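/- (L^p-convergence) Let n ≥ 2, p ∈ [1,∞], C₀ > 0, and let s be an integer with 0 ≤ s ≤ n. There exist constants d₀ ∈ (0,1) and C > 0 depending only on a, n, s, p, D, T and C₀ such that the following holds for all σ = 1/M and h = dσ with 0 < d ≤ d₀: let u₀ ∈ W^{s,p}(Ω), and suppose ũ₀ ∈ V_σ^{n+1}(Ω) satisfies ‖u₀ − ũ₀‖_{L^p(Ω)} ≤ C₀ σ^r ‖u₀‖_{W^{r,p}(Ω)} and ‖ũ₀‖_{W^{r,p}(Ω)} ≤ C₀ ‖u₀‖_{W^{r,p}(Ω)} for all integers 0 ≤ r ≤ min(s,n) (such ũ₀ exists, e.g. the spline quasi-interpolant of u₀). Set u_i := ũ₀(x_i(0)), let u(x,t) := u₀(X_{t→0}(x)) be the exact solution of ∂_t u + (a·∇)u = 0 with initial data u₀, and let u_{h,σ}(·,t) ∈ V_σ^n(Ω) satisfy Σ_{i=1}^N w_i u_{h,σ}(x_i(t)) v(x_i(t)) = Σ_{i=1}^N w_i u_i v(x_i(t)) for all v ∈ V_σ^n(Ω). Then for every t ∈ [0,T]: ‖u_{h,σ}(·,t) − u(·,t)‖_{L^p(Ω)}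 ≤ C σ^s ‖u₀‖_{W^{s,p}(Ω)}. -/

import Mathlib

open MeasureTheory
open scoped ENNReal NNReal

noncomputable section

/-- The open unit cube `Ω = (0,1)^D`. -/
def unitCube (D : ℕ) : Set (Fin D → ℝ) := {x | ∀ i, x i ∈ Set.Ioo (0 : ℝ) 1}

/-- The grid cell with multi-index `k` in the uniform partition of the unit cube into
`M^D` cubes of edge length `1/M`. -/
def cell (D M : ℕ) (k : Fin D → Fin M) : Set (Fin D → ℝ) :=
  {x | ∀ i, ((k i : ℕ) : ℝ) / M ≤ x i ∧ x i < (((k i : ℕ) : ℝ) + 1) / M}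

/-- Membership in the tensor-product spline space `V_σ^n(Ω)`, `σ = 1/M`: the function is
`C^{n-2}` on `Ω` and coincides on every grid cell with a polynomial of coordinate-wise
degree at most `n-1`. -/
def IsSpline (D M n : ℕ) (u : (Fin D → ℝ) → ℝ) : Prop :=
  ContDiffOn ℝ (n - 2 : ℕ) u (unitCube D) ∧
  ∀ k : Fin D → Fin M, ∃ p : MvPolynomial (Fin D) ℝ,
    (∀ i, p.degreeOf i ≤ n - 1) ∧ ∀ x ∈ cell D M k, u x = MvPolynomial.eval x p

/-- A smooth, bounded, divergence-free velocity field `a` on `Ω × [0,T]`, tangent to the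
boundary of the unit cube, together with its flow maps: `X τ t = X_{τ→t}`, so that
`X τ t x` is the position at time `t` of the trajectory passing through `x` at time `τ`. -/
structure FlowData (D : ℕ) (T : ℝ) where
  a : (Fin D → ℝ) → ℝ → (Fin D → ℝ)
  X : ℝ → ℝ → (Fin D → ℝ) → (Fin D → ℝ)
  smooth : ContDiff ℝ (⊤ : ℕ∞) (Function.uncurry a)
  bounded : ∃ B, ∀ x t, ‖a x t‖ ≤ B
  div_free : ∀ x t, ∑ i, fderiv ℝ (fun y => a y t i) x (Pi.single i 1) = 0
  tangent : ∀ t ∈ Set.Icc (0 : ℝ) T, ∀ x ∈ closure (unitCube D), ∀ i,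
      (x i = 0 ∨ x i = 1) → a x t i = 0
  flow_init : ∀ τ x, X τ τ x = x
  flow_ode : ∀ τ x t, HasDerivAt (fun s => X τ s x) (a (X τ t x) t) t
  flow_inv : ∀ τ t x, X t τ (X τ t x) = x

/-- The `W^{s,p}(Ω)` Sobolev norm, realised as the maximum over `k ≤ s` of the `L^p(Ω)`
norms of the derivatives of order `k`. -/
def sobolevNorm (D s : ℕ) (p : ℝ≥0∞) (u : (Fin D → ℝ) → ℝ) : ℝ≥0∞ :=
  (Finset.range (s + 1)).sup fun k =>
    eLpNorm (fun x => ‖iteratedFDeriv ℝ k u x‖) p (volume.restrict (unitCube D))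

namespace LPC
open Set Function

theorem hasDerivWithinAt_Ici_of_Icc {F : Type*} [NormedAddCommGroup F] [NormedSpace ℝ F]
    {W : ℝ → F} {w : F} {s : ℝ} (hs : s ∈ Ico (0:ℝ) 1)
    (h : HasDerivWithinAt W w (Icc 0 1) s) : HasDerivWithinAt W w (Ici s) s := by
  have h1 : HasDerivWithinAt W w (Icc s 1) s := h.mono (Icc_subset_Icc_left hs.1)
  exact h1.mono_of_mem_nhdsWithin (Icc_mem_nhdsGE hs.2)

theorem linear_ode {F : Type} [NormedAddCommGroup F] [NormedSpace ℝ F] [FiniteDimensional ℝ F]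
    (A : ℝ → F →L[ℝ] F) (hA : ContinuousOn A (Icc 0 1)) (w0 : F) :
    ∃ W : ℝ → F, W 0 = w0 ∧
      ∀ s ∈ Icc (0:ℝ) 1, HasDerivWithinAt W (A s (W s)) (Icc 0 1) s := by
  have : CompleteSpace F := FiniteDimensional.complete ℝ F
  obtain ⟨K, hK⟩ := isCompact_Icc.exists_bound_of_continuousOn hA
  have hK0 : 0 ≤ K := (norm_nonneg _).trans (hK 0 (by simp))
  set R : ℝ := ‖w0‖ * Real.exp K + 1 with hR
  have hRpos : 0 < R := by positivity
  let χ : ContDiffBump (0 : F) := ⟨R, R + 1, hRpos, by linarith⟩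
  let ψ : F → F := fun w => χ w • w
  have hψc : ContDiff ℝ 1 ψ := χ.contDiff.smul contDiff_id
  have hψs : HasCompactSupport ψ := χ.hasCompactSupport.smul_right
  obtain ⟨C, hC⟩ := hψc.lipschitzWith_of_hasCompactSupport hψs (by simp)
  have hψn : ∀ w, ‖ψ w‖ ≤ ‖w‖ := by
    intro w
    simp only [ψ, norm_smul, Real.norm_eq_abs, abs_of_nonneg χ.nonneg]
    exact mul_le_of_le_one_left (norm_nonneg _) χ.le_one
  have hψb : ∀ w, ‖ψ w‖ ≤ R + 1 := by
    intro w
    by_cases h : ‖w‖ ≤ R + 1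
    · exact (hψn w).trans h
    · have : χ w = 0 := χ.zero_of_le_dist (by simpa using (not_le.1 h).le)
      simp [ψ, this]; linarith
  have hψe : ∀ w, ‖w‖ ≤ R → ψ w = w := by
    intro w hw
    have : χ w = 1 := χ.one_of_mem_closedBall (by simpa using hw)
    simp [ψ, this]
  have hPL : IsPicardLindelof (fun s w => A s (ψ w)) (tmin := 0) (tmax := 1)
      ⟨0, by simp⟩ w0 (K.toNNReal * (R+1).toNNReal) 0 (K.toNNReal * (R+1).toNNReal)
      (K.toNNReal * C) := by
    constructor
    · intro t ht
      refine LipschitzWith.lipschitzOnWith ?_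
      refine LipschitzWith.comp (f := A t) (g := ψ) ?_ hC
      refine (A t).lipschitz.weaken ?_
      rw [← NNReal.coe_le_coe]; simpa [hK0] using hK t ht
    · intro x _
      exact hA.clm_apply continuousOn_const
    · intro t ht x _
      simp only [NNReal.coe_mul, Real.coe_toNNReal _ hK0, Real.coe_toNNReal _ (by linarith : 0 ≤ R+1)]
      refine ((A t).le_opNorm _).trans ?_
      exact mul_le_mul (hK t ht) (hψb x) (norm_nonneg _) hK0
    · simp
  obtain ⟨W, hW0, hW⟩ := hPL.exists_eq_forall_mem_Icc_hasDerivWithinAt₀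
  refine ⟨W, hW0, ?_⟩
  have hWb : ∀ s ∈ Icc (0:ℝ) 1, ‖W s‖ ≤ R := by
    intro s hs
    have := norm_le_gronwallBound_of_norm_deriv_right_le (f := W) (f' := fun s => A s (ψ (W s)))
      (δ := ‖w0‖) (K := K) (ε := 0) (a := 0) (b := 1)
      (fun s hs => (hW s hs).continuousWithinAt)
      (fun s hs => hasDerivWithinAt_Ici_of_Icc hs (hW s ⟨hs.1, hs.2.le⟩))
      (by rw [show W 0 = w0 from hW0]) (by
        intro s hs
        rw [add_zero]
        refine ((A s).le_opNorm _).trans ?_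
        exact mul_le_mul (hK s ⟨hs.1, hs.2.le⟩) (hψn _) (norm_nonneg _) hK0) s hs
    rw [gronwallBound_ε0, sub_zero] at this
    refine this.trans ?_
    have : Real.exp (K * s) ≤ Real.exp K := by
      apply Real.exp_le_exp.2; nlinarith [hs.2]
    nlinarith [norm_nonneg w0]
  intro s hs
  have := hW s hs
  simp only [hψe _ (hWb s hs)] at this
  exact this

/-- A family of trajectories of a smooth field on `[0,1]`. -/
structure IsFlow {E : Type} [NormedAddCommGroup E] [NormedSpace ℝ E]
    (f : ℝ → E → E) (Y : ℝ → E → E) : Prop where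
  smooth : ContDiff ℝ (⊤ : ℕ∞) (uncurry f)
  init : ∀ x, Y 0 x = x
  ode : ∀ x, ∀ s ∈ Icc (0:ℝ) 1, HasDerivWithinAt (fun s => Y s x) (f s (Y s x)) (Icc 0 1) s
  bdd : ∀ R : ℝ, ∃ R' : ℝ, ∀ x, ‖x‖ ≤ R → ∀ s ∈ Icc (0:ℝ) 1, ‖Y s x‖ ≤ R'

section
set_option linter.unusedSectionVars false
variable {E : Type} [NormedAddCommGroup E] [NormedSpace ℝ E] [FiniteDimensional ℝ E]

theorem smooth_slice {f : ℝ → E → E} (hf : ContDiff ℝ (⊤ : ℕ∞) (uncurry f)) (s : ℝ) :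
    ContDiff ℝ (⊤ : ℕ∞) (f s) := by
  have : f s = uncurry f ∘ (fun x => (s, x)) := rfl
  rw [this]; exact hf.comp (contDiff_prodMk_right s)

theorem smooth_fderiv {f : ℝ → E → E} (hf : ContDiff ℝ (⊤ : ℕ∞) (uncurry f)) :
    ContDiff ℝ (⊤ : ℕ∞) (fun q : ℝ × E => fderiv ℝ (f q.1) q.2) := by
  refine ContDiff.fderiv (f := fun q : ℝ × E => f q.1) (g := fun q => q.2) (n := (⊤ : ℕ∞)) (m := (⊤ : ℕ∞)) ?_ contDiff_snd (by norm_cast)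
  exact hf.comp ((contDiff_fst.comp contDiff_fst).prodMk contDiff_snd)

/-- uniform bounds of first derivative and Lipschitz constant of first derivative on a ball -/
theorem field_bounds {f : ℝ → E → E} (hf : ContDiff ℝ (⊤ : ℕ∞) (uncurry f)) (R : ℝ) :
    ∃ K : ℝ, 0 < K ∧ (∀ s ∈ Icc (0:ℝ) 1, ∀ x, ‖x‖ ≤ R → ‖fderiv ℝ (f s) x‖ ≤ K) ∧
      (∀ s ∈ Icc (0:ℝ) 1, ∀ x y, ‖x‖ ≤ R → ‖y‖ ≤ R → ‖f s x - f s y‖ ≤ K * ‖x - y‖) ∧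
      (∀ s ∈ Icc (0:ℝ) 1, ∀ x y, ‖x‖ ≤ R → ‖y‖ ≤ R →
        ‖f s x - f s y - fderiv ℝ (f s) y (x - y)‖ ≤ K * ‖x - y‖ ^ 2) := by
  have hc : IsCompact (Icc (0:ℝ) 1 ×ˢ Metric.closedBall (0:E) R) :=
    isCompact_Icc.prod (isCompact_closedBall _ _)
  have h1 := smooth_fderiv hf
  obtain ⟨K1, hK1⟩ := hc.exists_bound_of_continuousOn h1.continuous.continuousOn
  have h2 : ContDiff ℝ (⊤ : ℕ∞) (fun q : ℝ × E => fderiv ℝ (fderiv ℝ (f q.1)) q.2) := by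
    refine ContDiff.fderiv (f := fun q : ℝ × E => fderiv ℝ (f q.1)) (g := fun q => q.2) (n := (⊤ : ℕ∞)) (m := (⊤ : ℕ∞)) ?_ contDiff_snd (by norm_cast)
    exact h1.comp ((contDiff_fst.comp contDiff_fst).prodMk contDiff_snd)
  obtain ⟨K2, hK2⟩ := hc.exists_bound_of_continuousOn h2.continuous.continuousOn
  have hd : ∀ s, Differentiable ℝ (f s) := fun s => (smooth_slice hf s).differentiable (by simp)
  have hd2 : ∀ s, Differentiable ℝ (fderiv ℝ (f s)) := fun s =>
    ((smooth_slice hf s).fderiv_right (m := 1) (by norm_cast)).differentiable (by simp)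
  have hcv : Convex ℝ (Metric.closedBall (0:E) R) := convex_closedBall _ _
  refine ⟨max 1 (max K1 K2), by positivity, ?_, ?_, ?_⟩
  · intro s hs x hx
    exact (hK1 (s, x) ⟨hs, by simpa using hx⟩).trans (by simp)
  · intro s hs x y hx hy
    refine (hcv.norm_image_sub_le_of_norm_fderiv_le (𝕜 := ℝ) (C := K1) (fun z _ => hd s z) (fun z hz => hK1 (s, z) ⟨hs, hz⟩)
      (by simpa using hy) (by simpa using hx)).trans ?_
    gcongr; simp
  · intro s hs x y hx hy
    have hseg : segment ℝ y x ⊆ Metric.closedBall (0:E) R :=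
      hcv.segment_subset (by simpa using hy) (by simpa using hx)
    have hb : ∀ z ∈ segment ℝ y x, ‖fderiv ℝ (f s) z - fderiv ℝ (f s) y‖ ≤ K2 * ‖x - y‖ := by
      intro z hz
      have := hcv.norm_image_sub_le_of_norm_fderiv_le (𝕜 := ℝ) (C := K2) (f := fderiv ℝ (f s)) (fun z _ => hd2 s z)
        (fun z hz => hK2 (s, z) ⟨hs, hz⟩) (by simpa using hy) (hseg hz)
      refine this.trans ?_
      have h0 : 0 ≤ K2 := (norm_nonneg _).trans (hK2 (s, y) ⟨hs, by simpa using hy⟩)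
      gcongr
      exact norm_sub_le_of_mem_segment hz
    have := (convex_segment y x).norm_image_sub_le_of_norm_fderiv_le' (𝕜 := ℝ) (f := f s)
      (φ := fderiv ℝ (f s) y) (fun z _ => hd s z) hb (left_mem_segment ℝ y x) (right_mem_segment ℝ y x)
    refine this.trans ?_
    have : K2 ≤ max 1 (max K1 K2) := by simp
    nlinarith [mul_nonneg (norm_nonneg (x - y)) (norm_nonneg (x-y))]

theorem flow_tangent {f Y : ℝ → E → E} (h : IsFlow f Y) :
    ∃ W : E → ℝ → E →L[ℝ] E, (∀ x, ∀ s ∈ Icc (0:ℝ) 1, HasFDerivAt (Y s) (W x s) x) ∧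
      IsFlow (E := E × E) (fun s q => (f s q.1, fderiv ℝ (f s) q.1 q.2))
        (fun s q => (Y s q.1, W q.1 s q.2)) := by
  have hcont : ∀ x, ContinuousOn (fun s => Y s x) (Icc 0 1) :=
    fun x s hs => (h.ode x s hs).continuousWithinAt
  have hA : ∀ x, ContinuousOn (fun s => fderiv ℝ (f s) (Y s x)) (Icc 0 1) := fun x =>
    (smooth_fderiv h.smooth).continuous.comp_continuousOn (continuousOn_id.prodMk (hcont x))
  have hex : ∀ x, ∃ W : ℝ → E →L[ℝ] E, W 0 = ContinuousLinearMap.id ℝ E ∧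
      ∀ s ∈ Icc (0:ℝ) 1, HasDerivWithinAt W ((fderiv ℝ (f s) (Y s x)).comp (W s)) (Icc 0 1) s := by
    intro x
    exact linear_ode (F := E →L[ℝ] E)
      (fun s => ContinuousLinearMap.compL ℝ E E E (fderiv ℝ (f s) (Y s x)))
      ((ContinuousLinearMap.compL ℝ E E E).continuous.comp_continuousOn (hA x)) _
  choose W hW0 hW using hex
  have hWv : ∀ x v, ∀ s ∈ Icc (0:ℝ) 1,
      HasDerivWithinAt (fun s => W x s v) (fderiv ℝ (f s) (Y s x) (W x s v)) (Icc 0 1) s := by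
    intro x v s hs
    have := (hW x s hs).clm_apply (hasDerivWithinAt_const s (Icc (0:ℝ) 1) v)
    simpa using this
  refine ⟨W, ?_, ?_⟩
  · intro x s hs
    obtain ⟨R', hR'⟩ := h.bdd (‖x‖ + 1)
    obtain ⟨K, hKp, hK1, hK2, hK3⟩ := field_bounds h.smooth R'
    have key : ∀ x', ‖x' - x‖ ≤ 1 → ∀ s ∈ Icc (0:ℝ) 1, ‖Y s x' - Y s x‖ ≤ ‖x' - x‖ * Real.exp K := by
      intro x' hx' s hs
      have hx'' : ‖x'‖ ≤ ‖x‖ + 1 := by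
        calc ‖x'‖ = ‖x + (x' - x)‖ := by congr 1; abel
          _ ≤ _ := (norm_add_le _ _).trans (by linarith)
      have := dist_le_of_trajectories_ODE_of_mem (v := f) (K := K.toNNReal) (f := fun s => Y s x')
        (g := fun s => Y s x) (a := 0) (b := 1) (δ := ‖x' - x‖)
        (s := fun _ => Metric.closedBall (0:E) R')
        (fun s hs => LipschitzOnWith.of_dist_le_mul fun a ha b hb => by
          rw [dist_eq_norm, dist_eq_norm, Real.coe_toNNReal _ hKp.le]
          exact hK2 s ⟨hs.1, hs.2.le⟩ a b (by simpa using ha) (by simpa using hb))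
        (hcont x') (fun s hs => hasDerivWithinAt_Ici_of_Icc hs (h.ode x' s ⟨hs.1, hs.2.le⟩))
        (fun s hs => by simpa using hR' x' hx'' s ⟨hs.1, hs.2.le⟩)
        (hcont x) (fun s hs => hasDerivWithinAt_Ici_of_Icc hs (h.ode x s ⟨hs.1, hs.2.le⟩))
        (fun s hs => by simpa using hR' x (by linarith) s ⟨hs.1, hs.2.le⟩)
        (by simp [h.init, dist_eq_norm]) s hs
      rw [dist_eq_norm, Real.coe_toNNReal _ hKp.le] at this
      refine this.trans ?_
      have : Real.exp (K * (s - 0)) ≤ Real.exp K := by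
        apply Real.exp_le_exp.2; nlinarith [hs.2]
      gcongr
    set c : ℝ := K * Real.exp K ^ 2 with hc
    have key2 : ∀ x', ‖x' - x‖ ≤ 1 → ‖Y s x' - Y s x - W x s (x' - x)‖ ≤
        (c / K * (Real.exp K - 1)) * ‖x' - x‖ ^ 2 := by
      intro x' hx'
      have hx'' : ‖x'‖ ≤ ‖x‖ + 1 := by
        calc ‖x'‖ = ‖x + (x' - x)‖ := by congr 1; abel
          _ ≤ _ := (norm_add_le _ _).trans (by linarith)
      have hder : ∀ s ∈ Icc (0:ℝ) 1, HasDerivWithinAt (fun s => Y s x' - Y s x - W x s (x' - x))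
          (f s (Y s x') - f s (Y s x) - fderiv ℝ (f s) (Y s x) (W x s (x' - x))) (Icc 0 1) s :=
        fun s hs => ((h.ode x' s hs).sub (h.ode x s hs)).sub (hWv x (x' - x) s hs)
      have := norm_le_gronwallBound_of_norm_deriv_right_le
        (f := fun s => Y s x' - Y s x - W x s (x' - x))
        (f' := fun s => f s (Y s x') - f s (Y s x) - fderiv ℝ (f s) (Y s x) (W x s (x' - x)))
        (δ := 0) (K := K) (ε := c * ‖x' - x‖ ^ 2) (a := 0) (b := 1)
        (fun s hs => (hder s hs).continuousWithinAt)
        (fun s hs => hasDerivWithinAt_Ici_of_Icc hs (hder s ⟨hs.1, hs.2.le⟩))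
        (by simp [h.init, hW0]) (by
          intro s hs
          have hs' : s ∈ Icc (0:ℝ) 1 := ⟨hs.1, hs.2.le⟩
          have e1 : f s (Y s x') - f s (Y s x) - fderiv ℝ (f s) (Y s x) (W x s (x' - x)) =
            (f s (Y s x') - f s (Y s x) - fderiv ℝ (f s) (Y s x) (Y s x' - Y s x)) +
              fderiv ℝ (f s) (Y s x) (Y s x' - Y s x - W x s (x' - x)) := by
            simp only [map_sub]; abel
          rw [e1]
          have r1 := hR' x' hx'' s hs'
          have r2 := hR' x (by linarith) s hs'
          have b1 := hK3 s hs' _ _ r1 r2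
          have b2 := (fderiv ℝ (f s) (Y s x)).le_of_opNorm_le (hK1 s hs' _ r2)
            (Y s x' - Y s x - W x s (x' - x))
          have b3 := key x' hx' s hs'
          have b4 : ‖Y s x' - Y s x‖ ^ 2 ≤ (‖x' - x‖ * Real.exp K) ^ 2 := by gcongr
          refine (norm_add_le _ _).trans ?_
          have : K * ‖Y s x' - Y s x‖ ^ 2 ≤ c * ‖x' - x‖ ^ 2 := by
            calc _ ≤ K * (‖x' - x‖ * Real.exp K) ^ 2 := by gcongr
              _ = _ := by rw [hc]; ring
          linarith) s hs
      refine this.trans ?_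
      rw [gronwallBound_of_K_ne_0 hKp.ne']
      have hexp : Real.exp (K * (s - 0)) ≤ Real.exp K := by
        apply Real.exp_le_exp.2; nlinarith [hs.2]
      have hc0 : 0 ≤ c := by positivity
      calc _ = c * ‖x' - x‖ ^ 2 / K * (Real.exp (K * (s - 0)) - 1) := by ring
        _ ≤ c * ‖x' - x‖ ^ 2 / K * (Real.exp K - 1) := by gcongr
        _ = _ := by ring
    have hO : (fun x' => Y s x' - Y s x - W x s (x' - x)) =O[nhds x] fun x' => ‖x' - x‖ ^ 2 := by
      refine Asymptotics.IsBigO.of_bound (c / K * (Real.exp K - 1)) ?_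
      filter_upwards [Metric.closedBall_mem_nhds x one_pos] with x' hx'
      rw [mem_closedBall_iff_norm] at hx'
      simpa using key2 x' hx'
    have := hO.hasFDerivAt (𝕜 := ℝ) (n := 2) (by norm_num)
    have h3 := this.add (((W x s).hasFDerivAt (x := x)).add_const (Y s x - W x s x))
    simp only [zero_add] at h3
    refine h3.congr_of_eventuallyEq (Filter.Eventually.of_forall fun x' => ?_)
    simp
    abel
  · refine ⟨?_, ?_, ?_, ?_⟩
    · have := smooth_fderiv h.smooth
      have h1 : ContDiff ℝ (⊤:ℕ∞) (fun q : ℝ × E × E => f q.1 q.2.1) :=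
        h.smooth.comp (contDiff_fst.prodMk (contDiff_fst.comp contDiff_snd))
      have h2 : ContDiff ℝ (⊤:ℕ∞) (fun q : ℝ × E × E => fderiv ℝ (f q.1) q.2.1) :=
        this.comp (contDiff_fst.prodMk (contDiff_fst.comp contDiff_snd))
      exact h1.prodMk (h2.clm_apply (contDiff_snd.comp contDiff_snd))
    · intro q; simp [h.init, hW0]
    · intro q s hs
      exact (h.ode q.1 s hs).prodMk (hWv q.1 q.2 s hs)
    · intro R
      obtain ⟨R', hR'⟩ := h.bdd R
      obtain ⟨K, hKp, hK1, hK2, hK3⟩ := field_bounds h.smooth R'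
      refine ⟨max R' (R * Real.exp K), ?_⟩
      intro q hq s hs
      have hq1 : ‖q.1‖ ≤ R := (norm_fst_le q).trans hq
      have hq2 : ‖q.2‖ ≤ R := (norm_snd_le q).trans hq
      refine max_le_max (hR' _ hq1 s hs) ?_
      have := norm_le_gronwallBound_of_norm_deriv_right_le
        (f := fun s => W q.1 s q.2)
        (f' := fun s => fderiv ℝ (f s) (Y s q.1) (W q.1 s q.2))
        (δ := R) (K := K) (ε := 0) (a := 0) (b := 1)
        (fun s hs => (hWv q.1 q.2 s hs).continuousWithinAt)
        (fun s hs => hasDerivWithinAt_Ici_of_Icc hs (hWv q.1 q.2 s ⟨hs.1, hs.2.le⟩))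
        (by simpa [hW0] using hq2) (by
          intro s hs
          have hs' : s ∈ Icc (0:ℝ) 1 := ⟨hs.1, hs.2.le⟩
          rw [add_zero]
          exact (fderiv ℝ (f s) (Y s q.1)).le_of_opNorm_le (hK1 s hs' _ (hR' _ hq1 s hs')) _) s hs
      refine this.trans ?_
      rw [gronwallBound_ε0]
      have hexp : Real.exp (K * (s - 0)) ≤ Real.exp K := by
        apply Real.exp_le_exp.2; nlinarith [hs.2]
      have : 0 ≤ R := (norm_nonneg _).trans hq
      gcongr

end

theorem flow_contDiff (m : ℕ) : ∀ {E : Type} [NormedAddCommGroup E] [NormedSpace ℝ E]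
    [FiniteDimensional ℝ E] {f Y : ℝ → E → E}, IsFlow f Y → ∀ s ∈ Icc (0:ℝ) 1,
    ContDiff ℝ m (Y s) := by
  induction m with
  | zero =>
    intro E _ _ _ f Y h s hs
    obtain ⟨W, hW, -⟩ := flow_tangent h
    exact contDiff_zero.2 (continuous_iff_continuousAt.2 fun x => (hW x s hs).continuousAt)
  | succ m ih =>
    intro E _ _ _ f Y h s hs
    obtain ⟨W, hW, hF⟩ := flow_tangent h
    push_cast
    rw [contDiff_succ_iff_fderiv_apply]
    refine ⟨fun x => (hW x s hs).differentiableAt, by simp, fun v => ?_⟩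
    have h1 := ih hF s hs
    have h2 : ContDiff ℝ m (fun x => (W x s v)) :=
      contDiff_snd.comp (h1.comp (contDiff_id.prodMk contDiff_const))
    convert h2 using 2 with x
    rw [(hW x s hs).fderiv]

end LPC

namespace LPC
open Set Function

def ccube (D : ℕ) : Set (Fin D → ℝ) := {x | ∀ i, x i ∈ Icc (0:ℝ) 1}

theorem closure_unitCube (D : ℕ) : closure (unitCube D) = ccube D := by
  have h1 : unitCube D = Set.pi univ (fun _ => Ioo (0:ℝ) 1) := by ext; simp [unitCube]
  have h2 : ccube D = Set.pi univ (fun _ => Icc (0:ℝ) 1) := by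
    ext; simp only [ccube, Set.mem_ofPred_eq, Set.mem_pi, Set.mem_univ, forall_true_left]
  rw [h1, h2, closure_pi_set]
  congr 1; funext _; exact closure_Ioo (by norm_num)

theorem hasDerivAt_posSq (r : ℝ) : HasDerivAt (fun r : ℝ => (max r 0) ^ 2) (2 * max r 0) r := by
  rcases lt_trichotomy r 0 with h | h | h
  · have h1 : HasDerivAt (fun _ : ℝ => (0:ℝ)) 0 r := hasDerivAt_const _ _
    rw [max_eq_right h.le, mul_zero]
    refine h1.congr_of_eventuallyEq ?_
    filter_upwards [Iio_mem_nhds h] with y hy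
    simp [max_eq_right (le_of_lt (show y < 0 from hy))]
  · subst h
    simp only [max_self, mul_zero]
    rw [hasDerivAt_iff_isLittleO]
    have h2 : (fun x : ℝ => (max x 0)^2 - (max (0:ℝ) 0)^2 - (x - 0) • (0:ℝ)) =O[nhds 0] fun x => x^2 := by
      refine Asymptotics.IsBigO.of_bound 1 (Filter.Eventually.of_forall fun x => ?_)
      simp only [max_self, smul_zero, sub_zero, ne_eq, OfNat.ofNat_ne_zero, not_false_eq_true, zero_pow, one_mul]
      rw [Real.norm_of_nonneg (by positivity), Real.norm_of_nonneg (by positivity)]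
      rw [sq_le_sq, abs_of_nonneg (le_max_right x 0)]
      exact max_le (le_abs_self x) (abs_nonneg x)
    refine h2.trans_isLittleO ?_
    simpa using (Asymptotics.isLittleO_pow_id (𝕜 := ℝ) one_lt_two)
  · have h1 : HasDerivAt (fun r : ℝ => r ^ 2) (2 * r) r := by simpa using hasDerivAt_pow 2 r
    rw [max_eq_left h.le]
    refine h1.congr_of_eventuallyEq ?_
    filter_upwards [Ioi_mem_nhds h] with y hy
    simp [max_eq_left (le_of_lt (show 0 < y from hy))]

def clampR (r : ℝ) : ℝ := max 0 (min 1 r)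

theorem clampR_mem (r : ℝ) : clampR r ∈ Icc (0:ℝ) 1 := by
  unfold clampR; constructor <;> simp

theorem clampR_cases (r : ℝ) : r = clampR r ∨ clampR r = 0 ∨ clampR r = 1 := by
  unfold clampR; grind

theorem abs_clampR_le (r : ℝ) : |clampR r| ≤ |r| := by
  unfold clampR; grind

theorem hasDerivAt_clampSq (r : ℝ) :
    HasDerivAt (fun r : ℝ => (r - clampR r) ^ 2) (2 * (r - clampR r)) r := by
  have h1 := (hasDerivAt_posSq (r - 1)).comp r ((hasDerivAt_id r).sub_const 1)
  have h2 := (hasDerivAt_posSq (-r)).comp r ((hasDerivAt_id r).neg)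
  have h3 := h1.add h2
  have e : (fun r : ℝ => (r - clampR r) ^ 2) =
      (((fun r : ℝ => (max r 0) ^ 2) ∘ fun r => id r - 1) + ((fun r : ℝ => (max r 0) ^ 2) ∘ Neg.neg)) := by
    funext r
    simp only [Pi.add_apply, comp_apply, id]
    rcases le_total r 0 with h | h
    · rw [max_eq_right (by linarith), max_eq_left (by linarith)]; unfold clampR
      rw [min_eq_right (by linarith), max_eq_left (by linarith)]; ring
    rcases le_total r 1 with h' | h'
    · rw [max_eq_right (by linarith), max_eq_right (by linarith)]; unfold clampR
      rw [min_eq_right (by linarith), max_eq_right (by linarith)]; ring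
    · rw [max_eq_left (by linarith), max_eq_right (by linarith)]; unfold clampR
      rw [min_eq_left (by linarith), max_eq_right (by linarith)]; ring
  rw [e]
  refine h3.congr_deriv ?_
  rcases le_total r 0 with h | h
  · rw [max_eq_right (by simp; linarith), max_eq_left (by simp; linarith)]; unfold clampR
    rw [min_eq_right (by linarith), max_eq_left (by linarith)]; ring
  rcases le_total r 1 with h' | h'
  · rw [max_eq_right (by simp; linarith), max_eq_right (by simp; linarith)]; unfold clampR
    rw [min_eq_right (by linarith), max_eq_right (by linarith)]; ring
  · rw [max_eq_left (by simp; linarith), max_eq_right (by simp; linarith)]; unfold clampR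
    rw [min_eq_left (by linarith), max_eq_right (by linarith)]; simp

section
variable {D : ℕ} {f : ℝ → (Fin D → ℝ) → (Fin D → ℝ)} {g : ℝ → (Fin D → ℝ)}

theorem cube_closed (hf : ContDiff ℝ (⊤ : ℕ∞) (uncurry f))
    (ht : ∀ s ∈ Icc (0:ℝ) 1, ∀ x ∈ ccube D, ∀ i, (x i = 0 ∨ x i = 1) → f s x i = 0)
    (hg : ∀ s ∈ Icc (0:ℝ) 1, HasDerivWithinAt g (f s (g s)) (Icc 0 1) s) (h0 : g 0 ∈ ccube D) :
    ∀ s ∈ Icc (0:ℝ) 1, g s ∈ ccube D := by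
  obtain ⟨R, hR⟩ := isCompact_Icc.exists_bound_of_continuousOn
    (fun s hs => (hg s hs).continuousWithinAt : ContinuousOn g (Icc 0 1))
  obtain ⟨K, hKp, -, hK, -⟩ := field_bounds hf R
  have hgi : ∀ s ∈ Icc (0:ℝ) 1, ∀ i, HasDerivWithinAt (fun s => g s i) (f s (g s) i) (Icc 0 1) s :=
    fun s hs => hasDerivWithinAt_pi.1 (hg s hs)
  set e : ℝ → ℝ := fun s => ∑ i, (g s i - clampR (g s i)) ^ 2 with he
  have hed : ∀ s ∈ Icc (0:ℝ) 1, HasDerivWithinAt e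
      (∑ i, 2 * (g s i - clampR (g s i)) * f s (g s) i) (Icc 0 1) s := by
    intro s hs
    have := HasDerivWithinAt.sum (u := Finset.univ) (fun i _ => (hasDerivAt_clampSq (g s i)).comp_hasDerivWithinAt s (hgi s hs i))
    refine this.congr_of_eventuallyEq (Filter.Eventually.of_forall fun s => ?_) ?_ <;> simp [he]
  have hb : ∀ s ∈ Icc (0:ℝ) 1, ‖∑ i, 2 * (g s i - clampR (g s i)) * f s (g s) i‖ ≤ (2 * K * D) * ‖e s‖ := by
    intro s hs
    have e0 : 0 ≤ e s := Finset.sum_nonneg fun i _ => sq_nonneg _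
    rw [Real.norm_of_nonneg e0]
    set c : Fin D → ℝ := fun i => clampR (g s i)
    have hcn : ‖c‖ ≤ R := by
      refine le_trans ?_ (hR s hs)
      rw [pi_norm_le_iff_of_nonneg (norm_nonneg _)]
      exact fun i => (abs_clampR_le _).trans (norm_le_pi_norm (g s) i)
    have h1 := hK s hs (g s) c (hR s hs) hcn
    have h2 : ‖g s - c‖ ^ 2 ≤ e s := by
      have hs1 : ‖g s - c‖ ≤ Real.sqrt (e s) := by
        rw [pi_norm_le_iff_of_nonneg (Real.sqrt_nonneg _)]
        intro i
        refine Real.abs_le_sqrt ?_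
        exact Finset.single_le_sum (f := fun i => (g s i - clampR (g s i)) ^ 2) (fun i _ => sq_nonneg _) (Finset.mem_univ i)
      calc ‖g s - c‖ ^ 2 ≤ Real.sqrt (e s) ^ 2 := by gcongr
        _ = e s := Real.sq_sqrt e0
    have h3 : ∀ i, ‖2 * (g s i - clampR (g s i)) * f s (g s) i‖ ≤ 2 * K * e s := by
      intro i
      have hz : (g s i - c i) * f s c i = 0 := by
        rcases clampR_cases (g s i) with h | h
        · simp [c, ← h]
        · rw [ht s hs c (fun i => clampR_mem _) i h, mul_zero]
      have : 2 * (g s i - clampR (g s i)) * f s (g s) i = 2 * ((g s i - c i) * (f s (g s) i - f s c i)) := by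
        have hz' : (g s i - clampR (g s i)) * f s c i = 0 := hz
        show _ = 2 * ((g s i - clampR (g s i)) * (f s (g s) i - f s c i))
        linear_combination (2:ℝ) * hz'
      rw [this, norm_mul, norm_mul]
      have a1 := norm_le_pi_norm (g s - c) i
      have a2 := norm_le_pi_norm (f s (g s) - f s c) i
      simp only [Pi.sub_apply] at a1 a2
      rw [Real.norm_of_nonneg (by norm_num : (0:ℝ) ≤ 2)]
      calc 2 * (‖g s i - c i‖ * ‖f s (g s) i - f s c i‖) ≤ 2 * (‖g s - c‖ * (K * ‖g s - c‖)) := by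
            gcongr; exact a2.trans h1
        _ = 2 * K * ‖g s - c‖ ^ 2 := by ring
        _ ≤ _ := by gcongr
    refine (norm_sum_le _ _).trans ((Finset.sum_le_sum fun i _ => h3 i).trans ?_)
    simp; linarith
  intro s hs
  have := norm_le_gronwallBound_of_norm_deriv_right_le (f := e)
    (f' := fun s => ∑ i, 2 * (g s i - clampR (g s i)) * f s (g s) i)
    (δ := 0) (K := 2 * K * D) (ε := 0) (a := 0) (b := 1)
    (fun s hs => (hed s hs).continuousWithinAt)
    (fun s hs => hasDerivWithinAt_Ici_of_Icc hs (hed s ⟨hs.1, hs.2.le⟩))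
    (by
      have : e 0 = 0 := Finset.sum_eq_zero fun i _ => by
        have := h0 i
        simp [clampR, this.1, this.2]
      simp [this]) (fun s hs => by simpa using hb s ⟨hs.1, hs.2.le⟩) s hs
  rw [gronwallBound_ε0, zero_mul] at this
  have h4 : e s = 0 := norm_le_zero_iff.1 this
  intro i
  have h5 := (Finset.sum_eq_zero_iff_of_nonneg (fun i _ => sq_nonneg _)).1 h4 i (Finset.mem_univ i)
  have h6 : g s i = clampR (g s i) := by
    have := pow_eq_zero_iff (two_ne_zero) |>.1 h5
    linarith
  rw [h6]; exact clampR_mem _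

theorem cube_face (hf : ContDiff ℝ (⊤ : ℕ∞) (uncurry f))
    (ht : ∀ s ∈ Icc (0:ℝ) 1, ∀ x ∈ ccube D, ∀ i, (x i = 0 ∨ x i = 1) → f s x i = 0)
    (hg : ∀ s ∈ Icc (0:ℝ) 1, HasDerivWithinAt g (f s (g s)) (Icc 0 1) s) (h0 : g 0 ∈ ccube D)
    (v : ℝ) (hv : v = 0 ∨ v = 1) (i : Fin D) (hi : g 0 i = v) :
    ∀ s ∈ Icc (0:ℝ) 1, g s i = v := by
  have hcl := cube_closed hf ht hg h0
  obtain ⟨K, hKp, -, hK, -⟩ := field_bounds hf 1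
  have hn : ∀ x ∈ ccube D, ‖x‖ ≤ 1 := fun x hx => by
    rw [pi_norm_le_iff_of_nonneg zero_le_one]
    exact fun i => by rw [Real.norm_of_nonneg (hx i).1]; exact (hx i).2
  have hgi : ∀ s ∈ Icc (0:ℝ) 1, HasDerivWithinAt (fun s => g s i - v) (f s (g s) i) (Icc 0 1) s :=
    fun s hs => (hasDerivWithinAt_pi.1 (hg s hs) i).sub_const v
  intro s hs
  have := norm_le_gronwallBound_of_norm_deriv_right_le (f := fun s => g s i - v)
    (f' := fun s => f s (g s) i)
    (δ := 0) (K := K) (ε := 0) (a := 0) (b := 1)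
    (fun s hs => (hgi s hs).continuousWithinAt)
    (fun s hs => hasDerivWithinAt_Ici_of_Icc hs (hgi s ⟨hs.1, hs.2.le⟩))
    (by simp [hi]) (by
      intro s hs
      have hs' : s ∈ Icc (0:ℝ) 1 := ⟨hs.1, hs.2.le⟩
      have hu : update (g s) i v ∈ ccube D := by
        intro j
        by_cases h : j = i
        · subst h; rcases hv with h | h <;> simp [h]
        · simpa [h] using hcl s hs' j
      have h1 := hK s hs' (g s) _ (hn _ (hcl s hs')) (hn _ hu)
      have h2 := ht s hs' _ hu i (by simpa using hv)
      have a2 := norm_le_pi_norm (f s (g s) - f s (update (g s) i v)) i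
      rw [Pi.sub_apply, h2, sub_zero] at a2
      rw [add_zero]
      refine a2.trans (h1.trans ?_)
      gcongr
      rw [pi_norm_le_iff_of_nonneg (norm_nonneg _)]
      intro j
      by_cases h : j = i
      · subst h; simp
      · simp [h]) s hs
  rw [gronwallBound_ε0, zero_mul] at this
  have := norm_le_zero_iff.1 this
  linarith

end

section
variable {D : ℕ} {T : ℝ} (F : FlowData D T)

theorem field_smooth (c τ₀ τ₁ : ℝ) :
    ContDiff ℝ (⊤ : ℕ∞) (uncurry (fun (s : ℝ) (x : Fin D → ℝ) => c • F.a x (τ₀ + τ₁ * s))) := by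
  have : ContDiff ℝ (⊤ : ℕ∞) (fun q : ℝ × (Fin D → ℝ) => (q.2, τ₀ + τ₁ * q.1)) :=
    contDiff_snd.prodMk (contDiff_const.add (contDiff_const.mul contDiff_fst))
  exact (F.smooth.comp this).const_smul c

theorem traj (τ t : ℝ) (x : Fin D → ℝ) (s : ℝ) :
    HasDerivAt (fun s => F.X τ (τ + (t - τ) * s) x)
      ((t - τ) • F.a (F.X τ (τ + (t - τ) * s) x) (τ + (t - τ) * s)) s := by
  have h1 : HasDerivAt (fun s : ℝ => τ + (t - τ) * s) (t - τ) s := by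
    simpa using ((hasDerivAt_id s).const_mul (t - τ)).const_add τ
  exact (F.flow_ode τ x (τ + (t-τ)*s)).scomp s h1

theorem tangent' {τ t : ℝ} (hτ : τ ∈ Icc 0 T) (ht : t ∈ Icc 0 T) : ∀ s ∈ Icc (0:ℝ) 1, ∀ x ∈ ccube D, ∀ i,
    (x i = 0 ∨ x i = 1) → (fun (s : ℝ) (x : Fin D → ℝ) => (t - τ) • F.a x (τ + (t - τ) * s)) s x i = 0 := by
  intro s hs x hx i hi
  have hm : τ + (t - τ) * s ∈ Icc 0 T := by
    have := hs.1; have := hs.2; have := ht.1; have := ht.2; have := hτ.1; have := hτ.2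
    constructor <;> nlinarith
  simp [F.tangent _ hm x (by rwa [closure_unitCube]) i hi]

theorem flow_ccube {τ t : ℝ} (hτ : τ ∈ Icc 0 T) (ht : t ∈ Icc 0 T) {x : Fin D → ℝ} (hx : x ∈ ccube D) :
    F.X τ t x ∈ ccube D := by
  have := cube_closed (field_smooth F (t - τ) τ (t - τ)) (tangent' F hτ ht)
    (g := fun s => F.X τ (τ + (t - τ) * s) x)
    (fun s _ => (traj F τ t x s).hasDerivWithinAt) (by simpa [F.flow_init] using hx) 1 (by simp)
  simpa using this

theorem flow_face {τ t : ℝ} (hτ : τ ∈ Icc 0 T) (ht : t ∈ Icc 0 T) {x : Fin D → ℝ} (hx : x ∈ ccube D)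
    (v : ℝ) (hv : v = 0 ∨ v = 1) (i : Fin D) : F.X τ t x i = v ↔ x i = v := by
  have key : ∀ {τ t : ℝ}, τ ∈ Icc 0 T → t ∈ Icc 0 T → ∀ {x : Fin D → ℝ}, x ∈ ccube D → 
      x i = v → F.X τ t x i = v := by
    intro τ t hτ ht x hx hi
    have := cube_face (field_smooth F (t - τ) τ (t - τ)) (tangent' F hτ ht)
      (g := fun s => F.X τ (τ + (t - τ) * s) x)
      (fun s _ => (traj F τ t x s).hasDerivWithinAt) (by simpa [F.flow_init] using hx) v hv i
      (by simpa [F.flow_init] using hi) 1 (by simp)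
    simpa using this
  refine ⟨fun h => ?_, key hτ ht hx⟩
  have := key ht hτ (flow_ccube F hτ ht hx) h
  rwa [F.flow_inv] at this

/-- half-open cube -/
def hcube (D : ℕ) : Set (Fin D → ℝ) := {x | ∀ i, x i ∈ Ico (0:ℝ) 1}

theorem flow_hcube {τ t : ℝ} (hτ : τ ∈ Icc 0 T) (ht : t ∈ Icc 0 T) {x : Fin D → ℝ} (hx : x ∈ hcube D) :
    F.X τ t x ∈ hcube D := by
  have hx' : x ∈ ccube D := fun i => ⟨(hx i).1, (hx i).2.le⟩
  intro i
  refine ⟨(flow_ccube F hτ ht hx' i).1, lt_of_le_of_ne (flow_ccube F hτ ht hx' i).2 ?_⟩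
  rw [Ne, flow_face F hτ ht hx' 1 (Or.inr rfl)]
  exact (hx i).2.ne

theorem flow_unitCube {τ t : ℝ} (hτ : τ ∈ Icc 0 T) (ht : t ∈ Icc 0 T) {x : Fin D → ℝ} (hx : x ∈ unitCube D) :
    F.X τ t x ∈ unitCube D := by
  have hx' : x ∈ ccube D := fun i => ⟨(hx i).1.le, (hx i).2.le⟩
  intro i
  refine ⟨lt_of_le_of_ne (flow_ccube F hτ ht hx' i).1 (Ne.symm ?_), (flow_hcube F hτ ht (fun i => ⟨(hx i).1.le, (hx i).2⟩) i).2⟩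
  rw [Ne, flow_face F hτ ht hx' 0 (Or.inl rfl)]
  exact (hx i).1.ne'

theorem flow_bdd : ∃ B : ℝ, 0 ≤ B ∧ ∀ τ t x, ‖F.X τ t x - x‖ ≤ B * |t - τ| := by
  obtain ⟨B, hB⟩ := F.bounded
  refine ⟨max B 0, le_max_right _ _, fun τ t x => ?_⟩
  have := Convex.norm_image_sub_le_of_norm_hasDerivWithin_le (f := fun s => F.X τ s x)
    (f' := fun s => F.a (F.X τ s x) s) (s := univ) (C := max B 0) (x := τ) (y := t)
    (fun s _ => (F.flow_ode τ x s).hasDerivWithinAt) (fun s _ => (hB _ _).trans (le_max_left _ _))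
    convex_univ (mem_univ _) (mem_univ _)
  simpa [F.flow_init] using this

theorem flow_smooth_gen (β γ : ℝ) (m : ℕ) :
    ContDiff ℝ m (fun q : (Fin D → ℝ) × ℝ => F.X (β * q.2) (γ * q.2) q.1) := by
  obtain ⟨B, hB0, hB⟩ := flow_bdd F
  have hfl : IsFlow (E := (Fin D → ℝ) × ℝ)
      (fun s q => (((γ - β) * q.2) • F.a q.1 (β * q.2 + (γ - β) * q.2 * s), 0))
      (fun s q => (F.X (β * q.2) (β * q.2 + (γ - β) * q.2 * s) q.1, q.2)) := by
    refine ⟨?_, ?_, ?_, ?_⟩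
    · refine ContDiff.prodMk ?_ contDiff_const
      have h2 : ContDiff ℝ (⊤:ℕ∞) (fun q : ℝ × ((Fin D → ℝ) × ℝ) => q.2.2) := contDiff_snd.comp contDiff_snd
      have h1 : ContDiff ℝ (⊤:ℕ∞) (fun q : ℝ × ((Fin D → ℝ) × ℝ) => F.a q.2.1 (β * q.2.2 + (γ - β) * q.2.2 * q.1)) :=
        F.smooth.comp ((contDiff_fst.comp contDiff_snd).prodMk
          ((contDiff_const.mul h2).add ((contDiff_const.mul h2).mul contDiff_fst)))
      exact (contDiff_const.mul h2).smul h1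
    · intro q; simp [F.flow_init]
    · intro q s hs
      have := traj F (β * q.2) (γ * q.2) q.1 s
      rw [← sub_mul] at this
      exact (this.prodMk (hasDerivAt_const s q.2)).hasDerivWithinAt
    · intro R
      refine ⟨R + B * (|γ - β| * R), fun q hq s hs => ?_⟩
      have hq1 : ‖q.1‖ ≤ R := (norm_fst_le q).trans hq
      have hq2 : |q.2| ≤ R := (norm_snd_le q).trans hq
      have hR : 0 ≤ R := (norm_nonneg _).trans hq
      have h1 := hB (β * q.2) (β * q.2 + (γ - β) * q.2 * s) q.1
      have h2 : |β * q.2 + (γ - β) * q.2 * s - β * q.2| ≤ |γ - β| * R := by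
        rw [add_sub_cancel_left, abs_mul, abs_mul, abs_of_nonneg hs.1]
        calc |γ - β| * |q.2| * s ≤ |γ - β| * R * 1 := by
              have := hs.1; have := hs.2; gcongr
          _ = _ := by ring
      refine max_le ?_ (le_trans hq2 (by nlinarith [mul_nonneg hB0 (mul_nonneg (abs_nonneg (γ - β)) hR)]))
      have h3 := norm_le_norm_add_norm_sub' (F.X (β * q.2) (β * q.2 + (γ - β) * q.2 * s) q.1) q.1
      have h4 : B * |β * q.2 + (γ - β) * q.2 * s - β * q.2| ≤ B * (|γ - β| * R) := by gcongr
      linarith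
  have := contDiff_fst.comp (flow_contDiff m hfl 1 (by simp))
  convert this using 2 with q
  simp only [comp_apply]
  congr 1; ring

end
end LPC

namespace LPC
open Set Function

theorem convex_ccube (D : ℕ) : Convex ℝ (ccube D) := by
  rw [← closure_unitCube]
  have h1 : unitCube D = Set.pi univ (fun _ => Ioo (0:ℝ) 1) := by ext; simp [unitCube]
  rw [h1]
  exact (convex_pi fun i _ => convex_Ioo 0 1).closure

theorem isCompact_ccube (D : ℕ) : IsCompact (ccube D) := by
  have h2 : ccube D = Set.pi univ (fun _ => Icc (0:ℝ) 1) := by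
    ext; simp only [ccube, Set.mem_ofPred_eq, Set.mem_pi, Set.mem_univ, forall_true_left]
  rw [h2]; exact isCompact_univ_pi fun i => isCompact_Icc

theorem hcube_sub (D : ℕ) : hcube D ⊆ ccube D := fun _ hx i => ⟨(hx i).1, (hx i).2.le⟩

theorem unitCube_sub (D : ℕ) : unitCube D ⊆ hcube D := fun _ hx i => ⟨(hx i).1.le, (hx i).2⟩

structure GoodMap (D n : ℕ) (L : ℝ) (Φ Ψ : (Fin D → ℝ) → (Fin D → ℝ)) : Prop where
  one_le : 1 ≤ L
  inv1 : ∀ x, Φ (Ψ x) = x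
  inv2 : ∀ x, Ψ (Φ x) = x
  hc1 : ∀ x ∈ hcube D, Φ x ∈ hcube D
  hc2 : ∀ x ∈ hcube D, Ψ x ∈ hcube D
  uc1 : ∀ x ∈ unitCube D, Φ x ∈ unitCube D
  uc2 : ∀ x ∈ unitCube D, Ψ x ∈ unitCube D
  smooth1 : ContDiff ℝ n Φ
  cont2 : Continuous Ψ
  bound : ∀ x ∈ ccube D, ∀ i ≤ n, ‖iteratedFDeriv ℝ i Φ x‖ ≤ L
  lip1 : ∀ x ∈ ccube D, ∀ y ∈ ccube D, ‖Φ x - Φ y‖ ≤ L * ‖x - y‖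
  lip2 : ∀ x ∈ ccube D, ∀ y ∈ ccube D, ‖Ψ x - Ψ y‖ ≤ L * ‖x - y‖

theorem iter_bound {D : ℕ} (m : ℕ) (T : ℝ) (G : (Fin D → ℝ) × ℝ → (Fin D → ℝ)) (hG : ContDiff ℝ m G) :
    ∃ L : ℝ, 1 ≤ L ∧ ∀ t ∈ Icc (0:ℝ) T, ∀ x ∈ ccube D, ∀ i ≤ m,
      ‖iteratedFDeriv ℝ i (fun x => G (x, t)) x‖ ≤ L := by
  have hex : ∀ i : ℕ, ∃ L : ℝ, i ≤ m → ∀ q ∈ ccube D ×ˢ Icc (0:ℝ) T, ‖iteratedFDeriv ℝ i G q‖ ≤ L := by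
    intro i
    by_cases hi : i ≤ m
    · obtain ⟨L, hL⟩ := ((isCompact_ccube D).prod (isCompact_Icc (a := (0:ℝ)) (b := T))).exists_bound_of_continuousOn
        (hG.continuous_iteratedFDeriv (m := i) (by exact_mod_cast hi)).continuousOn
      exact ⟨L, fun _ => hL⟩
    · exact ⟨0, fun h => absurd h hi⟩
  choose L hL using hex
  refine ⟨max 1 (∑ i ∈ Finset.range (m+1), max (L i) 0), le_max_left _ _, ?_⟩
  intro t ht x hx i hi
  refine le_trans ?_ (le_max_right _ _)
  refine le_trans ?_ (Finset.single_le_sum (f := fun i => max (L i) 0) (fun i _ => le_max_right _ _) (Finset.mem_range.2 (Nat.lt_succ_of_le hi)))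
  refine le_trans ?_ (le_max_left _ _)
  have h1 : (fun x => G (x, t)) = (fun z => G (z + (0, t))) ∘ (ContinuousLinearMap.inl ℝ (Fin D → ℝ) ℝ) := by
    funext x; simp
  have hG' : ContDiff ℝ m (fun z => G (z + (0, t))) := hG.comp (contDiff_id.add contDiff_const)
  rw [h1, ContinuousLinearMap.iteratedFDeriv_comp_right _ hG' x (by exact_mod_cast hi), iteratedFDeriv_comp_add_right]
  refine (ContinuousMultilinearMap.norm_compContinuousLinearMap_le _ _).trans ?_
  have h2 : ‖iteratedFDeriv ℝ i G (ContinuousLinearMap.inl ℝ (Fin D → ℝ) ℝ x + (0, t))‖ ≤ L i := by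
    refine hL i hi _ ?_
    simp; exact ⟨hx, ht⟩
  have h3 : ∏ _j : Fin i, ‖ContinuousLinearMap.inl ℝ (Fin D → ℝ) ℝ‖ ≤ 1 := by
    apply Finset.prod_le_one (fun _ _ => norm_nonneg _)
    intro _ _; exact ContinuousLinearMap.norm_inl_le_one ℝ _ _
  calc _ ≤ L i * 1 := mul_le_mul h2 h3 (Finset.prod_nonneg fun _ _ => norm_nonneg _) ((norm_nonneg _).trans h2)
    _ = _ := mul_one _

theorem lip_of_bound {D : ℕ} {L : ℝ} {Φ : (Fin D → ℝ) → (Fin D → ℝ)} (h : ContDiff ℝ 1 Φ)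
    (hb : ∀ x ∈ ccube D, ‖iteratedFDeriv ℝ 1 Φ x‖ ≤ L) :
    ∀ x ∈ ccube D, ∀ y ∈ ccube D, ‖Φ x - Φ y‖ ≤ L * ‖x - y‖ := by
  intro x hx y hy
  refine (convex_ccube D).norm_image_sub_le_of_norm_fderiv_le (𝕜 := ℝ)
    (fun z _ => h.differentiable (by simp) z) (fun z hz => ?_) hy hx
  rw [← norm_iteratedFDeriv_one]; exact hb z hz

theorem exists_goodMap {D : ℕ} {T : ℝ} (hT : 0 < T) (F : FlowData D T) (n : ℕ) (hn : 1 ≤ n) :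
    ∃ L : ℝ, ∀ t ∈ Icc (0:ℝ) T, GoodMap D n L (F.X t 0) (F.X 0 t) := by
  have hs1 : ContDiff ℝ n (fun q : (Fin D → ℝ) × ℝ => F.X q.2 0 q.1) := by
    simpa using flow_smooth_gen F 1 0 n
  have hs2 : ContDiff ℝ n (fun q : (Fin D → ℝ) × ℝ => F.X 0 q.2 q.1) := by
    simpa using flow_smooth_gen F 0 1 n
  obtain ⟨L1, h1, hL1⟩ := iter_bound n T _ hs1
  obtain ⟨L2, h2, hL2⟩ := iter_bound n T _ hs2
  refine ⟨max L1 L2, fun t ht => ?_⟩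
  have h0 : (0:ℝ) ∈ Icc 0 T := ⟨le_rfl, hT.le⟩
  have c1 : ContDiff ℝ n (F.X t 0) := hs1.comp (contDiff_id.prodMk (contDiff_const (c := t)))
  have c2 : ContDiff ℝ n (F.X 0 t) := hs2.comp (contDiff_id.prodMk (contDiff_const (c := t)))
  refine ⟨le_max_of_le_left h1, fun x => F.flow_inv _ _ _, fun x => F.flow_inv _ _ _,
    fun x hx => flow_hcube F ht h0 hx, fun x hx => flow_hcube F h0 ht hx,
    fun x hx => flow_unitCube F ht h0 hx, fun x hx => flow_unitCube F h0 ht hx,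
    c1, c2.continuous, fun x hx i hi => (hL1 t ht x hx i hi).trans (le_max_left _ _), ?_, ?_⟩
  · exact lip_of_bound (c1.of_le (by exact_mod_cast hn))
      (fun x hx => (hL1 t ht x hx 1 hn).trans (le_max_left _ _))
  · exact lip_of_bound (c2.of_le (by exact_mod_cast hn))
      (fun x hx => (hL2 t ht x hx 1 hn).trans (le_max_right _ _))

theorem measurableSet_unitCube (D : ℕ) : MeasurableSet (unitCube D) := by
  have h1 : unitCube D = Set.pi univ (fun _ => Ioo (0:ℝ) 1) := by ext; simp [unitCube]
  rw [h1]; exact MeasurableSet.univ_pi fun _ => measurableSet_Ioo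

theorem comp_eLpNorm {D n : ℕ} {L : ℝ} {Φ Ψ : (Fin D → ℝ) → (Fin D → ℝ)} (h : GoodMap D n L Φ Ψ)
    (p : ℝ≥0∞) (hp : 1 ≤ p) (f : (Fin D → ℝ) → ℝ) :
    eLpNorm (fun x => f (Φ x)) p (volume.restrict (unitCube D)) ≤
      ENNReal.ofReal (L ^ D) * eLpNorm f p (volume.restrict (unitCube D)) := by
  let e : (Fin D → ℝ) ≃ₜ (Fin D → ℝ) := ⟨⟨Φ, Ψ, h.inv2, h.inv1⟩, h.smooth1.continuous, h.cont2⟩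
  have hL0 : 0 ≤ L := by linarith [h.one_le]
  have hm : Measure.map Φ (volume.restrict (unitCube D)) ≤
      ENNReal.ofReal (L ^ D) • volume.restrict (unitCube D) := by
    refine Measure.le_iff.2 fun s hs => ?_
    rw [Measure.map_apply h.smooth1.continuous.measurable hs, Measure.smul_apply,
      Measure.restrict_apply hs, Measure.restrict_apply (h.smooth1.continuous.measurable hs)]
    have h1 : Φ ⁻¹' s ∩ unitCube D = Ψ '' (s ∩ unitCube D) := by
      ext x; constructor
      · rintro ⟨hx, hx'⟩; exact ⟨Φ x, ⟨hx, h.uc1 x hx'⟩, h.inv2 x⟩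
      · rintro ⟨y, ⟨hy, hy'⟩, rfl⟩
        exact ⟨by simpa [h.inv1] using hy, h.uc2 y hy'⟩
    rw [h1]
    have hl : LipschitzOnWith L.toNNReal Ψ (s ∩ unitCube D) := by
      refine LipschitzOnWith.of_dist_le_mul fun a ha b hb => ?_
      rw [dist_eq_norm, dist_eq_norm, Real.coe_toNNReal _ hL0]
      exact h.lip2 a (hcube_sub D (unitCube_sub D ha.2)) b (hcube_sub D (unitCube_sub D hb.2))
    have h2 := hl.hausdorffMeasure_image_le (d := (Fintype.card (Fin D) : ℝ)) (by positivity)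
    rw [hausdorffMeasure_pi_real] at h2
    refine h2.trans (le_of_eq ?_)
    rw [smul_eq_mul]; congr 1
    rw [ENNReal.ofReal_pow hL0]; simp [ENNReal.ofReal]
  have h3 : eLpNorm (fun x => f (Φ x)) p (volume.restrict (unitCube D)) =
      eLpNorm f p (Measure.map Φ (volume.restrict (unitCube D))) :=
    (MeasurableEmbedding.eLpNorm_map_measure e.measurableEmbedding).symm
  rw [h3]
  refine (eLpNorm_mono_measure f hm).trans ?_
  have hLD : (1:ℝ≥0∞) ≤ ENNReal.ofReal (L^D) := by
    rw [← ENNReal.ofReal_one]; exact ENNReal.ofReal_le_ofReal (one_le_pow₀ h.one_le)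
  rw [eLpNorm_smul_measure_of_ne_zero (by positivity), smul_eq_mul]
  gcongr
  calc _ ≤ ENNReal.ofReal (L^D) ^ (1:ℝ) := by
        refine ENNReal.rpow_le_rpow_of_exponent_le hLD ?_
        rcases eq_or_ne p ⊤ with rfl | hpt
        · simp
        · rw [ENNReal.toReal_div]; simp
          refine inv_le_one_of_one_le₀ ?_
          exact (ENNReal.toReal_mono hpt hp).trans' (by simp)
    _ = _ := by simp

end LPC

namespace LPC
open Set Function

/-- Lagrange nodes in `(0,1)` -/
def nd (N : ℕ) (l : Fin (N+1)) : ℝ := ((l:ℕ) + 1 : ℝ) / (N + 2)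

theorem nd_mem (N : ℕ) (l : Fin (N+1)) : nd N l ∈ Ioo (0:ℝ) 1 := by
  unfold nd
  have : ((l:ℕ):ℝ) + 1 ≤ N + 1 := by exact_mod_cast l.2
  constructor
  · positivity
  · rw [div_lt_one (by positivity)]; linarith

theorem nd_inj (N : ℕ) : Injective (nd N) := by
  intro a b h
  unfold nd at h
  have h2 : ((N:ℝ) + 2) ≠ 0 := by positivity
  field_simp at h
  have : ((a:ℕ):ℝ) = b := by linarith
  exact Fin.ext (by exact_mod_cast this)

def lb (N : ℕ) (l : Fin (N+1)) : Polynomial ℝ := Lagrange.basis Finset.univ (nd N) l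

theorem lb_deg (N : ℕ) (l : Fin (N+1)) : (lb N l).natDegree ≤ N := by
  unfold lb
  rw [Lagrange.natDegree_basis (nd_inj N).injOn (Finset.mem_univ l)]; simp

theorem lagrange (N : ℕ) {q : Polynomial ℝ} (hq : q.natDegree ≤ N) :
    q = ∑ l, Polynomial.C (q.eval (nd N l)) * lb N l := by
  have := Lagrange.eq_interpolate (s := Finset.univ) (v := nd N) (f := q) (nd_inj N).injOn (by
    refine lt_of_le_of_lt (Polynomial.degree_le_of_natDegree_le hq) ?_
    simp only [Finset.card_univ, Fintype.card_fin]
    exact_mod_cast Nat.lt_succ_self N)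
  conv_lhs => rw [this]
  simp [Lagrange.interpolate_apply, lb]

theorem lagrange_eval (N : ℕ) {q : Polynomial ℝ} (hq : q.natDegree ≤ N) (t : ℝ) :
    q.eval t = ∑ l, q.eval (nd N l) * (lb N l).eval t := by
  conv_lhs => rw [lagrange N hq]
  simp [Polynomial.eval_finsetSum]

theorem poly_bound (N : ℕ) (R : ℝ) : ∃ C : ℝ, 1 ≤ C ∧ ∀ q : Polynomial ℝ, q.natDegree ≤ N →
    ∀ B : ℝ, (∀ t ∈ Ico (0:ℝ) 1, |q.eval t| ≤ B) →
      (∀ t, |t| ≤ R → |q.eval t| ≤ C * B) ∧ (∀ t, |t| ≤ R → |q.derivative.eval t| ≤ C * B) := by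
  have hc : ∀ r : Polynomial ℝ, ∃ c : ℝ, 0 ≤ c ∧ ∀ t, |t| ≤ R → |r.eval t| ≤ c := by
    intro r
    obtain ⟨c, hc⟩ := (isCompact_Icc (a := -R) (b := R)).exists_bound_of_continuousOn r.continuous.continuousOn
    exact ⟨max c 0, le_max_right _ _, fun t ht => (hc t (abs_le.1 ht)).trans (le_max_left _ _)⟩
  choose c hc0 hc using hc
  refine ⟨max 1 (∑ l, (c (lb N l) + c (lb N l).derivative)), le_max_left _ _, fun q hq B hB => ?_⟩
  have hB0 : 0 ≤ B := (abs_nonneg _).trans (hB 0 (by simp))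
  have hv : ∀ l, |q.eval (nd N l)| ≤ B := fun l => hB _ (Ioo_subset_Ico_self (nd_mem N l))
  have gen : ∀ (e : Fin (N+1) → ℝ) (d : Fin (N+1) → ℝ), (∀ l, |e l| ≤ d l) → (∀ l, d l ≤ c (lb N l) + c (lb N l).derivative) → 
      |∑ l, q.eval (nd N l) * e l| ≤ max 1 (∑ l, (c (lb N l) + c (lb N l).derivative)) * B := by
    intro e d he hd
    refine (Finset.abs_sum_le_sum_abs _ _).trans ?_
    calc _ ≤ ∑ l, (c (lb N l) + c (lb N l).derivative) * B := by
          refine Finset.sum_le_sum fun l _ => ?_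
          rw [abs_mul, mul_comm]
          exact mul_le_mul ((he l).trans (hd l)) (hv l) (abs_nonneg _) (add_nonneg (hc0 _) (hc0 _))
      _ = (∑ l, (c (lb N l) + c (lb N l).derivative)) * B := by rw [Finset.sum_mul]
      _ ≤ _ := by gcongr; exact le_max_right _ _
  constructor
  · intro t ht
    rw [lagrange_eval N hq t]
    exact gen _ (fun l => c (lb N l)) (fun l => hc _ t ht) (fun l => le_add_of_nonneg_right (hc0 _))
  · intro t ht
    have : q.derivative.eval t = ∑ l, q.eval (nd N l) * (lb N l).derivative.eval t := by
      conv_lhs => rw [lagrange N hq]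
      simp [Polynomial.eval_finsetSum]
    rw [this]
    exact gen _ (fun l => c (lb N l).derivative) (fun l => hc _ t ht) (fun l => le_add_of_nonneg_left (hc0 _))

/-- separately polynomial of degree at most `N` -/
def CP {D : ℕ} (N : ℕ) (f : (Fin D → ℝ) → ℝ) : Prop :=
  ∀ x i, ∃ q : Polynomial ℝ, q.natDegree ≤ N ∧ ∀ t, f (update x i t) = q.eval t

section
variable {D N : ℕ} {f g : (Fin D → ℝ) → ℝ}

theorem CP.of_mv (p : MvPolynomial (Fin D) ℝ) (hp : ∀ i, p.degreeOf i ≤ N) :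
    CP N (fun x => MvPolynomial.eval x p) := by
  intro x i
  refine ⟨MvPolynomial.eval₂ Polynomial.C (fun j => if j = i then Polynomial.X else Polynomial.C (x j)) p, ?_, ?_⟩
  · rw [MvPolynomial.eval₂_eq']
    refine Polynomial.natDegree_sum_le_of_forall_le _ _ fun d hd => ?_
    refine (Polynomial.natDegree_C_mul_le _ _).trans ?_
    refine (Polynomial.natDegree_prod_le _ _).trans ?_
    rw [Finset.sum_eq_single i]
    · simp only [if_true, Polynomial.natDegree_X_pow]
      exact (MvPolynomial.monomial_le_degreeOf i hd).trans (hp i)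
    · intro j _ hj; rw [if_neg hj, ← Polynomial.C_pow, Polynomial.natDegree_C]
    · simp
  · intro t
    show MvPolynomial.eval _ p = _
    rw [MvPolynomial.eval₂_eq', MvPolynomial.eval_eq', Polynomial.eval_finsetSum]
    refine Finset.sum_congr rfl fun d _ => ?_
    rw [Polynomial.eval_mul, Polynomial.eval_C, Polynomial.eval_prod]
    congr 1
    refine Finset.prod_congr rfl fun j _ => ?_
    by_cases hj : j = i
    · subst hj; simp
    · simp [hj]

theorem CP.const (c : ℝ) : CP (D := D) N (fun _ => c) :=
  fun _ _ => ⟨Polynomial.C c, by simp, by simp⟩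

theorem CP.add (hf : CP N f) (hg : CP N g) : CP N (fun x => f x + g x) := by
  intro x i
  obtain ⟨q, hq, hq'⟩ := hf x i
  obtain ⟨r, hr, hr'⟩ := hg x i
  exact ⟨q + r, (Polynomial.natDegree_add_le _ _).trans (max_le hq hr), fun t => by simp [hq', hr']⟩

theorem CP.const_mul (c : ℝ) (hf : CP N f) : CP N (fun x => c * f x) := by
  intro x i
  obtain ⟨q, hq, hq'⟩ := hf x i
  exact ⟨Polynomial.C c * q, (Polynomial.natDegree_C_mul_le _ _).trans hq, fun t => by simp [hq']⟩

theorem CP.sub (hf : CP N f) (hg : CP N g) : CP N (fun x => f x - g x) := by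
  have := hf.add (hg.const_mul (-1)); simpa [sub_eq_add_neg] using this

theorem CP.sum {ι : Type*} (s : Finset ι) {f : ι → (Fin D → ℝ) → ℝ} (hf : ∀ a ∈ s, CP N (f a)) :
    CP N (fun x => ∑ a ∈ s, f a x) := by
  classical
  induction s using Finset.induction_on with
  | empty => simpa using CP.const 0
  | insert a s ha ih =>
    simp only [Finset.sum_insert ha]
    exact (hf a (by simp)).add (ih fun b hb => hf b (by simp [hb]))

theorem CP.mono {N' : ℕ} (h : N ≤ N') (hf : CP N f) : CP N' f := fun x i => by
  obtain ⟨q, hq, hq'⟩ := hf x i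
  exact ⟨q, hq.trans h, hq'⟩

theorem CP.affine (hf : CP N f) (b : ℝ) (c : Fin D → ℝ) : CP N (fun x => f (fun i => c i + b * x i)) := by
  intro x i
  obtain ⟨q, hq, hq'⟩ := hf (fun i => c i + b * x i) i
  refine ⟨q.comp (Polynomial.C (c i) + Polynomial.C b * Polynomial.X), ?_, fun t => ?_⟩
  · refine Polynomial.natDegree_comp_le.trans ?_
    have h1 : (Polynomial.C (c i) + Polynomial.C b * Polynomial.X).natDegree ≤ 1 := by
      rw [add_comm]; exact Polynomial.natDegree_linear_le
    calc _ ≤ N * 1 := Nat.mul_le_mul hq h1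
      _ = N := mul_one N
  · have : (fun j => c j + b * update x i t j) = update (fun i => c i + b * x i) i (c i + b * t) := by
      funext j; by_cases h : j = i
      · subst h; simp
      · simp [h]
    show f (fun j => c j + b * update x i t j) = _
    rw [this, hq']; simp

theorem CP.add_vec (hf : CP N f) (v : Fin D → ℝ) : CP N (fun x => f (x + v)) := by
  have := hf.affine 1 v
  convert this using 3 with x
  funext i; simp [add_comm]

theorem CP.fix (hf : CP N f) (i : Fin D) (t : ℝ) : CP N (fun x => f (update x i t)) := by
  intro x j
  by_cases h : j = i
  · subst h; exact ⟨Polynomial.C (f (update x j t)), by simp, by simp⟩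
  · obtain ⟨q, hq, hq'⟩ := hf (update x i t) j
    exact ⟨q, hq, fun s => by rw [← hq', update_comm (Ne.symm h)]⟩

/-- product with a polynomial in one coordinate, after freezing that coordinate -/
theorem CP.fix_mul (hf : CP N f) (i : Fin D) (t : ℝ) (q : Polynomial ℝ) (hq : q.natDegree ≤ N) :
    CP N (fun x => f (update x i t) * q.eval (x i)) := by
  intro x j
  by_cases h : j = i
  · subst h
    exact ⟨Polynomial.C (f (update x j t)) * q, (Polynomial.natDegree_C_mul_le _ _).trans hq, by simp⟩
  · obtain ⟨r, hr, hr'⟩ := hf (update x i t) j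
    refine ⟨Polynomial.C (q.eval (x i)) * r, (Polynomial.natDegree_C_mul_le _ _).trans hr, fun s => ?_⟩
    show f (update (update x j s) i t) * q.eval (update x j s i) = _
    rw [update_comm h, hr', update_of_ne (Ne.symm h)]
    simp [mul_comm]

theorem CP.lagr (hf : CP N f) (x : Fin D → ℝ) (i : Fin D) (t : ℝ) :
    f (update x i t) = ∑ l, f (update x i (nd N l)) * (lb N l).eval t := by
  obtain ⟨q, hq, hq'⟩ := hf x i
  simp only [hq']; exact lagrange_eval N hq t

theorem CP.of_lagr (h : ∀ x i t, f (update x i t) = ∑ l, f (update x i (nd N l)) * (lb N l).eval t) :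
    CP N f := fun x i =>
  ⟨∑ l, Polynomial.C (f (update x i (nd N l))) * lb N l,
    Polynomial.natDegree_sum_le_of_forall_le _ _ fun l _ =>
      (Polynomial.natDegree_C_mul_le _ _).trans (lb_deg N l),
    fun t => by rw [h]; simp [Polynomial.eval_finsetSum]⟩

theorem CP.limit {F : ℝ → (Fin D → ℝ) → ℝ} {l : Filter ℝ} [l.NeBot] (hF : ∀ s, CP N (F s))
    (hl : ∀ x, Filter.Tendsto (fun s => F s x) l (nhds (f x))) : CP N f := by
  refine CP.of_lagr fun x i t => ?_
  refine tendsto_nhds_unique (hl (update x i t)) ?_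
  simp only [fun s => (hF s).lagr x i t]
  exact tendsto_finsetSum _ fun a _ => (hl _).mul_const _

theorem CP.toMv_aux (S : Finset (Fin D)) : ∀ f : (Fin D → ℝ) → ℝ, CP N f →
    ∃ p : MvPolynomial (Fin D) ℝ, (∀ i, p.degreeOf i ≤ if i ∈ S then N else 0) ∧
      ∀ x, MvPolynomial.eval x p = f (S.piecewise x 0) := by
  induction S using Finset.induction_on with
  | empty =>
    intro f hf
    exact ⟨MvPolynomial.C (f 0), by simp, by simp⟩
  | insert i S hi ih =>
    intro f hf
    choose p hp hp' using fun l => ih (fun x => f (update x i (nd N l))) (hf.fix i (nd N l))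
    refine ⟨∑ l, p l * ∑ m ∈ Finset.range (N+1), MvPolynomial.C ((lb N l).coeff m) * (MvPolynomial.X i) ^ m, ?_, ?_⟩
    · intro j
      refine (MvPolynomial.degreeOf_sum_le _ _ _).trans (Finset.sup_le fun l _ => ?_)
      refine (MvPolynomial.degreeOf_mul_le _ _ _).trans ?_
      have h1 : MvPolynomial.degreeOf j (∑ m ∈ Finset.range (N+1), MvPolynomial.C ((lb N l).coeff m) * (MvPolynomial.X i) ^ m) ≤ if j = i then N else 0 := by
        refine (MvPolynomial.degreeOf_sum_le _ _ _).trans (Finset.sup_le fun m hm => ?_)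
        refine (MvPolynomial.degreeOf_C_mul_le _ _ _).trans ?_
        by_cases h : j = i
        · subst h
          refine (MvPolynomial.degreeOf_pow_le _ _ _).trans ?_
          have h0 : MvPolynomial.degreeOf j (MvPolynomial.X j : MvPolynomial (Fin D) ℝ) ≤ 1 := by
            simp [MvPolynomial.degreeOf_X]
          have h2 : m ≤ N := by simpa [Nat.lt_succ_iff] using hm
          simp only [if_true]
          nlinarith
        · rw [MvPolynomial.degreeOf_X_pow_of_ne m h]; simp
      have h2 := hp l j
      by_cases h : j = i
      · subst h; simp [hi] at h1 h2 ⊢; omega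
      · simp [h] at h1 h2 ⊢; omega
    · intro x
      simp only [map_sum, map_mul, MvPolynomial.eval_C, map_pow, MvPolynomial.eval_X, hp']
      have h1 : (insert i S).piecewise x 0 = update (S.piecewise x 0) i (x i) := by
        rw [Finset.piecewise_insert]
      rw [h1, hf.lagr]
      refine Finset.sum_congr rfl fun l _ => ?_
      rw [Polynomial.eval_eq_sum_range' (Nat.lt_succ_of_le (lb_deg N l))]

theorem CP.toMv (hf : CP N f) : ∃ p : MvPolynomial (Fin D) ℝ, (∀ i, p.degreeOf i ≤ N) ∧
    ∀ x, f x = MvPolynomial.eval x p := by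
  obtain ⟨p, hp, hp'⟩ := CP.toMv_aux Finset.univ f hf
  exact ⟨p, by simpa using hp, fun x => by simp [hp' x]⟩

theorem CP.contDiff (hf : CP N f) {m : WithTop ℕ∞} : ContDiff ℝ m f := by
  obtain ⟨p, -, hp'⟩ := hf.toMv
  have : f = fun x => ∑ d ∈ p.support, p.coeff d * ∏ i, x i ^ d i := by
    funext x; rw [hp', MvPolynomial.eval_eq']
  rw [this]
  refine ContDiff.sum fun d _ => contDiff_const.mul (contDiff_prod fun i _ => ?_)
  exact (contDiff_apply ℝ ℝ i).pow _

theorem CP.iter (hf : CP N f) (k : ℕ) : ∀ v : Fin k → (Fin D → ℝ),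
    CP N (fun x => iteratedFDeriv ℝ k f x v) := by
  induction k with
  | zero => intro v; simpa using hf
  | succ k ih =>
    intro v
    have hd : ∀ x, DifferentiableAt ℝ (iteratedFDeriv ℝ k f) x := fun x =>
      (hf.contDiff (m := ((k+1 : ℕ) : WithTop ℕ∞))).differentiable_iteratedFDeriv (by exact_mod_cast Nat.lt_succ_self k) x
    refine CP.limit (l := nhdsWithin 0 {0}ᶜ)
      (F := fun s x => s⁻¹ * (iteratedFDeriv ℝ k f (x + s • v 0) (Fin.tail v) - iteratedFDeriv ℝ k f x (Fin.tail v)))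
      (fun s => (((ih (Fin.tail v)).add_vec (s • v 0)).sub (ih (Fin.tail v))).const_mul _) ?_
    intro x
    have h1 : HasDerivAt (fun s : ℝ => iteratedFDeriv ℝ k f (x + s • v 0)) (fderiv ℝ (iteratedFDeriv ℝ k f) x (v 0)) 0 := by
      have h2 : HasDerivAt (fun s : ℝ => x + s • v 0) (v 0) 0 := by
        simpa using ((hasDerivAt_id (0:ℝ)).smul_const (v 0)).const_add x
      have h3 : HasFDerivAt (iteratedFDeriv ℝ k f) (fderiv ℝ (iteratedFDeriv ℝ k f) x) (x + (0:ℝ) • v 0) := by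
        simpa using (hd x).hasFDerivAt
      exact h3.comp_hasDerivAt 0 h2
    have h4 : HasDerivAt (fun s : ℝ => iteratedFDeriv ℝ k f (x + s • v 0) (Fin.tail v)) (fderiv ℝ (iteratedFDeriv ℝ k f) x (v 0) (Fin.tail v)) 0 :=
      ((ContinuousMultilinearMap.apply ℝ (fun _ : Fin k => (Fin D → ℝ)) ℝ (Fin.tail v)).hasFDerivAt).comp_hasDerivAt 0 h1
    rw [iteratedFDeriv_succ_apply_left]
    have := h4.tendsto_slope_zero
    simpa using this

end
end LPC

namespace LPC
open Set Function

theorem extrap (D N : ℕ) (R : ℝ) : ∃ C : ℝ, 1 ≤ C ∧ ∀ f : (Fin D → ℝ) → ℝ, CP N f → ∀ B : ℝ,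
    (∀ y ∈ hcube D, |f y| ≤ B) → ∀ y, ‖y‖ ≤ R → |f y| ≤ C * B := by
  obtain ⟨C, hC1, hC⟩ := poly_bound N R
  refine ⟨C ^ D, one_le_pow₀ hC1, fun f hf B hB y hy => ?_⟩
  have key : ∀ S : Finset (Fin D), ∀ y : Fin D → ℝ, (∀ i ∈ S, |y i| ≤ R) → (∀ i, i ∉ S → y i ∈ Ico (0:ℝ) 1) →
      |f y| ≤ C ^ S.card * B := by
    intro S
    induction S using Finset.induction_on with
    | empty => intro y _ h; simpa using hB y (fun i => h i (by simp))
    | insert i S hi ih =>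
      intro y h1 h2
      obtain ⟨q, hq, hq'⟩ := hf y i
      have h3 : ∀ t ∈ Ico (0:ℝ) 1, |q.eval t| ≤ C ^ S.card * B := by
        intro t ht
        rw [← hq']
        refine ih _ (fun j hj => ?_) (fun j hj => ?_)
        · have : j ≠ i := fun h => hi (h ▸ hj)
          rw [update_of_ne this]; exact h1 j (by simp [hj])
        · by_cases h : j = i
          · subst h; simpa using ht
          · rw [update_of_ne h]; exact h2 j (by simp [h, hj])
      have h4 := (hC q hq _ h3).1 (y i) (h1 i (by simp))
      rw [← hq', update_eq_self] at h4
      rw [Finset.card_insert_of_notMem hi, pow_succ]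
      linarith
  have := key Finset.univ y (fun i _ => (norm_le_pi_norm y i).trans hy) (by simp)
  simpa using this

theorem lip (D N : ℕ) (R : ℝ) : ∃ C : ℝ, 1 ≤ C ∧ ∀ f : (Fin D → ℝ) → ℝ, CP N f → ∀ B : ℝ,
    (∀ y ∈ hcube D, |f y| ≤ B) → ∀ y z, ‖y‖ ≤ R → ‖z‖ ≤ R → |f y - f z| ≤ C * B * ‖y - z‖ := by
  obtain ⟨Ce, hCe1, hCe⟩ := extrap D N (max R 1)
  obtain ⟨C, hC1, hC⟩ := poly_bound N R
  refine ⟨(D + 1) * (C * Ce), ?_, fun f hf B hB y z hy hz => ?_⟩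
  · have : (1:ℝ) ≤ D + 1 := by linarith [Nat.cast_nonneg (α := ℝ) D]
    exact one_le_mul_of_one_le_of_one_le this (one_le_mul_of_one_le_of_one_le hC1 hCe1)
  have hB0 : 0 ≤ B := (abs_nonneg _).trans (hB 0 (fun i => by simp))
  have key : ∀ S : Finset (Fin D), |f (S.piecewise y z) - f z| ≤ S.card * (C * Ce * B * ‖y - z‖) := by
    intro S
    induction S using Finset.induction_on with
    | empty => simp
    | insert i S hi ih =>
      rw [Finset.piecewise_insert, Finset.card_insert_of_notMem hi]
      set w := S.piecewise y z with hw
      have hwi : w i = z i := by simp [hw, hi]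
      obtain ⟨q, hq, hq'⟩ := hf w i
      have hwR : ∀ j, |w j| ≤ R := by
        intro j; rw [hw]
        by_cases h : j ∈ S
        · simpa [h] using (norm_le_pi_norm y j).trans hy
        · simpa [h] using (norm_le_pi_norm z j).trans hz
      have h3 : ∀ t ∈ Ico (0:ℝ) 1, |q.eval t| ≤ Ce * B := by
        intro t ht
        rw [← hq']
        refine hCe f hf B hB _ ?_
        rw [pi_norm_le_iff_of_nonneg (by positivity)]
        intro j
        by_cases h : j = i
        · subst h; simp only [update_self, Real.norm_eq_abs, abs_of_nonneg ht.1]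
          exact le_max_of_le_right ht.2.le
        · rw [update_of_ne h]; exact le_max_of_le_left (hwR j)
      have h4 := (hC q hq _ h3).2
      have h5 : |q.eval (y i) - q.eval (z i)| ≤ C * (Ce * B) * |y i - z i| := by
        refine (convex_Icc (-R) R).norm_image_sub_le_of_norm_deriv_le (f := fun t => q.eval t)
          (fun t _ => q.differentiable.differentiableAt) (fun t ht => ?_)
          (abs_le.1 ((norm_le_pi_norm z i).trans hz)) (abs_le.1 ((norm_le_pi_norm y i).trans hy))
        rw [Polynomial.deriv]; exact h4 t (abs_le.2 ht)
      have h6 : f w = q.eval (z i) := by rw [← hq', ← hwi, update_eq_self]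
      have h7 : |y i - z i| ≤ ‖y - z‖ := norm_le_pi_norm (y - z) i
      have h8 : |f (update w i (y i)) - f w| ≤ C * Ce * B * ‖y - z‖ := by
        rw [hq', h6]
        refine h5.trans ?_
        have : 0 ≤ C * (Ce * B) := by positivity
        calc _ ≤ C * (Ce * B) * ‖y - z‖ := by gcongr
          _ = _ := by ring
      calc |f (update w i (y i)) - f z| ≤ |f (update w i (y i)) - f w| + |f w - f z| := abs_sub_le _ _ _
        _ ≤ _ := by push_cast; linarith
  have := key Finset.univ
  simp only [Finset.piecewise_univ, Finset.card_univ, Fintype.card_fin] at this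
  refine this.trans ?_
  have : 0 ≤ C * Ce * B * ‖y - z‖ := by positivity
  nlinarith

theorem norming (D N : ℕ) : ∃ ρ : ℝ, 0 < ρ ∧ ρ ≤ 1/8 ∧ ∀ f : (Fin D → ℝ) → ℝ, CP N f →
    ∃ z : Fin D → ℝ, (∀ i, z i ∈ Icc (2*ρ) (1-2*ρ)) ∧
      ∀ y ∈ hcube D, ∀ x, ‖x - z‖ ≤ ρ → |f y| ≤ 4 * |f x| := by
  obtain ⟨C, hC1, hC⟩ := lip D N 1
  have hCp : 0 < C := by linarith
  set ρ : ℝ := min (1/8) (1/(12*C)) with hρ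
  have hρ0 : 0 < ρ := by positivity
  have hρ8 : ρ ≤ 1/8 := min_le_left _ _
  have hρC : 12 * C * ρ ≤ 1 := by
    have : ρ ≤ 1/(12*C) := min_le_right _ _
    rw [le_div_iff₀ (by positivity)] at this; linarith
  refine ⟨ρ, hρ0, hρ8, fun f hf => ?_⟩
  have hbdd : BddAbove ((fun y => |f y|) '' hcube D) := by
    obtain ⟨B, hB⟩ := (isCompact_ccube D).exists_bound_of_continuousOn (hf.contDiff (m := 0)).continuous.continuousOn
    exact ⟨B, by rintro _ ⟨y, hy, rfl⟩; exact hB y (hcube_sub D hy)⟩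
  have hne : ((fun y => |f y|) '' hcube D).Nonempty := ⟨_, 0, fun i => by simp, rfl⟩
  set S := sSup ((fun y => |f y|) '' hcube D) with hS
  have hle : ∀ y ∈ hcube D, |f y| ≤ S := fun y hy => le_csSup hbdd ⟨y, hy, rfl⟩
  have hS0 : 0 ≤ S := (abs_nonneg _).trans (hle 0 (fun i => by simp))
  rcases hS0.eq_or_lt with h0 | hpos
  · refine ⟨fun _ => 1/2, fun i => ⟨by linarith, by linarith⟩, fun y hy x _ => ?_⟩
    have := hle y hy
    have := abs_nonneg (f x)
    linarith
  · obtain ⟨_, ⟨z0, hz0, rfl⟩, hz0S⟩ := exists_lt_of_lt_csSup hne (show S/2 < S by linarith)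
    simp only at hz0S
    refine ⟨fun i => max (2*ρ) (min (1-2*ρ) (z0 i)), fun i => ⟨le_max_left _ _, max_le (by linarith) (min_le_left _ _)⟩, ?_⟩
    intro y hy x hx
    have hxi : ∀ i, |x i - z0 i| ≤ 3 * ρ ∧ |x i| ≤ 1 := by
      intro i
      have h1 := (norm_le_pi_norm _ i).trans hx
      simp only [Pi.sub_apply, Real.norm_eq_abs] at h1
      have h2 := hz0 i
      rw [abs_le] at h1
      have h3 : |max (2*ρ) (min (1-2*ρ) (z0 i)) - z0 i| ≤ 2*ρ := by
        have := h2.1; have := h2.2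
        rcases le_total (z0 i) (2*ρ) with h | h
        · rw [min_eq_right (by linarith), max_eq_left h, abs_le]; constructor <;> linarith
        · rcases le_total (z0 i) (1-2*ρ) with h' | h'
          · rw [min_eq_right h', max_eq_right h]; simp; linarith
          · rw [min_eq_left h', max_eq_right (by linarith), abs_le]; constructor <;> linarith
      have h4 : 2*ρ ≤ max (2*ρ) (min (1-2*ρ) (z0 i)) := le_max_left _ _
      have h5 : max (2*ρ) (min (1-2*ρ) (z0 i)) ≤ 1-2*ρ := max_le (by linarith) (min_le_left _ _)
      rw [abs_le] at h3
      exact ⟨abs_le.2 ⟨by linarith, by linarith⟩, abs_le.2 ⟨by linarith, by linarith⟩⟩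
    have hxn : ‖x‖ ≤ 1 := (pi_norm_le_iff_of_nonneg zero_le_one).2 fun i => (hxi i).2
    have hzn : ‖z0‖ ≤ 1 := (pi_norm_le_iff_of_nonneg zero_le_one).2 fun i => by
      rw [Real.norm_of_nonneg (hz0 i).1]; exact (hz0 i).2.le
    have hd : ‖x - z0‖ ≤ 3 * ρ := (pi_norm_le_iff_of_nonneg (by positivity)).2 fun i => (hxi i).1
    have h6 := hC f hf S hle x z0 hxn hzn
    have h7 : C * S * ‖x - z0‖ ≤ S / 4 := by
      calc C * S * ‖x - z0‖ ≤ C * S * (3 * ρ) := by gcongr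
        _ = (12 * C * ρ) * (S / 4) := by ring
        _ ≤ 1 * (S/4) := by gcongr
        _ = _ := one_mul _
    have h8 := abs_sub_abs_le_abs_sub (f z0) (f x)
    rw [abs_sub_comm] at h6
    have := hle y hy
    linarith

end LPC

namespace LPC
open Set Function

theorem relu_hasDeriv (k : ℕ) (y : ℝ) :
    HasDerivAt (fun y : ℝ => (max y 0)^(k+2)) ((k+2:ℕ) * (max y 0)^(k+1)) y := by
  rcases lt_trichotomy y 0 with h | h | h
  · have : (fun y : ℝ => (max y 0)^(k+2)) =ᶠ[nhds y] fun _ => 0 := by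
      filter_upwards [Iio_mem_nhds h] with z hz
      rw [max_eq_right (le_of_lt hz)]; simp
    rw [max_eq_right h.le]
    simpa using (hasDerivAt_const y (0:ℝ)).congr_of_eventuallyEq this
  · subst h
    have e : (fun y : ℝ => (max y 0)^(k+2)) = fun y => y * (max y 0)^(k+1) := by
      funext z
      rcases le_total z 0 with hz | hz
      · rw [max_eq_right hz]; simp
      · rw [max_eq_left hz]; ring
    rw [e]
    have hc : Continuous (fun y : ℝ => (max y 0)^(k+1)) := by fun_prop
    rw [hasDerivAt_iff_tendsto_slope]
    have h1 := (hc.tendsto 0).mono_left (nhdsWithin_le_nhds (s := {0}ᶜ))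
    refine Filter.Tendsto.congr' ?_ (by simpa using h1)
    filter_upwards [self_mem_nhdsWithin] with z hz
    have hz' : z ≠ 0 := hz
    rw [slope_def_field]; field_simp; simp
  · have : (fun y : ℝ => (max y 0)^(k+2)) =ᶠ[nhds y] fun z => z^(k+2) := by
      filter_upwards [Ioi_mem_nhds h] with z hz
      rw [max_eq_left (le_of_lt hz)]
    rw [max_eq_left h.le]
    simpa using (hasDerivAt_pow (k+2) y).congr_of_eventuallyEq this

theorem relu_contDiff (k : ℕ) : ContDiff ℝ k (fun y : ℝ => (max y 0)^(k+1)) := by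
  induction k with
  | zero => rw [Nat.cast_zero, contDiff_zero]; fun_prop
  | succ k ih =>
    push_cast
    rw [contDiff_succ_iff_deriv]
    refine ⟨fun y => (relu_hasDeriv k y).differentiableAt, fun h => by simp at h, ?_⟩
    have : deriv (fun y : ℝ => (max y 0)^(k+1+1)) = fun y => ((k+2:ℕ):ℝ) * (max y 0)^(k+1) :=
      funext fun y => (relu_hasDeriv k y).deriv
    rw [this]
    exact contDiff_const.mul ih

def S1 (N : ℕ) (b : ℝ → ℝ) : Prop := ContDiff ℝ (N-1:ℕ) b ∧
  ∀ c : ℤ, ∃ q : Polynomial ℝ, q.natDegree ≤ N ∧ ∀ y ∈ Ico (c:ℝ) (c+1), b y = q.eval y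

section
variable {N : ℕ} {b b' : ℝ → ℝ}

theorem S1.poly (q : Polynomial ℝ) (hq : q.natDegree ≤ N) : S1 N (fun y => q.eval y) :=
  ⟨by simpa using q.contDiff_aeval (𝕜 := ℝ) (N-1:ℕ), fun c => ⟨q, hq, fun _ _ => rfl⟩⟩

theorem S1.zero : S1 N (fun _ => 0) := by simpa using S1.poly (N := N) 0 (by simp)

theorem S1.add (h : S1 N b) (h' : S1 N b') : S1 N (fun y => b y + b' y) :=
  ⟨h.1.add h'.1, fun c => by
    obtain ⟨q, hq, e⟩ := h.2 c
    obtain ⟨r, hr, e'⟩ := h'.2 c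
    exact ⟨q + r, (Polynomial.natDegree_add_le _ _).trans (max_le hq hr),
      fun y hy => by simp [e y hy, e' y hy]⟩⟩

theorem S1.const_mul (h : S1 N b) (a : ℝ) : S1 N (fun y => a * b y) :=
  ⟨contDiff_const.mul h.1, fun c => by
    obtain ⟨q, hq, e⟩ := h.2 c
    exact ⟨Polynomial.C a * q, (Polynomial.natDegree_C_mul_le _ _).trans hq,
      fun y hy => by simp [e y hy]⟩⟩

theorem S1.sub (h : S1 N b) (h' : S1 N b') : S1 N (fun y => b y - b' y) := by
  have := h.add (h'.const_mul (-1)); simpa [sub_eq_add_neg] using this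

theorem S1.sum {ι : Type*} (s : Finset ι) {f : ι → ℝ → ℝ} (hf : ∀ a ∈ s, S1 N (f a)) :
    S1 N (fun x => ∑ a ∈ s, f a x) := by
  classical
  induction s using Finset.induction_on with
  | empty => simpa using S1.zero
  | insert a s ha ih =>
    simp only [Finset.sum_insert ha]
    exact (hf a (by simp)).add (ih fun b hb => hf b (by simp [hb]))

theorem comp_sub_deg (q : Polynomial ℝ) (hq : q.natDegree ≤ N) (k : ℝ) :
    (q.comp (Polynomial.X - Polynomial.C k)).natDegree ≤ N := by
  refine Polynomial.natDegree_comp_le.trans ?_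
  simpa using hq

theorem S1.shift (h : S1 N b) (k : ℤ) : S1 N (fun y => b (y - k)) :=
  ⟨h.1.comp (contDiff_id.sub contDiff_const), fun c => by
    obtain ⟨q, hq, e⟩ := h.2 (c - k)
    refine ⟨q.comp (Polynomial.X - Polynomial.C (k:ℝ)), comp_sub_deg q hq _, fun y hy => ?_⟩
    show b (y - k) = _
    rw [e _ ⟨by push_cast; linarith [hy.1], by push_cast; linarith [hy.2]⟩]; simp⟩

theorem S1.relu (hN : 1 ≤ N) : S1 N (fun y : ℝ => (max y 0)^N) := by
  obtain ⟨k, rfl⟩ : ∃ k, N = k + 1 := ⟨N-1, by omega⟩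
  refine ⟨by simpa using relu_contDiff k, fun c => ?_⟩
  rcases le_or_gt 0 c with h | h
  · refine ⟨Polynomial.X^(k+1), by simp, fun y hy => ?_⟩
    have : (0:ℝ) ≤ c := by exact_mod_cast h
    show (max y 0)^(k+1) = _
    rw [max_eq_left (this.trans hy.1)]; simp
  · refine ⟨0, by simp, fun y hy => ?_⟩
    have : (c:ℝ) + 1 ≤ 0 := by exact_mod_cast h
    show (max y 0)^(k+1) = _
    rw [max_eq_right (hy.2.le.trans this)]; simp

theorem vander (N : ℕ) (q : Polynomial ℝ) (hq : q.natDegree ≤ N) :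
    ∃ c : Fin (N+1) → ℝ, ∀ y, q.eval y = ∑ m : Fin (N+1), c m * (y - (m:ℕ))^N := by
  set A : Matrix (Fin (N+1)) (Fin (N+1)) ℝ := Matrix.vandermonde (fun m : Fin (N+1) => -((m:ℕ):ℝ)) with hA
  have hdet : IsUnit A.det := by
    rw [isUnit_iff_ne_zero, hA, Matrix.det_vandermonde_ne_zero_iff]
    intro a b h
    have : ((a:ℕ):ℝ) = b := by simpa using h
    exact Fin.ext (by exact_mod_cast this)
  set r : Fin (N+1) → ℝ := fun i => q.coeff (N - i) / (N.choose i) with hr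
  refine ⟨Matrix.vecMul r A⁻¹, fun y => ?_⟩
  have key : Matrix.vecMul (Matrix.vecMul r A⁻¹) A = r := by
    rw [Matrix.vecMul_vecMul, Matrix.nonsing_inv_mul _ hdet, Matrix.vecMul_one]
  set c := Matrix.vecMul r A⁻¹
  have key2 : ∀ i : Fin (N+1), ∑ m, c m * (-((m:ℕ):ℝ))^(i:ℕ) = r i := by
    intro i
    have := congrFun key i
    simpa [Matrix.vecMul, dotProduct, hA, Matrix.vandermonde_apply] using this
  have h1 : ∀ m : Fin (N+1), (y - (m:ℕ))^N = ∑ i : Fin (N+1), (-((m:ℕ):ℝ))^(i:ℕ) * y^(N-i) * N.choose i := by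
    intro m
    rw [sub_eq_add_neg, add_comm, add_pow, Finset.sum_range]
  simp_rw [h1, Finset.mul_sum]
  rw [Finset.sum_comm]
  have h2 : ∀ i : Fin (N+1), ∑ m, c m * ((-((m:ℕ):ℝ))^(i:ℕ) * y^(N-i) * N.choose i) = q.coeff (N-i) * y^(N-i) := by
    intro i
    have hch : (N.choose i : ℝ) ≠ 0 := by
      exact_mod_cast (Nat.choose_pos (Nat.lt_succ_iff.1 i.2)).ne'
    calc _ = (∑ m, c m * (-((m:ℕ):ℝ))^(i:ℕ)) * (y^(N-i) * N.choose i) := by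
            rw [Finset.sum_mul]; exact Finset.sum_congr rfl fun m _ => by ring
      _ = _ := by rw [key2, hr]; field_simp
  simp_rw [h2]
  rw [Polynomial.eval_eq_sum_range' (Nat.lt_succ_of_le hq), ← Finset.sum_range_reflect, Finset.sum_range]
  simp

theorem cut (hN : 1 ≤ N) (q : Polynomial ℝ) (hq : q.natDegree ≤ N) :
    ∃ b, S1 N b ∧ (∀ y ≤ 0, b y = 0) ∧ ∀ y : ℝ, N ≤ y → b y = q.eval y := by
  obtain ⟨c, hc⟩ := vander N q hq
  refine ⟨fun y => ∑ m : Fin (N+1), c m * (max (y - ((m:ℕ):ℤ)) 0)^N, ?_, ?_, ?_⟩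
  · refine S1.sum _ fun m _ => ?_
    exact S1.const_mul (b := fun y => (max (y - ((m:ℕ):ℤ)) 0)^N) ((S1.relu hN).shift ((m:ℕ):ℤ)) (c m)
  · intro y hy
    refine Finset.sum_eq_zero fun m _ => ?_
    have : (0:ℝ) ≤ (m:ℕ) := by positivity
    rw [max_eq_right (by push_cast; linarith), zero_pow (by omega), mul_zero]
  · intro y hy
    rw [hc]
    refine Finset.sum_congr rfl fun m _ => ?_
    have : ((m:ℕ):ℝ) ≤ N := by exact_mod_cast Nat.lt_succ_iff.1 m.2
    rw [max_eq_left (by push_cast; linarith)]; simp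
end

theorem quasi1 (N : ℕ) (hN : 1 ≤ N) : ∃ (C : ℝ) (A : ℕ → ℕ → Fin (N+1) → ℝ → ℝ), 1 ≤ C ∧ ∀ M, 1 ≤ M →
    (∀ k l, S1 N (A M k l)) ∧
    (∀ k l (y : ℝ), k < M → 0 ≤ y → y < M → |A M k l y| ≤ C ∧ (A M k l y ≠ 0 → (k:ℝ) ≤ y ∧ y < k + N + 1)) ∧
    ∀ q : Polynomial ℝ, q.natDegree ≤ N → ∀ y,
      ∑ k ∈ Finset.range M, ∑ l, q.eval (k + nd N l) * A M k l y = q.eval y := by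
  choose b hb hb0 hb1 using fun l => cut hN (lb N l) (lb_deg N l)
  set e : ℕ → ℕ → Fin (N+1) → ℝ → ℝ := fun M k l y =>
    if k = 0 then (lb N l).eval y else if k = M then 0 else b l (y - (k:ℤ)) with he
  set al : Fin (N+1) → Fin (N+1) → ℝ := fun l l' => (lb N l).eval (nd N l' + 1) with hal
  have hrec : ∀ (q : Polynomial ℝ), q.natDegree ≤ N → ∀ t, q.eval t = ∑ l, q.eval (nd N l) * (lb N l).eval t :=
    fun q hq t => lagrange_eval N hq t
  -- bounds
  have hbd : ∃ B : ℝ, 1 ≤ B ∧ ∀ l, (∀ y : ℝ, |y| ≤ N+1 → |(lb N l).eval y| ≤ B ∧ |b l y| ≤ B) := by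
    have h1 : ∀ l, ∃ B : ℝ, ∀ y : ℝ, |y| ≤ N+1 → |(lb N l).eval y| ≤ B := fun l => by
      obtain ⟨c, hc⟩ := (isCompact_Icc (a := -((N:ℝ)+1)) (b := N+1)).exists_bound_of_continuousOn (lb N l).continuous.continuousOn
      exact ⟨c, fun t ht => hc t (abs_le.1 ht)⟩
    have h2 : ∀ l, ∃ B : ℝ, ∀ y : ℝ, |y| ≤ N+1 → |b l y| ≤ B := fun l => by
      obtain ⟨c, hc⟩ := (isCompact_Icc (a := -((N:ℝ)+1)) (b := N+1)).exists_bound_of_continuousOn (hb l).1.continuous.continuousOn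
      exact ⟨c, fun t ht => hc t (abs_le.1 ht)⟩
    choose B1 hB1 using h1
    choose B2 hB2 using h2
    refine ⟨1 + ∑ l, (|B1 l| + |B2 l|), ?_, fun l y hy => ?_⟩
    · have : 0 ≤ ∑ l, (|B1 l| + |B2 l|) := Finset.sum_nonneg fun _ _ => by positivity
      linarith
    · have : |B1 l| + |B2 l| ≤ ∑ l, (|B1 l| + |B2 l|) :=
        Finset.single_le_sum (f := fun l => |B1 l| + |B2 l|) (fun _ _ => by positivity) (Finset.mem_univ l)
      have h3 := hB1 l y hy
      have h4 := hB2 l y hy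
      have := le_abs_self (B1 l)
      have := le_abs_self (B2 l)
      have := abs_nonneg (B1 l)
      have := abs_nonneg (B2 l)
      constructor <;> linarith
  obtain ⟨B, hB1, hB⟩ := hbd
  have hNpos : (1:ℝ) ≤ N := by exact_mod_cast hN
  have hal' : ∀ l l', |al l l'| ≤ B := fun l l' => (hB l _ (by
    have := nd_mem N l'
    rw [abs_of_nonneg (by linarith [this.1])]; linarith [this.2])).1
  refine ⟨B + (N+1) * (B * B), fun M k l y => e M k l y - ∑ l', al l l' * e M (k+1) l' y, by nlinarith, fun M hM => ⟨?_, ?_, ?_⟩⟩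
  · have hS : ∀ k l, S1 N (e M k l) := by
      intro k l
      simp only [he]
      split_ifs with h1 h2
      · exact S1.poly _ (lb_deg N l)
      · exact S1.zero
      · exact (hb l).shift k
    intro k l
    exact (hS k l).sub (S1.sum _ fun l' _ => (hS _ _).const_mul _)
  · intro k l y hk hy0 hyM
    show |e M k l y - ∑ l', al l l' * e M (k+1) l' y| ≤ _ ∧ (e M k l y - ∑ l', al l l' * e M (k+1) l' y ≠ 0 → _)
    have hsupp : e M k l y - ∑ l', al l l' * e M (k+1) l' y ≠ 0 → (k:ℝ) ≤ y ∧ y < k + N + 1 := by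
      intro hne
      by_contra hcon
      apply hne
      rw [not_and_or, not_le, not_lt] at hcon
      rcases hcon with h | h
      · have hk0 : k ≠ 0 := by rintro rfl; simp at h; linarith
        have e1 : e M k l y = 0 := by
          simp only [he, if_neg hk0]
          split_ifs
          · rfl
          · exact hb0 l _ (by push_cast; linarith)
        have e2 : ∀ l', e M (k+1) l' y = 0 := fun l' => by
          simp only [he, if_neg (Nat.succ_ne_zero k)]
          split_ifs
          · rfl
          · exact hb0 l' _ (by push_cast; linarith)
        simp [e1, e2]
      · have hkM : k + 1 ≠ M := by
          rintro rfl; push_cast at hyM; linarith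
        have e1 : e M k l y = (lb N l).eval (y - k) := by
          simp only [he]
          split_ifs with h1 h2
          · simp [h1]
          · omega
          · rw [hb1 l _ (by push_cast; linarith)]; simp
        have e2 : ∀ l', e M (k+1) l' y = (lb N l').eval (y - k - 1) := fun l' => by
          simp only [he, if_neg (Nat.succ_ne_zero k), if_neg hkM]
          rw [hb1 l' _ (by push_cast; linarith)]; push_cast; congr 1; ring
        rw [e1]; simp_rw [e2]
        have := hrec ((lb N l).comp (Polynomial.X + Polynomial.C 1))
          (Polynomial.natDegree_comp_le.trans (by rw [Polynomial.natDegree_X_add_C, mul_one]; exact lb_deg N l)) (y - k - 1)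
        simp only [Polynomial.eval_comp, Polynomial.eval_add, Polynomial.eval_X, Polynomial.eval_C, sub_add_cancel] at this
        rw [this, sub_self]
    refine ⟨?_, hsupp⟩
    by_cases h0 : e M k l y - ∑ l', al l l' * e M (k+1) l' y = 0
    · rw [h0, abs_zero]; positivity
    obtain ⟨h1, h2⟩ := hsupp h0
    have eb : ∀ k' l, k' = k ∨ k' = k + 1 → |e M k' l y| ≤ B := by
      intro k' l hk'
      have hk'1 : (k:ℝ) ≤ k' := by rcases hk' with rfl | rfl <;> push_cast <;> linarith
      have hk'2 : (k':ℝ) ≤ k + 1 := by rcases hk' with rfl | rfl <;> push_cast <;> linarith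
      simp only [he]
      split_ifs with h3 h4
      · refine (hB l y ?_).1
        have : (k:ℝ) = 0 := by
          have : k = 0 := by omega
          simp [this]
        rw [abs_of_nonneg hy0]; linarith
      · simp; linarith
      · refine (hB l _ ?_).2
        push_cast
        rw [abs_le]; constructor <;> linarith
    calc |e M k l y - ∑ l', al l l' * e M (k+1) l' y|
        ≤ |e M k l y| + |∑ l', al l l' * e M (k+1) l' y| := abs_sub _ _
      _ ≤ B + ∑ l' : Fin (N+1), B * B := by
          refine add_le_add (eb k l (Or.inl rfl)) ((Finset.abs_sum_le_sum_abs _ _).trans (Finset.sum_le_sum fun l' _ => ?_))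
          rw [abs_mul]
          exact mul_le_mul (hal' _ _) (eb _ _ (Or.inr rfl)) (abs_nonneg _) (by linarith)
      _ = _ := by simp
  · intro q hq y
    set g : ℕ → ℝ := fun k => ∑ l, q.eval (k + nd N l) * e M k l y with hg
    have hdeg : ∀ k : ℝ, (q.comp (Polynomial.X + Polynomial.C k)).natDegree ≤ N := fun k =>
      Polynomial.natDegree_comp_le.trans (by rw [Polynomial.natDegree_X_add_C, mul_one]; exact hq)
    have step : ∀ k : ℕ, ∑ l, q.eval (k + nd N l) * (e M k l y - ∑ l', al l l' * e M (k+1) l' y) = g k - g (k+1) := by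
      intro k
      simp only [mul_sub, Finset.sum_sub_distrib, hg]
      congr 1
      simp only [Finset.mul_sum]
      rw [Finset.sum_comm]
      refine Finset.sum_congr rfl fun l' _ => ?_
      have := hrec (q.comp (Polynomial.X + Polynomial.C (k:ℝ))) (hdeg k) (nd N l' + 1)
      simp only [Polynomial.eval_comp, Polynomial.eval_add, Polynomial.eval_X, Polynomial.eval_C] at this
      have e3 : ((k+1:ℕ):ℝ) + nd N l' = nd N l' + 1 + k := by push_cast; ring
      rw [e3, this, Finset.sum_mul]
      refine Finset.sum_congr rfl fun l _ => ?_
      rw [add_comm (k:ℝ)]; simp only [hal]; ring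
    rw [Finset.sum_congr rfl fun k _ => step k, Finset.sum_range_sub']
    have g0 : g 0 = q.eval y := by
      simp only [hg, he, if_true]
      rw [hrec q hq y]; simp
    have gM : g M = 0 := by
      simp only [hg, he, if_neg (by omega : M ≠ 0), if_true]; simp
    rw [g0, gM, sub_zero]

end LPC

namespace LPC
open Set Function

theorem mem_cell_iff {D M : ℕ} (hM : 1 ≤ M) {k : Fin D → Fin M} {x : Fin D → ℝ} :
    x ∈ cell D M k ↔ ∀ i, ((k i : ℕ) : ℝ) ≤ M * x i ∧ M * x i < (k i : ℕ) + 1 := by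
  have hM' : (0:ℝ) < M := by exact_mod_cast hM
  simp only [cell, mem_ofPred_eq, div_le_iff₀ hM', lt_div_iff₀ hM', mul_comm (M:ℝ)]

theorem cell_sub {D M : ℕ} (hM : 1 ≤ M) {k : Fin D → Fin M} {x : Fin D → ℝ} (hx : x ∈ cell D M k) :
    x ∈ hcube D := by
  have hM' : (0:ℝ) < M := by exact_mod_cast hM
  rw [mem_cell_iff hM] at hx
  intro i
  obtain ⟨h1, h2⟩ := hx i
  have h3 : ((k i:ℕ):ℝ) + 1 ≤ M := by exact_mod_cast (k i).2
  have h4 : (0:ℝ) ≤ (k i:ℕ) := by positivity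
  constructor
  · by_contra h; push Not at h; nlinarith
  · by_contra h; push Not at h; nlinarith

theorem exists_cell {D M : ℕ} (hM : 1 ≤ M) {x : Fin D → ℝ} (hx : x ∈ hcube D) :
    ∃ k : Fin D → Fin M, x ∈ cell D M k := by
  have hM' : (0:ℝ) < M := by exact_mod_cast hM
  have h0 : ∀ i, 0 ≤ M * x i := fun i => mul_nonneg hM'.le (hx i).1
  refine ⟨fun i => ⟨⌊(M:ℝ) * x i⌋₊, ?_⟩, ?_⟩
  · rw [Nat.floor_lt (h0 i)]; nlinarith [(hx i).2]
  · rw [mem_cell_iff hM]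
    exact fun i => ⟨Nat.floor_le (h0 i), Nat.lt_floor_add_one _⟩

theorem cell_unique {D M : ℕ} (hM : 1 ≤ M) {k k' : Fin D → Fin M} {x : Fin D → ℝ}
    (hx : x ∈ cell D M k) (hx' : x ∈ cell D M k') : k = k' := by
  rw [mem_cell_iff hM] at hx hx'
  funext i
  apply Fin.ext
  have h1 : ((k i:ℕ):ℝ) < (k' i:ℕ) + 1 := (hx i).1.trans_lt (hx' i).2
  have h2 : ((k' i:ℕ):ℝ) < (k i:ℕ) + 1 := (hx' i).1.trans_lt (hx i).2
  have h1' : (k i:ℕ) < (k' i:ℕ) + 1 := by exact_mod_cast h1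
  have h2' : (k' i:ℕ) < (k i:ℕ) + 1 := by exact_mod_cast h2
  omega

theorem isOpen_unitCube (D : ℕ) : IsOpen (unitCube D) := by
  have : unitCube D = Set.pi univ fun _ => Ioo (0:ℝ) 1 := by
    ext x; simp [unitCube]
  rw [this]; exact isOpen_set_pi finite_univ fun _ _ => isOpen_Ioo

section
variable {D M N : ℕ} {u v : (Fin D → ℝ) → ℝ}

theorem sp_iff : IsSpline D M (N+1) u ↔ (∀ x ∈ unitCube D, ContDiffAt ℝ (N-1:ℕ) u x) ∧
    ∀ k : Fin D → Fin M, ∃ f, CP N f ∧ ∀ x ∈ cell D M k, u x = f x := by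
  unfold IsSpline
  have e : N + 1 - 2 = N - 1 := by omega
  rw [e, Nat.add_sub_cancel]
  refine and_congr ?_ (forall_congr' fun k => ?_)
  · constructor
    · intro h x hx; exact (h x hx).contDiffAt ((isOpen_unitCube D).mem_nhds hx)
    · intro h x hx; exact (h x hx).contDiffWithinAt
  · constructor
    · rintro ⟨p, hp, h⟩; exact ⟨_, CP.of_mv p hp, h⟩
    · rintro ⟨f, hf, h⟩
      obtain ⟨p, hp, e⟩ := hf.toMv
      exact ⟨p, hp, fun x hx => by rw [h x hx, e]⟩

theorem sp_const (c : ℝ) : IsSpline D M (N+1) (fun _ => c) :=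
  sp_iff.2 ⟨fun _ _ => contDiffAt_const, fun _ => ⟨_, CP.const c, fun _ _ => rfl⟩⟩

theorem sp_add (hu : IsSpline D M (N+1) u) (hv : IsSpline D M (N+1) v) :
    IsSpline D M (N+1) (fun x => u x + v x) := by
  rw [sp_iff] at *
  refine ⟨fun x hx => (hu.1 x hx).add (hv.1 x hx), fun k => ?_⟩
  obtain ⟨f, hf, e⟩ := hu.2 k
  obtain ⟨g, hg, e'⟩ := hv.2 k
  exact ⟨_, hf.add hg, fun x hx => by rw [e x hx, e' x hx]⟩

theorem sp_smul (hu : IsSpline D M (N+1) u) (c : ℝ) :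
    IsSpline D M (N+1) (fun x => c * u x) := by
  rw [sp_iff] at *
  refine ⟨fun x hx => contDiffAt_const.mul (hu.1 x hx), fun k => ?_⟩
  obtain ⟨f, hf, e⟩ := hu.2 k
  exact ⟨_, hf.const_mul c, fun x hx => by rw [e x hx]⟩

theorem sp_sub (hu : IsSpline D M (N+1) u) (hv : IsSpline D M (N+1) v) :
    IsSpline D M (N+1) (fun x => u x - v x) := by
  have := sp_add hu (sp_smul hv (-1)); simpa [sub_eq_add_neg] using this

theorem sp_sum {ι : Type*} (s : Finset ι) {f : ι → (Fin D → ℝ) → ℝ}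
    (hf : ∀ a ∈ s, IsSpline D M (N+1) (f a)) : IsSpline D M (N+1) (fun x => ∑ a ∈ s, f a x) := by
  classical
  induction s using Finset.induction_on with
  | empty => simpa using sp_const 0
  | insert a s ha ih =>
    simp only [Finset.sum_insert ha]
    exact sp_add (hf a (by simp)) (ih fun b hb => hf b (by simp [hb]))

theorem update_mem_cell (hM : 1 ≤ M) {m : Fin D → Fin M} {x : Fin D → ℝ} (hx : x ∈ cell D M m) (i : Fin D)
    (κ : Fin M) {ξ : ℝ} (h : ((κ:ℕ):ℝ) ≤ M * ξ ∧ M * ξ < (κ:ℕ) + 1) :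
    update x i ξ ∈ cell D M (update m i κ) := by
  rw [mem_cell_iff hM] at *
  intro j
  by_cases hj : j = i
  · subst hj; simpa using h
  · simpa [hj] using hx j

theorem sp_mul (hM : 1 ≤ M) (hu : IsSpline D M (N+1) u) (i : Fin D) {ξ : ℝ} (hξ : ξ ∈ Ioo (0:ℝ) 1)
    {b : ℝ → ℝ} (hb : S1 N b) :
    IsSpline D M (N+1) (fun x => u (update x i ξ) * b (M * x i)) := by
  rw [sp_iff] at *
  have hM' : (0:ℝ) < M := by exact_mod_cast hM
  refine ⟨fun x hx => ?_, fun m => ?_⟩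
  · refine ContDiffAt.mul ?_ ?_
    · have hm : update x i ξ ∈ unitCube D := by
        intro j
        by_cases hj : j = i
        · subst hj; simpa using hξ
        · simpa [hj] using hx j
      have hs : ContDiff ℝ (N-1:ℕ) (fun x : Fin D → ℝ => update x i ξ) := by
        rw [contDiff_pi]
        intro j
        by_cases hj : j = i
        · subst hj; simpa using contDiff_const
        · simpa [hj] using contDiff_apply ℝ ℝ j
      exact ContDiffAt.comp x (g := u) (hu.1 _ hm) hs.contDiffAt
    · exact ContDiffAt.comp x (g := b) hb.1.contDiffAt
        (contDiff_const.mul (contDiff_apply ℝ ℝ i)).contDiffAt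
  · have h0 : 0 ≤ M * ξ := mul_nonneg hM'.le hξ.1.le
    set κ : Fin M := ⟨⌊(M:ℝ) * ξ⌋₊, by rw [Nat.floor_lt h0]; nlinarith [hξ.2]⟩ with hκ
    obtain ⟨f, hf, e⟩ := hu.2 (update m i κ)
    obtain ⟨q, hq, e'⟩ := hb.2 ((m i : ℕ) : ℤ)
    refine ⟨_, hf.fix_mul i ξ (q.comp (Polynomial.C (M:ℝ) * Polynomial.X)) ?_, fun x hx => ?_⟩
    · refine Polynomial.natDegree_comp_le.trans ?_
      calc _ ≤ N * 1 := Nat.mul_le_mul hq ((Polynomial.natDegree_C_mul_le _ _).trans Polynomial.natDegree_X_le)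
        _ = N := mul_one N
    · have h1 := update_mem_cell hM hx i κ (ξ := ξ) ⟨Nat.floor_le h0, Nat.lt_floor_add_one _⟩
      have h2 := (mem_cell_iff hM).1 hx i
      rw [e _ h1, e' (M * x i) (by simpa using h2)]
      simp

end

def nbhd (D N M : ℕ) (m : Fin D → Fin M) : Set (Fin D → ℝ) :=
  {x | x ∈ hcube D ∧ ∀ j, ((m j:ℕ):ℝ) - N ≤ M * x j ∧ M * x j < (m j:ℕ) + 1}

theorem cell_nbhd {D N M : ℕ} (hM : 1 ≤ M) {m : Fin D → Fin M} {x} (hx : x ∈ cell D M m) : x ∈ nbhd D N M m :=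
  ⟨cell_sub hM hx, fun j => by
    have := (mem_cell_iff hM).1 hx j
    exact ⟨by have : (0:ℝ) ≤ N := by positivity
              linarith, this.2⟩⟩

/-- local polynomial approximability in every coordinate direction -/
def LocApp (D N M : ℕ) (g : (Fin D → ℝ) → ℝ) (m : Fin D → Fin M) (ε : ℝ) : Prop :=
  ∀ i, ∀ x ∈ nbhd D N M m, ∃ q : Polynomial ℝ, q.natDegree ≤ N ∧
    ∀ τ : ℝ, update x i (τ / M) ∈ nbhd D N M m → |g (update x i (τ/M)) - q.eval τ| ≤ ε

theorem win_card (M N : ℕ) (y : ℝ) :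
    ((Finset.range M).filter fun k : ℕ => (k:ℝ) ≤ y ∧ y < k + N + 1).card ≤ N + 1 := by
  have : ((Finset.range M).filter fun k : ℕ => (k:ℝ) ≤ y ∧ y < k + N + 1) ⊆
      Finset.Icc (⌊y⌋₊ - N) (⌊y⌋₊) := by
    intro k hk
    simp only [Finset.mem_filter, Finset.mem_Icc] at *
    have h0 : 0 ≤ y := le_trans (by positivity) hk.2.1
    refine ⟨?_, Nat.le_floor hk.2.1⟩
    have : ⌊y⌋₊ < k + N + 1 := by rw [Nat.floor_lt h0]; push_cast; exact hk.2.2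
    omega
  refine (Finset.card_le_card this).trans ?_
  simp; omega

theorem quasiD (D N : ℕ) (hN : 1 ≤ N) : ∃ C : ℝ, 1 ≤ C ∧ ∀ M : ℕ, 1 ≤ M → ∀ g : (Fin D → ℝ) → ℝ,
    ∃ v, IsSpline D M (N+1) v ∧ ∀ m ε, 0 ≤ ε → LocApp D N M g m ε → ∀ x ∈ cell D M m, |v x - g x| ≤ C * ε := by
  obtain ⟨C, A, hC, hA⟩ := quasi1 N hN
  set C1 : ℝ := (N+1) * ((N+1) * C) with hC1
  have hC1p : 1 ≤ C1 := by
    have : (0:ℝ) ≤ N := by positivity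
    rw [hC1]; nlinarith [mul_nonneg this this, mul_nonneg this (by linarith : 0 ≤ C)]
  -- sum bound
  have sb : ∀ M : ℕ, 1 ≤ M → ∀ y : ℝ, 0 ≤ y → y < M → ∀ (φ : ℕ → Fin (N+1) → ℝ) (B : ℝ), 0 ≤ B →
      (∀ (k : ℕ) l, k < M → (k:ℝ) ≤ y → y < k + N + 1 → |φ k l| ≤ B) →
      |∑ k ∈ Finset.range M, ∑ l, φ k l * A M k l y| ≤ C1 * B := by
    intro M hM y hy0 hyM φ B hB hφ
    refine (Finset.abs_sum_le_sum_abs _ _).trans ?_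
    calc _ ≤ ∑ k ∈ Finset.range M, if ((k:ℝ) ≤ y ∧ y < k + N + 1) then (N+1) * (B * C) else 0 := by
          refine Finset.sum_le_sum fun k hk => ?_
          rw [Finset.mem_range] at hk
          split_ifs with h
          · refine (Finset.abs_sum_le_sum_abs _ _).trans ?_
            calc _ ≤ ∑ l : Fin (N+1), B * C := Finset.sum_le_sum fun l _ => by
                  rw [abs_mul]
                  exact mul_le_mul (hφ k l hk h.1 h.2) ((hA M hM).2.1 k l y hk hy0 hyM).1 (abs_nonneg _) hB
              _ = _ := by simp
          · have : ∀ l, A M k l y = 0 := fun l => by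
              by_contra h'; exact h (((hA M hM).2.1 k l y hk hy0 hyM).2 h')
            simp [this]
      _ = ((Finset.range M).filter fun k : ℕ => (k:ℝ) ≤ y ∧ y < k + N + 1).card * ((N+1) * (B * C)) := by
          rw [← Finset.sum_filter]; simp
      _ ≤ (N+1) * ((N+1) * (B*C)) := by
          have := win_card M N y
          have h' : ((((Finset.range M).filter fun k : ℕ => (k:ℝ) ≤ y ∧ y < k + N + 1).card : ℕ) : ℝ) ≤ N + 1 := by
            exact_mod_cast this
          gcongr
      _ = _ := by rw [hC1]; ring
  have main : ∀ S : Finset (Fin D), ∃ CS : ℝ, 1 ≤ CS ∧ ∀ M, 1 ≤ M → ∀ g : (Fin D → ℝ) → ℝ,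
      ∃ v : (Fin D → ℝ) → ℝ, (∀ x0, IsSpline D M (N+1) (fun y => v (S.piecewise y x0))) ∧
      ∀ m ε, 0 ≤ ε → LocApp D N M g m ε → ∀ x ∈ nbhd D N M m,
        (∀ j ∈ S, ((m j:ℕ):ℝ) ≤ M * x j) → |v x - g x| ≤ CS * ε := by
    intro S
    induction S using Finset.induction_on with
    | empty =>
      refine ⟨1, le_rfl, fun M hM g => ⟨g, fun x0 => ?_, fun m ε hε _ x _ _ => ?_⟩⟩
      · simpa using sp_const (g x0)
      · simpa using hε
    | insert i S hi ih =>
      obtain ⟨CS, hCS, ih⟩ := ih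
      refine ⟨C1 * CS + (C1 + 1), by nlinarith, fun M hM g => ?_⟩
      have hM' : (0:ℝ) < M := by exact_mod_cast hM
      obtain ⟨v, hv, hve⟩ := ih M hM g
      set ξ : ℕ → Fin (N+1) → ℝ := fun k l => (k + nd N l) / M with hξ
      have hξm : ∀ k l, k < M → ξ k l ∈ Ioo (0:ℝ) 1 := by
        intro k l hk
        have h1 := nd_mem N l
        have h2 : (k:ℝ) + 1 ≤ M := by exact_mod_cast hk
        have h3 : (0:ℝ) ≤ k := by positivity
        simp only [hξ]
        exact ⟨div_pos (by linarith [h1.1]) hM', by rw [div_lt_one hM']; linarith [h1.2]⟩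
      have hMξ : ∀ k l, M * ξ k l = k + nd N l := fun k l => by simp only [hξ]; field_simp
      refine ⟨fun x => ∑ k ∈ Finset.range M, ∑ l, v (update x i (ξ k l)) * A M k l (M * x i), fun x0 => ?_, ?_⟩
      · refine sp_sum _ fun k hk => sp_sum _ fun l _ => ?_
        rw [Finset.mem_range] at hk
        have h1 := sp_mul hM (hv (update x0 i (ξ k l))) i (hξm k l hk) ((hA M hM).1 k l)
        convert h1 using 1
        funext y
        congr 2
        · funext j
          by_cases hj : j = i
          · subst hj; simp [hi]
          · by_cases hjS : j ∈ S <;> simp [hj, hjS, Finset.piecewise]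
        · simp [Finset.piecewise]
      · intro m ε hε hL x hx hxS
        have hxi0 := (hx.1 i)
        have hy0 : 0 ≤ M * x i := mul_nonneg hM'.le hxi0.1
        have hyM : M * x i < M := by nlinarith [hxi0.2]
        have hxm := hxS i (by simp)
        have hxm2 := (hx.2 i).2
        have hin : ∀ k l, k < M → (k:ℝ) ≤ M * x i → M * x i < k + N + 1 →
            update x i (ξ k l) ∈ nbhd D N M m := by
          intro k l hk h1 h2
          have h3 : k < (m i:ℕ) + 1 := by exact_mod_cast h1.trans_lt hxm2
          have h4 : (m i:ℕ) < k + N + 1 := by exact_mod_cast hxm.trans_lt h2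
          have h3' : (k:ℝ) ≤ (m i:ℕ) := by exact_mod_cast Nat.lt_succ_iff.1 h3
          have h4' : ((m i:ℕ):ℝ) ≤ k + N := by exact_mod_cast Nat.lt_succ_iff.1 h4
          have h5 := hξm k l hk
          have h6 := nd_mem N l
          refine ⟨fun j => ?_, fun j => ?_⟩
          · by_cases hj : j = i
            · subst hj; simpa using ⟨h5.1.le, h5.2⟩
            · simpa [hj] using hx.1 j
          · by_cases hj : j = i
            · subst hj; rw [update_self, hMξ]; constructor <;> linarith [h6.1, h6.2]
            · simpa [hj] using hx.2 j
        obtain ⟨q, hq, hqe⟩ := hL i x hx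
        have e1 : (∑ k ∈ Finset.range M, ∑ l, v (update x i (ξ k l)) * A M k l (M * x i)) - g x =
            (∑ k ∈ Finset.range M, ∑ l, (v (update x i (ξ k l)) - g (update x i (ξ k l))) * A M k l (M * x i)) +
            ((∑ k ∈ Finset.range M, ∑ l, (g (update x i (ξ k l)) - q.eval (k + nd N l)) * A M k l (M * x i))
              + (q.eval (M * x i) - g x)) := by
          have := (hA M hM).2.2 q hq (M * x i)
          simp only [sub_mul, Finset.sum_sub_distrib, this]; ring
        show |(∑ k ∈ Finset.range M, ∑ l, v (update x i (ξ k l)) * A M k l (M * x i)) - g x| ≤ _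
        rw [e1]
        refine (abs_add_le _ _).trans ?_
        have b1 := sb M hM (M * x i) hy0 hyM (fun k l => v (update x i (ξ k l)) - g (update x i (ξ k l)))
          (CS * ε) (by positivity) (fun k l hk h1 h2 => hve m ε hε hL _ (hin k l hk h1 h2) (fun j hj => by
            have hji : j ≠ i := by rintro rfl; exact hi hj
            rw [update_of_ne hji]; exact hxS j (by simp [hj])))
        have b2 := sb M hM (M * x i) hy0 hyM (fun k l => g (update x i (ξ k l)) - q.eval (k + nd N l))
          ε hε (fun k l hk h1 h2 => hqe (k + nd N l) (hin k l hk h1 h2))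
        have b3 : |q.eval (M * x i) - g x| ≤ ε := by
          have e2 : update x i (M * x i / M) = x := by
            rw [mul_div_cancel_left₀ _ hM'.ne']; simp
          have := hqe (M * x i) (by rw [e2]; exact hx)
          rw [e2, abs_sub_comm] at this; exact this
        have b4 := (abs_add_le (∑ k ∈ Finset.range M, ∑ l, (g (update x i (ξ k l)) - q.eval (k + nd N l)) * A M k l (M * x i)) (q.eval (M * x i) - g x))
        calc _ ≤ C1 * (CS * ε) + (C1 * ε + ε) := add_le_add b1 (b4.trans (add_le_add b2 b3))
          _ = _ := by ring
  obtain ⟨CS, hCS, h⟩ := main Finset.univ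
  refine ⟨CS, hCS, fun M hM g => ?_⟩
  obtain ⟨v, hv, he⟩ := h M hM g
  exact ⟨v, by simpa using hv 0, fun m ε hε hL x hx => he m ε hε hL x (cell_nbhd hM hx)
    fun j _ => ((mem_cell_iff hM).1 hx j).1⟩

theorem cutoff (D N : ℕ) (hN : 1 ≤ N) : ∃ C : ℝ, 1 ≤ C ∧ ∀ M, 1 ≤ M → ∀ (i : Fin D) (k : ℕ), k + N < M →
    ∀ u, IsSpline D M (N+1) u → ∃ R, IsSpline D M (N+1) R ∧
      (∀ x ∈ hcube D, M * x i < k → R x = 0) ∧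
      (∀ x ∈ hcube D, k + N ≤ M * x i → R x = u x) ∧
      (∀ x ∈ hcube D, k ≤ M * x i → M * x i < k + N → ∀ B,
        (∀ t ∈ Ico (0:ℝ) 1, |u (update x i ((k + N + t)/M))| ≤ B) → |R x| ≤ C * B) := by
  choose ρ hρ hρ0 hρ1 using fun l => cut hN ((lb N l).comp (Polynomial.X - Polynomial.C (N:ℝ))) (comp_sub_deg _ (lb_deg N l) _)
  have h2 : ∀ l, ∃ B : ℝ, ∀ y : ℝ, |y| ≤ N → |ρ l y| ≤ B := fun l => by
    obtain ⟨c, hc⟩ := (isCompact_Icc (a := -(N:ℝ)) (b := N)).exists_bound_of_continuousOn (hρ l).1.continuous.continuousOn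
    exact ⟨c, fun t ht => hc t (abs_le.1 ht)⟩
  choose B2 hB2 using h2
  refine ⟨1 + ∑ l, |B2 l|, by
    have : 0 ≤ ∑ l, |B2 l| := Finset.sum_nonneg fun _ _ => abs_nonneg _
    linarith, fun M hM i k hk u hu => ?_⟩
  have hM' : (0:ℝ) < M := by exact_mod_cast hM
  set ξ : Fin (N+1) → ℝ := fun l => (k + N + nd N l) / M with hξ
  have hkM : (k:ℝ) + N + 1 ≤ M := by exact_mod_cast hk
  have hMξ : ∀ l, M * ξ l = k + N + nd N l := fun l => by simp only [hξ]; field_simp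
  have hξm : ∀ l, ξ l ∈ Ioo (0:ℝ) 1 := by
    intro l
    have h1 := nd_mem N l
    have h3 : (0:ℝ) ≤ k := by positivity
    have h4 : (0:ℝ) ≤ N := by positivity
    simp only [hξ]
    exact ⟨div_pos (by linarith [h1.1]) hM', by rw [div_lt_one hM']; linarith [h1.2]⟩
  set R1 : (Fin D → ℝ) → ℝ := fun x => ∑ l, u (update x i (ξ l)) * ρ l (M * x i - (k:ℤ)) with hR1
  have hR1s : IsSpline D M (N+1) R1 := sp_sum _ fun l _ => sp_mul hM hu i (hξm l) ((hρ l).shift k)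
  -- agreement on the layer
  have agree : ∀ x ∈ hcube D, k + N ≤ M * x i → M * x i < k + N + 1 → R1 x = u x := by
    intro x hx h1 h2
    obtain ⟨m, hm⟩ := exists_cell hM hx
    obtain ⟨f, hf, e⟩ := (sp_iff.1 hu).2 m
    have hmi := (mem_cell_iff hM).1 hm i
    have hmi' : (m i : ℕ) = k + N := by
      have a1 : (m i:ℕ) < k + N + 1 := by exact_mod_cast hmi.1.trans_lt h2
      have a2 : k + N < (m i:ℕ) + 1 := by exact_mod_cast h1.trans_lt hmi.2
      omega
    have hupd : ∀ l, update x i (ξ l) ∈ cell D M m := by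
      intro l
      have := update_mem_cell hM hm i (m i) (ξ := ξ l) (by
        rw [hMξ, hmi']; push_cast; have := nd_mem N l; constructor <;> linarith [this.1, this.2])
      simpa using this
    simp only [hR1]
    rw [e x hm]
    have hf' := hf.affine (1/M) (update (0 : Fin D → ℝ) i ((k+N)/M))
    have hl := hf'.lagr (fun j => if j = i then 0 else M * x j) i (M * x i - k - N)
    have e1 : ∀ t : ℝ, (fun j => (update (0 : Fin D → ℝ) i (((k:ℝ)+N)/M)) j + 1/M * (update (fun j => if j = i then 0 else M * x j) i t) j)
        = update x i ((k + N + t)/M) := by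
      intro t
      funext j
      by_cases hj : j = i
      · subst hj; simp; field_simp
      · simp [hj]; field_simp
    simp only [e1] at hl
    have e2 : update x i (((k:ℝ) + N + (M * x i - k - N))/M) = x := by
      have : ((k:ℝ) + N + (M * x i - k - N))/M = x i := by field_simp; ring
      rw [this]; simp
    rw [e2] at hl
    rw [hl]
    refine Finset.sum_congr rfl fun l _ => ?_
    rw [e _ (hupd l), hρ1 l _ (by push_cast; linarith)]
    simp only [hξ]; simp
  set R : (Fin D → ℝ) → ℝ := fun x => if M * x i < k + N + 1 then R1 x else u x with hR
  have hRu : ∀ x ∈ hcube D, k + N ≤ M * x i → R x = u x := by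
    intro x hx h
    simp only [hR]; split_ifs with h2
    · exact agree x hx h h2
    · rfl
  refine ⟨R, ?_, ?_, hRu, ?_⟩
  · rw [sp_iff]
    have hcont : Continuous (fun x : Fin D → ℝ => (M:ℝ) * x i) := by fun_prop
    refine ⟨fun x hx => ?_, fun m => ?_⟩
    · by_cases h : M * x i < k + N + 1
      · refine ((sp_iff.1 hR1s).1 x hx).congr_of_eventuallyEq ?_
        filter_upwards [hcont.continuousAt.eventually_lt continuousAt_const h] with z hz
        simp only [hR, if_pos hz]
      · push Not at h
        refine ((sp_iff.1 hu).1 x hx).congr_of_eventuallyEq ?_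
        have h' : (k:ℝ) + N < M * x i := by linarith
        filter_upwards [continuousAt_const.eventually_lt hcont.continuousAt h', (isOpen_unitCube D).mem_nhds hx] with z hz hz2
        exact hRu z (unitCube_sub D hz2) hz.le
    · by_cases h : (m i : ℕ) ≤ k + N
      · obtain ⟨f, hf, e⟩ := (sp_iff.1 hR1s).2 m
        refine ⟨f, hf, fun x hx => ?_⟩
        have h1 := ((mem_cell_iff hM).1 hx i).2
        have h2 : ((m i:ℕ):ℝ) ≤ k + N := by exact_mod_cast h
        rw [← e x hx]; simp only [hR]; rw [if_pos (by linarith)]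
      · obtain ⟨f, hf, e⟩ := (sp_iff.1 hu).2 m
        refine ⟨f, hf, fun x hx => ?_⟩
        have h1 := ((mem_cell_iff hM).1 hx i).1
        have h2 : (k:ℝ) + N ≤ (m i:ℕ) := by push Not at h; exact_mod_cast h.le
        rw [← e x hx]; exact hRu x (cell_sub hM hx) (by linarith)
  · intro x hx h
    have : (0:ℝ) ≤ N := by positivity
    simp only [hR]; rw [if_pos (by linarith)]
    exact Finset.sum_eq_zero fun l _ => by rw [hρ0 l _ (by push_cast; linarith), mul_zero]
  · intro x hx h1 h2 B hB
    have hB0 : 0 ≤ B := (abs_nonneg _).trans (hB 0 (by simp))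
    simp only [hR]; rw [if_pos (by linarith)]
    refine (Finset.abs_sum_le_sum_abs _ _).trans ?_
    calc _ ≤ ∑ l, B * |B2 l| := Finset.sum_le_sum fun l _ => by
          rw [abs_mul]
          refine mul_le_mul (hB _ ⟨(nd_mem N l).1.le, (nd_mem N l).2⟩) ?_ (abs_nonneg _) hB0
          refine (hB2 l _ ?_).trans (le_abs_self _)
          push_cast
          rw [abs_le]; constructor <;> linarith
      _ = (∑ l, |B2 l|) * B := by rw [← Finset.mul_sum]; ring
      _ ≤ _ := by nlinarith

end LPC

namespace LPC
open Set Function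

theorem win_upper (K : ℕ) (a B : ℝ) (hB : 0 ≤ B) :
    (((Finset.univ : Finset (Fin K)).filter fun j : Fin K => |((j:ℕ):ℝ) - a| ≤ B).card : ℝ) ≤ 2 * B + 1 := by
  have h : ((Finset.univ : Finset (Fin K)).filter fun j : Fin K => |((j:ℕ):ℝ) - a| ≤ B).card ≤
      (Finset.Icc ⌈a - B⌉ ⌊a + B⌋).card := by
    refine Finset.card_le_card_of_injOn (fun j : Fin K => ((j:ℕ):ℤ)) ?_ ?_
    · intro j hj
      have hj' : |((j:ℕ):ℝ) - a| ≤ B := by simpa using hj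
      rw [abs_le] at hj'
      simp only [Finset.coe_Icc, mem_Icc]
      exact ⟨Int.ceil_le.2 (by push_cast; linarith), Int.le_floor.2 (by push_cast; linarith)⟩
    · intro j _ j' _ h
      have h' : ((j:ℕ):ℤ) = (j':ℕ) := h
      exact Fin.ext (by exact_mod_cast h')
  rw [Int.card_Icc] at h
  have h1 : ((⌊a + B⌋ + 1 - ⌈a - B⌉).toNat : ℝ) ≤ 2 * B + 1 := by
    rcases le_total 0 (⌊a + B⌋ + 1 - ⌈a - B⌉) with h2 | h2
    · have : (((⌊a + B⌋ + 1 - ⌈a - B⌉).toNat : ℤ) : ℝ) = ((⌊a + B⌋ + 1 - ⌈a - B⌉ : ℤ) : ℝ) := by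
        rw [Int.toNat_of_nonneg h2]
      have h3 : ((⌊a + B⌋ + 1 - ⌈a - B⌉).toNat : ℝ) = ((⌊a + B⌋ + 1 - ⌈a - B⌉ : ℤ) : ℝ) := by
        rw [← this]; exact (Int.cast_natCast _).symm
      rw [h3]; push_cast
      linarith [Int.floor_le (a+B), Int.le_ceil (a-B)]
    · rw [Int.toNat_of_nonpos h2]; simp; linarith
  calc _ ≤ _ := Nat.cast_le.2 h
    _ ≤ _ := h1

theorem win_upperD (D K : ℕ) (a : Fin D → ℝ) (B : ℝ) (hB : 0 ≤ B) (S : Finset (Fin D → Fin K))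
    (hS : ∀ k ∈ S, ∀ i, |((k i:ℕ):ℝ) - a i| ≤ B) : (S.card : ℝ) ≤ (2*B+1)^D := by
  have hsub : S ⊆ Fintype.piFinset fun i => (Finset.univ : Finset (Fin K)).filter fun j : Fin K => |((j:ℕ):ℝ) - a i| ≤ B := by
    intro k hk
    rw [Fintype.mem_piFinset]
    intro i
    simpa using hS k hk i
  calc (S.card : ℝ) ≤ _ := Nat.cast_le.2 (Finset.card_le_card hsub)
    _ = ∏ i : Fin D, (((Finset.univ : Finset (Fin K)).filter fun j : Fin K => |((j:ℕ):ℝ) - a i| ≤ B).card : ℝ) := by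
      rw [Fintype.card_piFinset]; push_cast; rfl
    _ ≤ ∏ i : Fin D, (2*B+1) := Finset.prod_le_prod (fun _ _ => by positivity) fun i _ => win_upper K _ _ hB
    _ = _ := by simp

theorem win_lower (K : ℕ) (a : ℝ) (ha : 0 ≤ a) (haK : a < K) (q : ℕ) (hq : q ≤ K) :
    q ≤ ((Finset.univ : Finset (Fin K)).filter fun j : Fin K => |((j:ℕ):ℝ) - a| ≤ q).card := by
  set b := min ⌈a⌉₊ (K - q) with hb
  have hbq : b + q ≤ K := by omega
  have h := Finset.card_le_card_of_injOn (s := (Finset.univ : Finset (Fin q)))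
    (t := (Finset.univ : Finset (Fin K)).filter fun j : Fin K => |((j:ℕ):ℝ) - a| ≤ q)
    (fun j => (⟨b + j, by omega⟩ : Fin K)) ?_ ?_
  · simpa using h
  · intro j _
    simp only [Finset.coe_filter, Finset.mem_univ, true_and, mem_ofPred_eq]
    have hj : ((j:ℕ):ℝ) + 1 ≤ q := by exact_mod_cast j.2
    have hj0 : (0:ℝ) ≤ (j:ℕ) := by positivity
    have h1 : (b:ℝ) ≤ a + 1 := by
      have : (b:ℝ) ≤ ⌈a⌉₊ := by exact_mod_cast min_le_left _ _
      linarith [Nat.ceil_lt_add_one ha]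
    have h2 : a - q ≤ b := by
      rcases min_choice ⌈a⌉₊ (K - q) with h | h
      · rw [hb, h]
        have := Nat.le_ceil a
        have : (0:ℝ) ≤ q := by positivity
        linarith
      · rw [hb, h, Nat.cast_sub hq]; linarith
    push_cast
    rw [abs_le]; constructor <;> linarith
  · intro j _ j' _ h
    simp only [Fin.mk.injEq] at h
    exact Fin.ext (by omega)

theorem scaled_mem {D M : ℕ} (hM : 1 ≤ M) (m : Fin D → Fin M) {y : Fin D → ℝ} (hy : y ∈ hcube D) :
    (fun i => ((m i:ℕ):ℝ)/M + 1/M * y i) ∈ cell D M m := by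
  have hM' : (0:ℝ) < M := by exact_mod_cast hM
  rw [mem_cell_iff hM]
  intro i
  have := hy i
  have e : (M:ℝ) * (((m i:ℕ):ℝ)/M + 1/M * y i) = (m i:ℕ) + y i := by field_simp
  rw [e]
  exact ⟨by linarith [this.1], by linarith [this.2]⟩

theorem unscaled_mem {D M : ℕ} (hM : 1 ≤ M) (m : Fin D → Fin M) {x : Fin D → ℝ} (hx : x ∈ cell D M m) :
    (fun i => M * x i - (m i:ℕ)) ∈ hcube D := fun i => by
  have := (mem_cell_iff hM).1 hx i
  exact ⟨by linarith [this.1], by linarith [this.2]⟩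

theorem scaled_unscaled {D M : ℕ} (hM : 1 ≤ M) (m : Fin D → Fin M) (x : Fin D → ℝ) :
    (fun i => ((m i:ℕ):ℝ)/M + 1/M * (M * x i - (m i:ℕ))) = x := by
  have hM' : (0:ℝ) < M := by exact_mod_cast hM
  funext i; field_simp; ring

theorem particles (D N n : ℕ) (L : ℝ) (hL : 1 ≤ L) : ∃ d₀ c C : ℝ, d₀ ∈ Ioo (0:ℝ) 1 ∧ 0 < c ∧ 1 ≤ C ∧
    ∀ Φ Ψ, GoodMap D n L Φ Ψ → ∀ M K : ℕ, 1 ≤ M → 1 ≤ K → (M:ℝ) ≤ d₀ * K →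
    ∀ x0 : (Fin D → Fin K) → (Fin D → ℝ), (∀ k, x0 k ∈ cell D K k) →
    ∀ ci : (Fin D → Fin K) → (Fin D → Fin M), (∀ k, Ψ (x0 k) ∈ cell D M (ci k)) →
    (∀ m, ((Finset.univ.filter fun k => ci k = m).card : ℝ) ≤ C * ((K:ℝ)/M)^D) ∧
    ∀ u, IsSpline D M (N+1) u → ∀ m, ∀ x ∈ cell D M m,
      c * ((K:ℝ)/M)^D * (u x)^2 ≤ ∑ k ∈ Finset.univ.filter (fun k => ci k = m), (u (Ψ (x0 k)))^2 := by
  obtain ⟨ρ, hρ0, hρ8, hρ⟩ := norming D N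
  have hLp : 0 < L := by linarith
  refine ⟨ρ/(4*L), (ρ/(2*L))^D/16, (5*L)^D, ⟨by positivity, ?_⟩, by positivity, one_le_pow₀ (by linarith), ?_⟩
  · rw [div_lt_one (by positivity)]; linarith
  intro Φ Ψ hG M K hM hK hMK x0 hx0 ci hci
  have hM' : (0:ℝ) < M := by exact_mod_cast hM
  have hK' : (0:ℝ) < K := by exact_mod_cast hK
  have hKM : 4 * L / ρ ≤ K / M := by
    rw [div_le_div_iff₀ hρ0 hM']
    have : (M:ℝ) * (4*L) ≤ ρ * K := by
      calc (M:ℝ) * (4*L) ≤ ρ/(4*L)*K * (4*L) := by gcongr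
        _ = _ := by field_simp
    linarith
  have hKM1 : 1 ≤ (K:ℝ)/M := by
    refine le_trans ?_ hKM
    rw [le_div_iff₀ hρ0]; linarith
  have hx0h : ∀ k, x0 k ∈ ccube D := fun k => hcube_sub D (cell_sub hK (hx0 k))
  have hyh : ∀ k, Ψ (x0 k) ∈ ccube D := fun k => hcube_sub D (cell_sub hM (hci k))
  refine ⟨fun m => ?_, fun u hu m x hx => ?_⟩
  · rcases (Finset.univ.filter fun k => ci k = m).eq_empty_or_nonempty with h | ⟨k', hk'⟩
    · rw [h]; simp; positivity
    have hk'm : ci k' = m := by simpa using hk'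
    have h1 := win_upperD D K (fun i => ((k' i:ℕ):ℝ)) (L*(K/M)+1) (by positivity) (Finset.univ.filter fun k => ci k = m) ?_
    · refine h1.trans ?_
      rw [← mul_pow]
      refine pow_le_pow_left₀ (by positivity) ?_ D
      nlinarith
    · intro k hk i
      have hkm : ci k = m := by simpa using hk
      have a1 : ‖Ψ (x0 k) - Ψ (x0 k')‖ ≤ 1/M := by
        rw [pi_norm_le_iff_of_nonneg (by positivity)]
        intro j
        have b1 := (mem_cell_iff hM).1 (hci k) j
        have b2 := (mem_cell_iff hM).1 (hci k') j
        rw [hkm] at b1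
        rw [hk'm] at b2
        rw [Pi.sub_apply, Real.norm_eq_abs, le_div_iff₀ hM']
        rw [show |Ψ (x0 k) j - Ψ (x0 k') j| * (M:ℝ) = |(Ψ (x0 k) j - Ψ (x0 k') j) * M| by rw [abs_mul, abs_of_pos hM'], abs_le]
        constructor <;> nlinarith
      have a2 := hG.lip1 _ (hyh k) _ (hyh k')
      rw [hG.inv1, hG.inv1] at a2
      have a3 : |x0 k i - x0 k' i| ≤ L * (1/M) := by
        have := norm_le_pi_norm (x0 k - x0 k') i
        rw [Pi.sub_apply, Real.norm_eq_abs] at this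
        exact (this.trans a2).trans (by gcongr)
      have c1 := (mem_cell_iff hK).1 (hx0 k) i
      have c2 := (mem_cell_iff hK).1 (hx0 k') i
      have a4 : K * |x0 k i - x0 k' i| ≤ L * (K/M) := by
        calc _ ≤ (K:ℝ) * (L * (1/M)) := by gcongr
          _ = _ := by ring
      have a5 := abs_le.1 (show |K * x0 k i - K * x0 k' i| ≤ L*(K/M) by
        rw [← mul_sub, abs_mul, abs_of_pos hK']; exact a4)
      rw [abs_le]; constructor <;> linarith [a5.1, a5.2]
  · obtain ⟨f, hf, e⟩ := (sp_iff.1 hu).2 m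
    have hf' := hf.affine (1/M) (fun i => ((m i:ℕ):ℝ)/M)
    obtain ⟨z, hz, hzf⟩ := hρ _ hf'
    set z' : Fin D → ℝ := fun i => ((m i:ℕ):ℝ)/M + 1/M * z i with hz'
    have hzh : z ∈ hcube D := fun i => ⟨by linarith [(hz i).1], by linarith [(hz i).2]⟩
    have hz'c : z' ∈ cell D M m := scaled_mem hM m hzh
    set ζ := Φ z' with hζ
    have hζh : ζ ∈ hcube D := hG.hc1 _ (cell_sub hM hz'c)
    set B := ρ * (K/M) / L with hBdef
    have hB4 : 4 ≤ B := by
      rw [hBdef, le_div_iff₀ hLp]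
      calc 4 * L = ρ * (4 * L/ρ) := by field_simp
        _ ≤ _ := by gcongr
    set q := ⌊B - 1⌋₊ with hq
    have hqB : (q:ℝ) ≤ B - 1 := Nat.floor_le (by linarith)
    have hqB' : B / 2 ≤ q := by
      have := Nat.lt_floor_add_one (B - 1)
      rw [← hq] at this; linarith
    have hBK : B ≤ K := by
      rw [hBdef, div_le_iff₀ hLp]
      have h1 : (1:ℝ) ≤ M := by exact_mod_cast hM
      have : (K:ℝ)/M ≤ K := div_le_self hK'.le h1
      nlinarith
    have hqK : q ≤ K := by
      have : (q:ℝ) ≤ K := by linarith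
      exact_mod_cast this
    set S := Fintype.piFinset fun i => (Finset.univ : Finset (Fin K)).filter fun j : Fin K => |((j:ℕ):ℝ) - K * ζ i| ≤ q with hS
    have hScard : (B/2)^D ≤ (S.card:ℝ) := by
      rw [hS, Fintype.card_piFinset]; push_cast
      calc (B/2)^D = ∏ i : Fin D, (B/2) := by simp [div_pow]
        _ ≤ _ := Finset.prod_le_prod (fun _ _ => by positivity) fun i _ => hqB'.trans ?_
      exact_mod_cast win_lower K (K * ζ i) (mul_nonneg hK'.le (hζh i).1) (by nlinarith [(hζh i).2]) q hqK
    have hmem : ∀ k ∈ S, ‖(fun i => M * Ψ (x0 k) i - (m i:ℕ)) - z‖ ≤ ρ := by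
      intro k hk
      rw [hS, Fintype.mem_piFinset] at hk
      have a1 : ‖x0 k - ζ‖ ≤ ρ / (M * L) := by
        rw [pi_norm_le_iff_of_nonneg (by positivity)]
        intro i
        have b1 : |((k i:ℕ):ℝ) - K * ζ i| ≤ q := by simpa using hk i
        rw [abs_le] at b1
        have b2 := (mem_cell_iff hK).1 (hx0 k) i
        rw [Pi.sub_apply, Real.norm_eq_abs]
        have b3 : |K * (x0 k i - ζ i)| ≤ B := by
          rw [abs_le]; constructor <;> linarith [b1.1, b1.2, b2.1, b2.2]
        rw [abs_mul, abs_of_pos hK'] at b3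
        rw [hBdef] at b3
        calc |x0 k i - ζ i| = K * |x0 k i - ζ i| / K := by field_simp
          _ ≤ ρ * (K/M) / L / K := by gcongr
          _ = _ := by field_simp
      have a2 := hG.lip2 _ (hx0h k) _ (hcube_sub D hζh)
      rw [hζ, hG.inv2, ← hζ] at a2
      have a3 : ‖Ψ (x0 k) - z'‖ ≤ ρ / M := a2.trans (by
        calc _ ≤ L * (ρ/(M*L)) := by gcongr
          _ = _ := by field_simp)
      rw [pi_norm_le_iff_of_nonneg hρ0.le]
      intro i
      have a4 := (norm_le_pi_norm _ i).trans a3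
      rw [Pi.sub_apply, Real.norm_eq_abs, le_div_iff₀ hM'] at a4
      have e1 : ((fun i => M * Ψ (x0 k) i - ((m i:ℕ):ℝ)) - z) i = (Ψ (x0 k) i - z' i) * M := by
        simp only [Pi.sub_apply, hz']; field_simp; ring
      rw [e1, Real.norm_eq_abs, abs_mul, abs_of_pos hM']; exact a4
    have hSsub : S ⊆ Finset.univ.filter (fun k => ci k = m) := by
      intro k hk
      have h1 := hmem k hk
      simp only [Finset.mem_filter, Finset.mem_univ, true_and]
      refine cell_unique hM (hci k) ?_
      rw [← scaled_unscaled hM m (Ψ (x0 k))]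
      refine scaled_mem hM m (y := fun i => M * Ψ (x0 k) i - ((m i:ℕ):ℝ)) fun i => ?_
      have h2 := (norm_le_pi_norm _ i).trans h1
      rw [Pi.sub_apply, Real.norm_eq_abs, abs_le] at h2
      exact ⟨by linarith [h2.1, (hz i).1], by linarith [h2.2, (hz i).2]⟩
    have hpt : ∀ k ∈ S, (u x)^2 / 16 ≤ (u (Ψ (x0 k)))^2 := by
      intro k hk
      have hkm : ci k = m := by simpa using hSsub hk
      have h1 := hzf _ (unscaled_mem hM m hx) _ (hmem k hk)
      simp only [scaled_unscaled hM m] at h1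
      rw [← e x hx, ← e _ (hkm ▸ hci k)] at h1
      have := pow_le_pow_left₀ (abs_nonneg _) h1 2
      rw [mul_pow, sq_abs, sq_abs] at this
      linarith
    calc _ = (B/2)^D * ((u x)^2/16) := by
          have : B/2 = ρ/(2*L) * (K/M) := by rw [hBdef]; field_simp
          rw [this, mul_pow]; ring
      _ ≤ S.card * ((u x)^2/16) := by gcongr
      _ = ∑ k ∈ S, (u x)^2/16 := by simp
      _ ≤ ∑ k ∈ S, (u (Ψ (x0 k)))^2 := Finset.sum_le_sum hpt
      _ ≤ _ := Finset.sum_le_sum_of_subset_of_nonneg hSsub fun _ _ _ => sq_nonneg _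

end LPC

namespace LPC
open Set Function

structure Disc (D N M : ℕ) {ι : Type} [Fintype ι] (c C H : ℝ) (y : ι → Fin D → ℝ)
    (ci : ι → Fin D → Fin M) : Prop where
  hM : 1 ≤ M
  hc : 0 < c
  hC : 1 ≤ C
  hH : 0 < H
  mem : ∀ k, y k ∈ cell D M (ci k)
  count : ∀ m, ((Finset.univ.filter fun k => ci k = m).card : ℝ) ≤ C * H
  norm : ∀ u, IsSpline D M (N+1) u → ∀ m, ∀ x ∈ cell D M m,
    c * H * (u x)^2 ≤ ∑ k ∈ Finset.univ.filter (fun k => ci k = m), (u (y k))^2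

def en {D M : ℕ} {ι : Type} [Fintype ι] (y : ι → Fin D → ℝ) (ci : ι → Fin D → Fin M)
    (u : (Fin D → ℝ) → ℝ) (m : Fin D → Fin M) : ℝ :=
  ∑ k ∈ Finset.univ.filter (fun k => ci k = m), (u (y k))^2

theorem en_nonneg {D M : ℕ} {ι : Type} [Fintype ι] (y : ι → Fin D → ℝ) (ci : ι → Fin D → Fin M)
    (u : (Fin D → ℝ) → ℝ) (m : Fin D → Fin M) : 0 ≤ en y ci u m :=
  Finset.sum_nonneg fun _ _ => sq_nonneg _

theorem upd_sum {D M : ℕ} (e : (Fin D → Fin M) → ℝ) (he : ∀ m, 0 ≤ e m) (i : Fin D) (k N : ℕ) (κ : Fin M) :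
    ∑ m ∈ Finset.univ.filter (fun m : Fin D → Fin M => k ≤ (m i:ℕ) ∧ (m i:ℕ) < k + N), e (update m i κ) ≤
      N * ∑ m ∈ Finset.univ.filter (fun m : Fin D → Fin M => m i = κ), e m := by
  rw [← Finset.sum_fiberwise_of_maps_to (g := fun m : Fin D → Fin M => update m i κ)
    (t := Finset.univ.filter (fun m : Fin D → Fin M => m i = κ)), Finset.mul_sum]
  · refine Finset.sum_le_sum fun m' hm' => ?_
    rw [Finset.sum_congr rfl (g := fun _ => e m')]
    · rw [Finset.sum_const, nsmul_eq_mul]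
      refine mul_le_mul_of_nonneg_right ?_ (he _)
      rw [Nat.cast_le]
      have : (Finset.Ico k (k+N)).card = N := by simp
      rw [← this]
      refine Finset.card_le_card_of_injOn (fun m => (m i:ℕ)) ?_ ?_
      · intro m hm
        simp only [Finset.coe_filter, Finset.mem_filter, Finset.mem_univ, true_and, mem_ofPred_eq] at hm
        simpa using hm.1
      · intro m hm m2 hm2 h
        simp only [Finset.coe_filter, Finset.mem_filter, Finset.mem_univ, true_and, mem_ofPred_eq] at hm hm2
        have h' : m i = m2 i := Fin.ext h
        have h2 : update m i κ = update m2 i κ := hm.2.trans hm2.2.symm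
        funext j
        by_cases hj : j = i
        · rw [hj, h']
        · have := congrFun h2 j
          simpa [hj] using this
    · intro m hm
      rw [(Finset.mem_filter.1 hm).2]
  · intro m hm
    simp

theorem trans_bound (D N : ℕ) (c C C0 : ℝ) (hc : 0 < c) (hC : 1 ≤ C) : ∃ A : ℝ, 1 ≤ A ∧
    ∀ (M : ℕ) (ι : Type) [Fintype ι] (H : ℝ) (y : ι → Fin D → ℝ) (ci : ι → Fin D → Fin M),
    Disc D N M c C H y ci → ∀ u, IsSpline D M (N+1) u → ∀ R : (Fin D → ℝ) → ℝ,
    ∀ (i : Fin D) (k : ℕ) (hk : k + N < M),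
    (∀ m, k ≤ (m i:ℕ) → (m i:ℕ) < k + N → ∀ x ∈ cell D M m, ∀ B1 B2 : ℝ, (∀ x' ∈ cell D M m, |u x'| ≤ B1) →
      (∀ x' ∈ cell D M (update m i ⟨k+N, hk⟩), |u x'| ≤ B2) → |R x| ≤ C0 * (B1 + B2)) →
    ∑ m ∈ Finset.univ.filter (fun m : Fin D → Fin M => k ≤ (m i:ℕ) ∧ (m i:ℕ) < k + N),
      ∑ p ∈ Finset.univ.filter (fun p => ci p = m), |u (y p) * R (y p)| ≤
    A * ∑ m ∈ Finset.univ.filter (fun m : Fin D → Fin M => k ≤ (m i:ℕ) ∧ (m i:ℕ) < k + N + 1), en y ci u m := by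
  set A1 : ℝ := 1 + C * C0^2 / c with hA1
  have hA1p : 1 ≤ A1 := by rw [hA1]; have : 0 ≤ C * C0^2/c := by positivity
                           linarith
  refine ⟨A1 * (N+1), ?_, ?_⟩
  · have : (0:ℝ) ≤ N := by positivity
    nlinarith
  intro M ι _ H y ci h u hu R i k hk hR
  have hH := h.hH
  set κ : Fin M := ⟨k+N, hk⟩ with hκ
  set e := en y ci u with he
  have e0 : ∀ m, 0 ≤ e m := en_nonneg y ci u
  have key : ∀ m, k ≤ (m i:ℕ) → (m i:ℕ) < k + N →
      ∑ p ∈ Finset.univ.filter (fun p => ci p = m), |u (y p) * R (y p)| ≤ A1 * (e m + e (update m i κ)) := by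
    intro m h1 h2
    have hs : ∀ m, ∀ x ∈ cell D M m, |u x| ≤ Real.sqrt (e m/(c*H)) := by
      intro m x hx
      refine Real.abs_le_sqrt ?_
      rw [le_div_iff₀ (by positivity), mul_comm]
      exact h.norm u hu m x hx
    set b1 := Real.sqrt (e m/(c*H))
    set b2 := Real.sqrt (e (update m i κ)/(c*H))
    have hb1 : b1^2 = e m/(c*H) := Real.sq_sqrt (div_nonneg (e0 _) (by positivity))
    have hb2 : b2^2 = e (update m i κ)/(c*H) := Real.sq_sqrt (div_nonneg (e0 _) (by positivity))
    have hRp : ∀ p ∈ Finset.univ.filter (fun p => ci p = m),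
        |u (y p) * R (y p)| ≤ (u (y p))^2/2 + C0^2 * ((e m + e (update m i κ))/(c*H)) := by
      intro p hp
      have hpm : ci p = m := by simpa using hp
      have h3 := hR m h1 h2 (y p) (hpm ▸ h.mem p) b1 b2 (hs m) (hs _)
      have h4 : (R (y p))^2 ≤ 2 * C0^2 * (b1^2+b2^2) := by
        have := pow_le_pow_left₀ (abs_nonneg _) h3 2
        rw [sq_abs] at this
        nlinarith [mul_nonneg (sq_nonneg C0) (sq_nonneg (b1-b2))]
      rw [hb1, hb2] at h4
      rw [abs_mul, add_div]
      nlinarith [sq_nonneg (|u (y p)| - |R (y p)|), sq_abs (u (y p)), sq_abs (R (y p))]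
    calc _ ≤ ∑ p ∈ Finset.univ.filter (fun p => ci p = m), ((u (y p))^2/2 + C0^2 * ((e m + e (update m i κ))/(c*H))) :=
          Finset.sum_le_sum hRp
      _ = e m / 2 + ((Finset.univ.filter (fun p => ci p = m)).card : ℝ) * (C0^2 * ((e m + e (update m i κ))/(c*H))) := by
          rw [Finset.sum_add_distrib, Finset.sum_const, nsmul_eq_mul, ← Finset.sum_div]; rfl
      _ ≤ e m / 2 + (C * H) * (C0^2 * ((e m + e (update m i κ))/(c*H))) := by
          have := h.count m
          have h5 : 0 ≤ C0^2 * ((e m + e (update m i κ))/(c*H)) :=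
            mul_nonneg (sq_nonneg _) (div_nonneg (add_nonneg (e0 _) (e0 _)) (by positivity))
          gcongr
      _ = e m / 2 + C * C0^2/c * (e m + e (update m i κ)) := by field_simp
      _ ≤ _ := by rw [hA1]; nlinarith [e0 m, e0 (update m i κ)]
  set S := Finset.univ.filter (fun m : Fin D → Fin M => k ≤ (m i:ℕ) ∧ (m i:ℕ) < k + N) with hS
  set S' := Finset.univ.filter (fun m : Fin D → Fin M => k ≤ (m i:ℕ) ∧ (m i:ℕ) < k + N + 1) with hS'
  have s1 : ∑ m ∈ S, e m ≤ ∑ m ∈ S', e m := by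
    refine Finset.sum_le_sum_of_subset_of_nonneg ?_ fun _ _ _ => e0 _
    intro m; simp only [hS, hS', Finset.mem_filter, Finset.mem_univ, true_and]; omega
  have s2 : ∑ m ∈ Finset.univ.filter (fun m : Fin D → Fin M => m i = κ), e m ≤ ∑ m ∈ S', e m := by
    refine Finset.sum_le_sum_of_subset_of_nonneg ?_ fun _ _ _ => e0 _
    intro m; simp only [hS', hκ, Finset.mem_filter, Finset.mem_univ, true_and, Fin.ext_iff]; omega
  have s3 := upd_sum e e0 i k N κ
  calc _ ≤ ∑ m ∈ S, A1 * (e m + e (update m i κ)) := Finset.sum_le_sum fun m hm => by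
        have := (Finset.mem_filter.1 hm).2
        exact key m this.1 this.2
    _ = A1 * (∑ m ∈ S, e m + ∑ m ∈ S, e (update m i κ)) := by
        rw [← Finset.mul_sum, Finset.sum_add_distrib]
    _ ≤ A1 * (∑ m ∈ S', e m + N * ∑ m ∈ S', e m) := by
        have : (0:ℝ) ≤ N := by positivity
        have := s3.trans (mul_le_mul_of_nonneg_left s2 this)
        gcongr
    _ = _ := by ring

/-- energy decay over one block of `N+1` layers, in both directions -/
theorem decay_step (D N : ℕ) (hN : 1 ≤ N) (c C : ℝ) (hc : 0 < c) (hC : 1 ≤ C) : ∃ A : ℝ, 1 ≤ A ∧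
    ∀ (M : ℕ) (ι : Type) [Fintype ι] (H : ℝ) (y : ι → Fin D → ℝ) (ci : ι → Fin D → Fin M),
    Disc D N M c C H y ci → ∀ u, IsSpline D M (N+1) u → ∀ (g : ι → ℝ) (m0 : Fin D → Fin M),
    (∀ k, ci k ≠ m0 → g k = 0) →
    (∀ v, IsSpline D M (N+1) v → ∑ k, u (y k) * v (y k) = ∑ k, g k * v (y k)) →
    ∀ (i : Fin D) (k : ℕ) (hk : k + N < M),
    ((m0 i:ℕ) < k → ∑ m ∈ Finset.univ.filter (fun m : Fin D → Fin M => k + N ≤ (m i:ℕ)), en y ci u m ≤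
      A * ∑ m ∈ Finset.univ.filter (fun m : Fin D → Fin M => k ≤ (m i:ℕ) ∧ (m i:ℕ) < k + N + 1), en y ci u m) ∧
    (k + N ≤ (m0 i:ℕ) → ∑ m ∈ Finset.univ.filter (fun m : Fin D → Fin M => (m i:ℕ) < k), en y ci u m ≤
      A * ∑ m ∈ Finset.univ.filter (fun m : Fin D → Fin M => k ≤ (m i:ℕ) ∧ (m i:ℕ) < k + N + 1), en y ci u m) := by
  obtain ⟨C0, hC0, hcut⟩ := cutoff D N hN
  obtain ⟨A, hA, ht⟩ := trans_bound D N c C C0 hc hC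
  refine ⟨A, hA, ?_⟩
  intro M ι _ H y ci h u hu g m0 hg huv i k hk
  have hM' : (0:ℝ) < M := by exact_mod_cast h.hM
  obtain ⟨R, hR, hR0, hR1, hR2⟩ := hcut M h.hM i k hk u hu
  have R0 : ∀ m, (m i:ℕ) < k → ∀ x ∈ cell D M m, R x = 0 := fun m hm x hx => by
    refine hR0 x (cell_sub h.hM hx) ?_
    have := ((mem_cell_iff h.hM).1 hx i).2
    have h2 : ((m i:ℕ):ℝ) + 1 ≤ k := by exact_mod_cast hm
    linarith
  have R1 : ∀ m, k + N ≤ (m i:ℕ) → ∀ x ∈ cell D M m, R x = u x := fun m hm x hx => by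
    refine hR1 x (cell_sub h.hM hx) ?_
    have := ((mem_cell_iff h.hM).1 hx i).1
    have h2 : (k:ℝ) + N ≤ (m i:ℕ) := by exact_mod_cast hm
    linarith
  have R2 : ∀ m, k ≤ (m i:ℕ) → (m i:ℕ) < k + N → ∀ x ∈ cell D M m, ∀ B2 : ℝ,
      (∀ x' ∈ cell D M (update m i ⟨k+N, hk⟩), |u x'| ≤ B2) → |R x| ≤ C0 * B2 := by
    intro m h1 h2 x hx B2 hB
    have hx' := (mem_cell_iff h.hM).1 hx i
    have h3 : (k:ℝ) ≤ (m i:ℕ) := by exact_mod_cast h1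
    have h4 : ((m i:ℕ):ℝ) + 1 ≤ k + N := by exact_mod_cast h2
    refine hR2 x (cell_sub h.hM hx) (by linarith) (by linarith) B2 fun t htt => hB _ ?_
    refine update_mem_cell h.hM hx i _ ?_
    have : (M:ℝ) * ((k+N+t)/M) = k + N + t := by field_simp
    rw [this]; push_cast
    exact ⟨by linarith [htt.1], by linarith [htt.2]⟩
  -- test with V
  have test : ∀ V, IsSpline D M (N+1) V → (∀ x ∈ cell D M m0, V x = 0) →
      ∑ m, ∑ p ∈ Finset.univ.filter (fun p => ci p = m), u (y p) * V (y p) = 0 := by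
    intro V hV hV0
    rw [Finset.sum_fiberwise, huv V hV]
    refine Finset.sum_eq_zero fun p _ => ?_
    by_cases hp : ci p = m0
    · rw [hV0 _ (hp ▸ h.mem p), mul_zero]
    · rw [hg p hp, zero_mul]
  have main : ∀ V, IsSpline D M (N+1) V → (∀ x ∈ cell D M m0, V x = 0) → ∀ P : (Fin D → Fin M) → Prop, ∀ [DecidablePred P],
      (∀ m, P m → ¬ (k ≤ (m i:ℕ) ∧ (m i:ℕ) < k + N)) →
      (∀ m, P m → ∀ x ∈ cell D M m, V x = u x) →
      (∀ m, ¬ P m → ¬ (k ≤ (m i:ℕ) ∧ (m i:ℕ) < k + N) → ∀ x ∈ cell D M m, V x = 0) →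
      (∀ m, k ≤ (m i:ℕ) → (m i:ℕ) < k + N → ∀ x ∈ cell D M m, ∀ B1 B2 : ℝ, (∀ x' ∈ cell D M m, |u x'| ≤ B1) →
      (∀ x' ∈ cell D M (update m i ⟨k+N, hk⟩), |u x'| ≤ B2) → |V x| ≤ C0 * (B1 + B2)) →
      ∑ m ∈ Finset.univ.filter (fun m : Fin D → Fin M => P m), en y ci u m ≤
      A * ∑ m ∈ Finset.univ.filter (fun m : Fin D → Fin M => k ≤ (m i:ℕ) ∧ (m i:ℕ) < k + N + 1), en y ci u m := by
    intro V hV hV0 P _ hP1 hP2 hP3 hP4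
    refine le_trans ?_ (ht M ι H y ci h u hu V i k hk hP4)
    have h1 := test V hV hV0
    have h2 : ∀ m, ∑ p ∈ Finset.univ.filter (fun p => ci p = m), u (y p) * V (y p) ≥
        (if P m then en y ci u m else 0) - (if (k ≤ (m i:ℕ) ∧ (m i:ℕ) < k + N) then
          ∑ p ∈ Finset.univ.filter (fun p => ci p = m), |u (y p) * V (y p)| else 0) := by
      intro m
      have hmem : ∀ p ∈ Finset.univ.filter (fun p => ci p = m), y p ∈ cell D M m := fun p hp => by
        have : ci p = m := by simpa using hp
        exact this ▸ h.mem p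
      by_cases hPm : P m
      · rw [if_pos hPm, if_neg (hP1 m hPm), sub_zero, en]
        refine le_of_eq (Finset.sum_congr rfl fun p hp => ?_)
        rw [hP2 m hPm _ (hmem p hp)]; ring
      · rw [if_neg hPm]
        split_ifs with hT
        · rw [zero_sub, ge_iff_le, neg_le, ← Finset.sum_neg_distrib]
          exact Finset.sum_le_sum fun p _ => neg_le_abs _
        · rw [sub_zero]
          refine le_of_eq (Eq.symm (Finset.sum_eq_zero fun p hp => ?_))
          rw [hP3 m hPm hT _ (hmem p hp), mul_zero]
    have h3 := Finset.sum_le_sum fun m (_ : m ∈ Finset.univ) => h2 m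
    rw [h1, Finset.sum_sub_distrib, ← Finset.sum_filter, ← Finset.sum_filter] at h3
    linarith
  constructor
  · intro hm0
    refine main R hR (R0 m0 hm0) (fun m => k + N ≤ (m i:ℕ)) (fun m h1 => by omega) R1 (fun m h1 h2 => R0 m (by omega)) ?_
    intro m h1 h2 x hx B1 B2 hB1 hB2
    have := R2 m h1 h2 x hx B2 hB2
    have h3 := (abs_nonneg _).trans (hB1 x hx)
    nlinarith
  · intro hm0
    refine main (fun x => u x - R x) (sp_sub hu hR) (fun x hx => by rw [R1 m0 hm0 x hx, sub_self])
      (fun m => (m i:ℕ) < k) (fun m h1 => by omega) (fun m h1 x hx => by rw [R0 m h1 x hx, sub_zero])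
      (fun m h1 h2 x hx => by rw [R1 m (by omega) x hx, sub_self]) ?_
    intro m h1 h2 x hx B1 B2 hB1 hB2
    have := R2 m h1 h2 x hx B2 hB2
    have h3 := hB1 x hx
    have h4 := (abs_nonneg _).trans h3
    have h5 := abs_sub (u x) (R x)
    nlinarith

end LPC

namespace LPC
open Set Function

def df (a b : ℕ) : ℕ := (a - b) + (b - a)

theorem decay (D N : ℕ) (hD : 0 < D) (hN : 1 ≤ N) (c C : ℝ) (hc : 0 < c) (hC : 1 ≤ C) :
    ∃ ϑ C' : ℝ, ϑ ∈ Ioo (0:ℝ) 1 ∧ 0 < C' ∧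
    ∀ (M : ℕ) (ι : Type) [Fintype ι] (H : ℝ) (y : ι → Fin D → ℝ) (ci : ι → Fin D → Fin M),
    Disc D N M c C H y ci → ∀ u, IsSpline D M (N+1) u → ∀ (g : ι → ℝ) (m0 : Fin D → Fin M) (γ : ℝ), 0 ≤ γ →
    (∀ k, ci k ≠ m0 → g k = 0) → (∀ k, |g k| ≤ γ) →
    (∀ v, IsSpline D M (N+1) v → ∑ k, u (y k) * v (y k) = ∑ k, g k * v (y k)) →
    ∀ m, ∀ x ∈ cell D M m, |u x| ≤ C' * ((∏ i, ϑ ^ df (m i) (m0 i)) * γ) := by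
  obtain ⟨A, hA, hst⟩ := decay_step D N hN c C hc hC
  set θ : ℝ := A/(1+A) with hθ
  have hθ0 : 0 < θ := by positivity
  have hθ1 : θ < 1 := by rw [hθ, div_lt_one (by positivity)]; linarith
  set n := N + 1 with hn
  set ϑ : ℝ := θ ^ ((1:ℝ)/((2*D*n : ℕ):ℝ)) with hϑ
  have hϑ0 : 0 < ϑ := Real.rpow_pos_of_pos hθ0 _
  have h2Dn : 0 < 2*D*n := by positivity
  have hϑ1 : ϑ < 1 := Real.rpow_lt_one hθ0.le hθ1 (by positivity)
  have hϑθ : ϑ ^ (2*D*n) = θ := by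
    rw [hϑ, one_div]; exact Real.rpow_inv_natCast_pow hθ0.le h2Dn.ne'
  refine ⟨ϑ, Real.sqrt (C/(θ*c)), ⟨hϑ0, hϑ1⟩, Real.sqrt_pos.2 (by positivity), ?_⟩
  intro M ι _ H y ci h u hu g m0 γ hγ hg hgγ huv m x hx
  have hH := h.hH
  set e := en y ci u with he
  have e0 : ∀ m, 0 ≤ e m := en_nonneg y ci u
  set E := ∑ m, e m with hE
  have hEe : E = ∑ k, (u (y k))^2 := by rw [hE, he]; exact Finset.sum_fiberwise _ _ _
  have hEγ : E ≤ C * H * γ^2 := by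
    have h1 := huv u hu
    have h2 : ∑ k, (u (y k))^2 ≤ ∑ k, (g k)^2 := by
      have h3 : ∑ k, g k * u (y k) ≤ ∑ k, ((g k)^2/2 + (u (y k))^2/2) :=
        Finset.sum_le_sum fun k _ => by nlinarith [sq_nonneg (g k - u (y k))]
      rw [Finset.sum_add_distrib, ← Finset.sum_div, ← Finset.sum_div] at h3
      have h4 : ∑ k, u (y k) * u (y k) = ∑ k, (u (y k))^2 := Finset.sum_congr rfl fun k _ => by ring
      linarith
    have h5 : ∑ k, (g k)^2 ≤ ∑ k ∈ Finset.univ.filter (fun k => ci k = m0), γ^2 := by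
      rw [Finset.sum_filter]
      refine Finset.sum_le_sum fun k _ => ?_
      split_ifs with hk
      · rw [← sq_abs]; exact pow_le_pow_left₀ (abs_nonneg _) (hgγ k) 2
      · rw [hg k hk]; simp
    rw [Finset.sum_const, nsmul_eq_mul] at h5
    have := mul_le_mul_of_nonneg_right (h.count m0) (sq_nonneg γ)
    rw [hEe]; linarith
  have sub_le : ∀ (S S' : Finset (Fin D → Fin M)), S ⊆ S' → ∑ m ∈ S, e m ≤ ∑ m ∈ S', e m := fun S S' hs =>
    Finset.sum_le_sum_of_subset_of_nonneg hs fun _ _ _ => e0 _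
  have dir : ∀ i, θ * e m ≤ ϑ ^ (2*D*df (m i) (m0 i)) * E := by
    intro i
    set GR : ℕ → ℝ := fun r => ∑ m ∈ Finset.univ.filter (fun m : Fin D → Fin M => r ≤ (m i:ℕ)), e m with hGR
    set Gl : ℕ → ℝ := fun r => ∑ m ∈ Finset.univ.filter (fun m : Fin D → Fin M => (m i:ℕ) < r), e m with hGl
    have split : ∀ k, Gl (k+n) = Gl k + ∑ m ∈ Finset.univ.filter (fun m : Fin D → Fin M => k ≤ (m i:ℕ) ∧ (m i:ℕ) < k + n), e m := by
      intro k
      simp only [hGl]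
      rw [← Finset.sum_union]
      · congr 1; ext m; simp only [Finset.mem_filter, Finset.mem_union, Finset.mem_univ, true_and]; omega
      · rw [Finset.disjoint_filter]; intro m _; omega
    have splitR : ∀ k, GR k = GR (k+n) + ∑ m ∈ Finset.univ.filter (fun m : Fin D → Fin M => k ≤ (m i:ℕ) ∧ (m i:ℕ) < k + n), e m := by
      intro k
      simp only [hGR]
      rw [← Finset.sum_union]
      · congr 1; ext m; simp only [Finset.mem_filter, Finset.mem_union, Finset.mem_univ, true_and]; omega
      · rw [Finset.disjoint_filter]; intro m _; omega
    have ar : ∀ a b c : ℝ, c = a + b → a ≤ A * b → a ≤ θ * c := by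
      intro a b c h1 h2
      rw [hθ, div_mul_eq_mul_div, le_div_iff₀ (by positivity), h1]; nlinarith
    have stR : ∀ k, (m0 i:ℕ) < k → GR (k+n) ≤ θ * GR k := by
      intro k hk
      by_cases hkM : k + N < M
      · refine ar _ _ _ (splitR k) (le_trans ?_ ((hst M ι H y ci h u hu g m0 hg huv i k hkM).1 hk))
        refine sub_le _ _ ?_
        intro m; simp only [Finset.mem_filter, Finset.mem_univ, true_and]; omega
      · have : GR (k+n) = 0 := by
          simp only [hGR]
          rw [Finset.filter_false_of_mem, Finset.sum_empty]
          intro m _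
          have := (m i).2
          omega
        rw [this]
        exact mul_nonneg hθ0.le (Finset.sum_nonneg fun _ _ => e0 _)
    have stL : ∀ k, k + n ≤ (m0 i:ℕ) + 1 → Gl k ≤ θ * Gl (k+n) := by
      intro k hk
      have hkM : k + N < M := by have := (m0 i).2; omega
      exact ar _ _ _ (split k) ((hst M ι H y ci h u hu g m0 hg huv i k hkM).2 (by omega))
    have itR : ∀ q, GR ((m0 i:ℕ)+1+q*n) ≤ θ^q * E := by
      intro q
      induction q with
      | zero => simp only [pow_zero, one_mul]; exact sub_le _ _ (Finset.subset_univ _)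
      | succ q ih =>
        have := stR ((m0 i:ℕ)+1+q*n) (by omega)
        have e1 : (m0 i:ℕ)+1+(q+1)*n = (m0 i:ℕ)+1+q*n+n := by ring
        rw [e1, pow_succ', mul_assoc]
        exact this.trans (by gcongr)
    have itL : ∀ q r, r + q*n = (m0 i:ℕ)+1 → Gl r ≤ θ^q * E := by
      intro q
      induction q with
      | zero => intro r _; simp only [pow_zero, one_mul]; exact sub_le _ _ (Finset.subset_univ _)
      | succ q ih =>
        intro r hr
        have e1 : (q+1)*n = q*n+n := by ring
        have := stL r (by rw [e1] at hr; omega)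
        have h2 := ih (r+n) (by rw [e1] at hr; omega)
        rw [pow_succ', mul_assoc]
        exact this.trans (by gcongr)
    have fin : ∀ q, df (m i) (m0 i) ≤ n*(q+1) → e m ≤ θ^q * E → θ * e m ≤ ϑ ^ (2*D*df (m i) (m0 i)) * E := by
      intro q hq h1
      have E0 : 0 ≤ E := Finset.sum_nonneg fun _ _ => e0 _
      calc θ * e m ≤ θ * (θ^q * E) := by gcongr
        _ = θ^(q+1) * E := by ring
        _ = ϑ^(2*D*(n*(q+1))) * E := by rw [← hϑθ, ← pow_mul]; ring_nf
        _ ≤ _ := by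
          refine mul_le_mul_of_nonneg_right (pow_le_pow_of_le_one hϑ0.le hϑ1.le ?_) E0
          exact Nat.mul_le_mul_left _ hq
    have sing : ∀ S : Finset (Fin D → Fin M), m ∈ S → e m ≤ ∑ m ∈ S, e m := fun S hS =>
      Finset.single_le_sum (f := e) (fun m _ => e0 m) hS
    have hnp : 0 < n := by omega
    rcases lt_or_ge (m0 i:ℕ) (m i:ℕ) with hlt | hge
    · set r := (m i:ℕ) - (m0 i:ℕ) - 1 with hr
      have h1 := Nat.div_add_mod r n
      have h2 := Nat.mod_lt r hnp
      refine fin (r/n) ?_ ((sing _ ?_).trans (itR (r/n)))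
      · rw [mul_add, mul_one]; unfold df; omega
      · simp only [Finset.mem_filter, Finset.mem_univ, true_and]; rw [mul_comm (r/n)]; omega
    · set r := (m0 i:ℕ) - (m i:ℕ) with hr
      have h1 := Nat.div_add_mod r n
      have h2 := Nat.mod_lt r hnp
      refine fin (r/n) ?_ ((sing _ ?_).trans (itL (r/n) ((m0 i:ℕ)+1 - r/n*n) ?_))
      · rw [mul_add, mul_one]; unfold df; omega
      · simp only [Finset.mem_filter, Finset.mem_univ, true_and]; rw [mul_comm (r/n)]; omega
      · rw [mul_comm (r/n)]; omega
  have E0 : 0 ≤ E := Finset.sum_nonneg fun _ _ => e0 _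
  set Q := ∏ i, ϑ ^ df (m i) (m0 i) with hQ
  have Q0 : 0 ≤ Q := Finset.prod_nonneg fun _ _ => by positivity
  have all : θ * e m ≤ Q^2 * E := by
    have h1 : (θ * e m)^D ≤ (Q^2 * E)^D := by
      calc (θ * e m)^D = ∏ i : Fin D, (θ * e m) := by simp
        _ ≤ ∏ i, (ϑ ^ (2*D*df (m i) (m0 i)) * E) :=
          Finset.prod_le_prod (fun _ _ => mul_nonneg hθ0.le (e0 _)) fun i _ => dir i
        _ = _ := by
          rw [Finset.prod_mul_distrib, mul_pow, Finset.prod_const, Finset.card_univ, Fintype.card_fin, hQ, ← pow_mul, ← Finset.prod_pow]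
          congr 1
          refine Finset.prod_congr rfl fun i _ => ?_
          rw [← pow_mul]; ring_nf
    exact (pow_le_pow_iff_left₀ (mul_nonneg hθ0.le (e0 _)) (by positivity) hD.ne').1 h1
  have hn1 := h.norm u hu m x hx
  have : (u x)^2 ≤ C/(θ*c) * (Q*γ)^2 := by
    have h1 : θ * (c * H * (u x)^2) ≤ Q^2 * (C * H * γ^2) :=
      (mul_le_mul_of_nonneg_left hn1 hθ0.le).trans (all.trans (by gcongr))
    rw [div_mul_eq_mul_div, le_div_iff₀ (by positivity)]
    refine le_of_mul_le_mul_right ?_ hH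
    nlinarith
  have h2 := Real.abs_le_sqrt this
  rwa [Real.sqrt_mul (by positivity), Real.sqrt_sq (by positivity)] at h2

theorem disc_exists {D N M : ℕ} {ι : Type} [Fintype ι] (y : ι → Fin D → ℝ) (g : ι → ℝ) :
    ∃ u, IsSpline D M (N+1) u ∧ ∀ v, IsSpline D M (N+1) v → ∑ k, u (y k) * v (y k) = ∑ k, g k * v (y k) := by
  let W : Submodule ℝ (EuclideanSpace ℝ ι) :=
    { carrier := {f | ∃ v, IsSpline D M (N+1) v ∧ ∀ k, f k = v (y k)}
      add_mem' := by
        rintro f f' ⟨v, hv, e⟩ ⟨v', hv', e'⟩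
        exact ⟨_, sp_add hv hv', fun k => by simp [e, e']⟩
      zero_mem' := ⟨_, sp_const 0, fun k => rfl⟩
      smul_mem' := by
        rintro a f ⟨v, hv, e⟩
        exact ⟨_, sp_smul hv a, fun k => by simp [e]⟩ }
  set G : EuclideanSpace ℝ ι := WithLp.toLp 2 g with hG
  obtain ⟨u, hu, e⟩ := (W.starProjection_apply_mem G : W.starProjection G ∈ W)
  refine ⟨u, hu, fun v hv => ?_⟩
  have h := W.starProjection_inner_eq_zero G (WithLp.toLp 2 fun k => v (y k)) ⟨v, hv, fun k => rfl⟩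
  simp only [PiLp.inner_apply, RCLike.inner_apply, conj_trivial, PiLp.sub_apply] at h
  have h2 : ∑ k, g k * v (y k) - ∑ k, u (y k) * v (y k) = 0 := by
    rw [← Finset.sum_sub_distrib, ← h]
    exact Finset.sum_congr rfl fun k _ => by rw [e k]; simp only [hG]; ring
  linarith

theorem stab (D N : ℕ) (hD : 0 < D) (hN : 1 ≤ N) (c C : ℝ) (hc : 0 < c) (hC : 1 ≤ C) :
    ∃ ϑ C' : ℝ, ϑ ∈ Ioo (0:ℝ) 1 ∧ 0 < C' ∧
    ∀ (M : ℕ) (ι : Type) [Fintype ι] (H : ℝ) (y : ι → Fin D → ℝ) (ci : ι → Fin D → Fin M),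
    Disc D N M c C H y ci → ∀ u, IsSpline D M (N+1) u → ∀ (g : ι → ℝ) (γ : (Fin D → Fin M) → ℝ), (∀ m, 0 ≤ γ m) →
    (∀ k, |g k| ≤ γ (ci k)) →
    (∀ v, IsSpline D M (N+1) v → ∑ k, u (y k) * v (y k) = ∑ k, g k * v (y k)) →
    ∀ m, ∀ x ∈ cell D M m, |u x| ≤ C' * ∑ m0, (∏ i, ϑ ^ df (m i) (m0 i)) * γ m0 := by
  obtain ⟨ϑ, C', hϑ, hC', hd⟩ := decay D N hD hN c C hc hC
  refine ⟨ϑ, C', hϑ, hC', ?_⟩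
  intro M ι _ H y ci h u hu g γ hγ hg huv m x hx
  choose U hU hUv using fun m0 : Fin D → Fin M =>
    disc_exists (D := D) (N := N) (M := M) y (fun k => if ci k = m0 then g k else 0)
  have hb : ∀ m0, |U m0 x| ≤ C' * ((∏ i, ϑ ^ df (m i) (m0 i)) * γ m0) := fun m0 =>
    hd M ι H y ci h (U m0) (hU m0) _ m0 (γ m0) (hγ m0) (fun k hk => by simp [hk]) (fun k => by
      by_cases hk : ci k = m0
      · rw [if_pos hk, ← hk]; exact hg k
      · rw [if_neg hk, abs_zero]; exact hγ m0) (hUv m0) m x hx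
  have hS : IsSpline D M (N+1) (fun x => ∑ m0, U m0 x) := sp_sum _ fun m0 _ => hU m0
  have hd' := sp_sub hu hS
  have hz : ∑ k, (u (y k) - ∑ m0, U m0 (y k)) * (u (y k) - ∑ m0, U m0 (y k)) = 0 := by
    have h1 := huv _ hd'
    have h2 : ∀ v, IsSpline D M (N+1) v → ∑ k, (∑ m0, U m0 (y k)) * v (y k) = ∑ k, g k * v (y k) := by
      intro v hv
      simp only [Finset.sum_mul]
      rw [Finset.sum_comm, Finset.sum_congr rfl fun m0 _ => hUv m0 v hv, Finset.sum_comm]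
      refine Finset.sum_congr rfl fun k _ => ?_
      simp
    have h3 := h2 _ hd'
    rw [← sub_eq_zero, ] at h1
    rw [Finset.sum_congr rfl fun k _ => sub_mul _ _ _, Finset.sum_sub_distrib, h3]
    exact h1
  have hzx : u x - ∑ m0, U m0 x = 0 := by
    have h1 := h.norm _ hd' m x hx
    have h2 : ∑ k ∈ Finset.univ.filter (fun k => ci k = m), (u (y k) - ∑ m0, U m0 (y k))^2 ≤
        ∑ k, (u (y k) - ∑ m0, U m0 (y k))^2 :=
      Finset.sum_le_sum_of_subset_of_nonneg (Finset.subset_univ _) fun _ _ _ => sq_nonneg _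
    simp only [← sq] at hz
    rw [hz] at h2
    have hp : 0 < c * H := mul_pos hc h.hH
    have h3 : (u x - ∑ m0, U m0 x)^2 ≤ 0 := by
      by_contra hh
      push Not at hh
      nlinarith [mul_pos hp hh]
    exact pow_eq_zero_iff (two_ne_zero) |>.1 (le_antisymm h3 (sq_nonneg _))
  have : u x = ∑ m0, U m0 x := by linarith
  rw [this, Finset.mul_sum]
  exact (Finset.abs_sum_le_sum_abs _ _).trans (Finset.sum_le_sum fun m0 _ => hb m0)

/-- bounded row sums of the decay kernel -/
theorem kernel_sum (D M : ℕ) (ϑ : ℝ) (hϑ : ϑ ∈ Ioo (0:ℝ) 1) (m : Fin D → Fin M) :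
    ∑ m0 : Fin D → Fin M, (∏ i, ϑ ^ df (m i) (m0 i)) ≤ (2/(1-ϑ))^D := by
  rw [← Fintype.piFinset_univ, ← Finset.prod_univ_sum (fun _ => Finset.univ) (fun i (j : Fin M) => ϑ ^ df (m i) j)]
  have : ∀ a : ℕ, ∑ j : Fin M, ϑ ^ df a j ≤ 2/(1-ϑ) := by
    intro a
    have hg : ∀ K : ℕ, ∑ r ∈ Finset.range K, ϑ^r ≤ 1/(1-ϑ) := fun K => by
      rw [one_div, ← tsum_geometric_of_lt_one hϑ.1.le hϑ.2]
      exact (summable_geometric_of_lt_one hϑ.1.le hϑ.2).sum_le_tsum _ fun _ _ => pow_nonneg hϑ.1.le _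
    rw [Fin.sum_univ_eq_sum_range (fun j => ϑ ^ df a j) M]
    have h1 : ∀ j, ϑ ^ df a j ≤ (if j < a + 1 then ϑ^(a+1-1-j) else 0) + (if a ≤ j then ϑ^(j-a) else 0) := by
      intro j
      have p1 : 0 ≤ ϑ^(a+1-1-j) := pow_nonneg hϑ.1.le _
      have p2 : 0 ≤ ϑ^(j-a) := pow_nonneg hϑ.1.le _
      rcases le_or_gt a j with h | h
      · have : df a j = j - a := by unfold df; omega
        rw [this, if_pos h]
        split_ifs <;> linarith
      · have : df a j = a+1-1-j := by unfold df; omega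
        rw [this, if_pos (by omega), if_neg (by omega)]; linarith
    have h2 : ∑ j ∈ Finset.range M, ϑ ^ df a j ≤ ∑ j ∈ Finset.range (M+a+1), ϑ ^ df a j :=
      Finset.sum_le_sum_of_subset_of_nonneg (Finset.range_subset_range.2 (by omega)) fun _ _ _ => pow_nonneg hϑ.1.le _
    refine h2.trans ((Finset.sum_le_sum fun j _ => h1 j).trans ?_)
    rw [Finset.sum_add_distrib]
    have h3 : ∑ j ∈ Finset.range (M+a+1), (if j < a + 1 then ϑ^(a+1-1-j) else 0) ≤ 1/(1-ϑ) := by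
      rw [← Finset.sum_filter]
      have : (Finset.range (M+a+1)).filter (fun j => j < a + 1) = Finset.range (a+1) := by
        ext j; simp; omega
      rw [this, Finset.sum_range_reflect (fun r => ϑ^r)]
      exact hg _
    have h4 : ∑ j ∈ Finset.range (M+a+1), (if a ≤ j then ϑ^(j-a) else 0) ≤ 1/(1-ϑ) := by
      have : M+a+1 = a + (M+1) := by ring
      rw [this, Finset.sum_range_add, Finset.sum_eq_zero, zero_add]
      · simpa using hg (M+1)
      · intro j hj
        rw [Finset.mem_range] at hj
        rw [if_neg (by omega)]
    calc _ ≤ 1/(1-ϑ) + 1/(1-ϑ) := add_le_add h3 h4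
      _ = _ := by ring
  calc _ ≤ ∏ i : Fin D, (2/(1-ϑ)) := Finset.prod_le_prod (fun _ _ => Finset.sum_nonneg fun _ _ => pow_nonneg hϑ.1.le _) fun i _ => this _
    _ = _ := by rw [Finset.prod_const, Finset.card_univ, Fintype.card_fin]

theorem df_comm (a b : ℕ) : df a b = df b a := by unfold df; omega

end LPC

namespace LPC
open Set Function Filter Topology

theorem iterDeriv_cont {k n : ℕ} (hk : k ≤ n) {φ : ℝ → ℝ} {t : ℝ} (h : ContDiffAt ℝ n φ t) :
    ContinuousAt (iteratedDeriv k φ) t := by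
  have h1 : ContDiffAt ℝ (0:ℕ) (iteratedFDeriv ℝ k φ) t := h.iteratedFDeriv_right (by exact_mod_cast (by omega : 0 + k ≤ n))
  have h2 := h1.continuousAt
  exact (ContinuousMultilinearMap.apply ℝ (fun _ : Fin k => ℝ) ℝ (fun _ => 1)).continuous.continuousAt.comp h2

theorem piecewise_bound (n s : ℕ) (hn : 1 ≤ n) (hs : s ≤ n) (φ : ℝ → ℝ)
    (hφ : ∀ t ∈ Icc (0:ℝ) 1, ContDiffAt ℝ (n-1:ℕ) φ t) (ψ : ℝ → ℝ → ℝ)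
    (hψ : ∀ t ∈ Ico (0:ℝ) 1, ContDiff ℝ (n:ℕ) (ψ t))
    (heq : ∀ t ∈ Ico (0:ℝ) 1, ∀ᶠ τ in 𝓝[>] t, φ τ = ψ t τ)
    (h0 : ∀ k, iteratedDeriv k φ 0 = 0) (B : ℝ)
    (hB : ∀ t ∈ Ico (0:ℝ) 1, |iteratedDeriv s (ψ t) t| ≤ B) : ∀ t ∈ Icc (0:ℝ) 1, |φ t| ≤ B := by
  have hB0 : 0 ≤ B := (abs_nonneg _).trans (hB 0 (by simp))
  have ev : ∀ k ≤ n-1, ∀ t ∈ Ico (0:ℝ) 1, iteratedDeriv k φ =ᶠ[𝓝[≥] t] iteratedDeriv k (ψ t) := by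
    intro k hk t ht
    obtain ⟨b, hb, hsub⟩ := mem_nhdsGT_iff_exists_Ioo_subset.1 (heq t ht)
    have hb : t < b := hb
    have h1 : ∀ τ ∈ Ioo t b, iteratedDeriv k φ τ = iteratedDeriv k (ψ t) τ := fun τ hτ => by
      have : φ =ᶠ[𝓝 τ] ψ t := by
        filter_upwards [isOpen_Ioo.mem_nhds hτ] with τ' h'
        exact hsub h'
      exact this.iteratedDeriv_eq k
    have h2 : iteratedDeriv k φ t = iteratedDeriv k (ψ t) t := by
      have c1 := (iterDeriv_cont hk (hφ t ⟨ht.1, ht.2.le⟩)).tendsto.mono_left (nhdsWithin_le_nhds (s := Ioi t))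
      have c2 := (iterDeriv_cont (hk.trans (Nat.sub_le _ _)) (hψ t ht).contDiffAt (t := t)).tendsto.mono_left (nhdsWithin_le_nhds (s := Ioi t))
      refine tendsto_nhds_unique c1 (c2.congr' ?_)
      filter_upwards [Ioo_mem_nhdsGT hb] with τ hτ
      exact (h1 τ hτ).symm
    filter_upwards [Ico_mem_nhdsGE hb] with τ hτ
    rcases eq_or_lt_of_le hτ.1 with h | h
    · rw [← h]; exact h2
    · exact h1 τ ⟨h, hτ.2⟩
  have rd : ∀ k ≤ n-1, ∀ t ∈ Ico (0:ℝ) 1,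
      HasDerivWithinAt (iteratedDeriv k φ) (iteratedDeriv (k+1) (ψ t) t) (Ici t) t := by
    intro k hk t ht
    have h1 : HasDerivAt (iteratedDeriv k (ψ t)) (iteratedDeriv (k+1) (ψ t) t) t := by
      rw [iteratedDeriv_succ]
      refine DifferentiableAt.hasDerivAt ?_
      exact ((hψ t ht).differentiable_iteratedDeriv k (by exact_mod_cast (by omega : k < n))) t
    exact h1.hasDerivWithinAt.congr_of_eventuallyEq_of_mem (ev k hk t ht) self_mem_Ici
  have down : ∀ r, r ≤ s → ∀ t ∈ Ico (0:ℝ) 1, |iteratedDeriv (s-r) (ψ t) t| ≤ B := by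
    intro r
    induction r with
    | zero => intro _; simpa using hB
    | succ r ih =>
      intro hr t ht
      have ih' := ih (by omega)
      set k := s - (r+1) with hk
      have hk1 : s - r = k + 1 := by omega
      rw [hk1] at ih'
      have hkn : k ≤ n - 1 := by omega
      have h1 := norm_image_sub_le_of_norm_deriv_right_le_segment (a := 0) (b := 1) (f := iteratedDeriv k φ) (C := B)
        (fun x hx => (iterDeriv_cont hkn (hφ x hx)).continuousWithinAt) (rd k hkn) ih' t ⟨ht.1, ht.2.le⟩
      rw [h0 k, sub_zero, sub_zero] at h1
      rw [← (ev k hkn t ht).self_of_nhdsWithin self_mem_Ici]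
      refine h1.trans ?_
      nlinarith [ht.2]
  have h1 : ∀ t ∈ Ico (0:ℝ) 1, |φ t| ≤ B := fun t ht => by
    have h2 := down s le_rfl t ht
    rw [Nat.sub_self, ← (ev 0 (Nat.zero_le _) t ht).self_of_nhdsWithin self_mem_Ici] at h2
    simpa using h2
  intro t ht
  rcases eq_or_lt_of_le ht.2 with h | h
  · subst h
    have c1 := ((hφ 1 ht).continuousAt.abs).tendsto.mono_left (nhdsWithin_le_nhds (s := Iio 1))
    refine le_of_tendsto c1 ?_
    filter_upwards [Ioo_mem_nhdsLT (zero_lt_one' ℝ)] with τ hτ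
    exact h1 τ ⟨hτ.1.le, hτ.2⟩
  · exact h1 t ⟨ht.1, h⟩

theorem affine_iter {D : ℕ} (z v : Fin D → ℝ) (i : ℕ) (hi : 1 ≤ i) (t : ℝ) :
    ‖iteratedFDeriv ℝ i (fun τ : ℝ => z + τ • v) t‖ ≤ ‖v‖^i := by
  rw [norm_iteratedFDeriv_eq_norm_iteratedDeriv]
  obtain ⟨i, rfl⟩ := Nat.exists_eq_add_of_le hi
  have hd : deriv (fun τ : ℝ => z + τ • v) = fun _ => v := by
    funext τ
    have : HasDerivAt (fun τ : ℝ => z + τ • v) ((1:ℝ) • v) τ := ((hasDerivAt_id τ).smul_const v).const_add z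
    rw [this.deriv, one_smul]
  rw [add_comm, iteratedDeriv_succ', hd]
  cases i with
  | zero => simp
  | succ i => rw [iteratedDeriv_const]; simp

theorem comp_line {D : ℕ} (z v : Fin D → ℝ) (f : (Fin D → ℝ) → ℝ) (s : ℕ) (hf : ContDiff ℝ s f) (t B : ℝ)
    (hB : ∀ k ≤ s, ‖iteratedFDeriv ℝ k f (z + t • v)‖ ≤ B) :
    |iteratedDeriv s (fun τ : ℝ => f (z + τ • v)) t| ≤ s.factorial * B * ‖v‖^s := by
  rw [← Real.norm_eq_abs, ← norm_iteratedFDeriv_eq_norm_iteratedDeriv]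
  exact norm_iteratedFDeriv_comp_le (N := s) hf (by fun_prop) le_rfl t hB (fun i hi _ => affine_iter z v i hi t)

theorem extrapD (D n : ℕ) (R : ℝ) (hR : 0 ≤ R) : ∃ C : ℝ, 1 ≤ C ∧ ∀ M : ℕ, 1 ≤ M → ∀ f : (Fin D → ℝ) → ℝ, CP n f →
    ∀ (j : Fin D → Fin M) (k : ℕ) (B : ℝ), (∀ x ∈ cell D M j, ‖iteratedFDeriv ℝ k f x‖ ≤ B) →
    ∀ x : Fin D → ℝ, (∀ i, |M * x i - (j i:ℕ)| ≤ R) → ‖iteratedFDeriv ℝ k f x‖ ≤ C * B := by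
  obtain ⟨C, hC, h⟩ := extrap D n R
  refine ⟨C, hC, fun M hM f hf j k B hB x hx => ?_⟩
  have hB0 : 0 ≤ B := by
    refine (norm_nonneg _).trans (hB _ (scaled_mem hM j (y := 0) fun i => by simp))
  refine ContinuousMultilinearMap.opNorm_le_bound (by positivity) fun v => ?_
  have h1 := h _ ((hf.iter k v).affine (1/M) (fun i => ((j i:ℕ):ℝ)/M)) (B * ∏ i, ‖v i‖) (fun y hy => by
    refine (ContinuousMultilinearMap.le_opNorm (iteratedFDeriv ℝ k f _) v).trans ?_
    have := hB _ (scaled_mem hM j hy)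
    gcongr) (fun i => M * x i - (j i:ℕ)) ((pi_norm_le_iff_of_nonneg hR).2 hx)
  rw [scaled_unscaled hM j x] at h1
  rw [mul_assoc]; exact h1

theorem forward (a b t : ℝ) : ∃ c : ℤ, ∀ᶠ τ in 𝓝[>] t, (c:ℝ) ≤ a + b * τ ∧ a + b * τ < c + 1 := by
  have hc : Continuous fun τ : ℝ => a + b * τ := by fun_prop
  rcases le_or_gt 0 b with hb | hb
  · refine ⟨⌊a + b * t⌋, ?_⟩
    have h1 : ∀ᶠ τ in 𝓝[>] t, a + b * τ < ⌊a + b * t⌋ + 1 :=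
      (hc.continuousAt.eventually_lt continuousAt_const (Int.lt_floor_add_one _)).filter_mono nhdsWithin_le_nhds
    filter_upwards [h1, self_mem_nhdsWithin] with τ h2 h3
    have h3 : t < τ := h3
    refine ⟨(Int.floor_le _).trans ?_, h2⟩
    gcongr
  · refine ⟨⌈a + b * t⌉ - 1, ?_⟩
    have h0 : ((⌈a + b * t⌉ - 1 : ℤ):ℝ) < a + b * t := by
      push_cast; linarith [Int.ceil_lt_add_one (a + b * t)]
    have h1 : ∀ᶠ τ in 𝓝[>] t, ((⌈a + b * t⌉ - 1 : ℤ):ℝ) < a + b * τ :=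
      (continuousAt_const.eventually_lt hc.continuousAt h0).filter_mono nhdsWithin_le_nhds
    filter_upwards [h1, self_mem_nhdsWithin] with τ h2 h3
    have h3 : t < τ := h3
    refine ⟨h2.le, ?_⟩
    push_cast
    nlinarith [Int.le_ceil (a + b * t)]

end LPC

namespace LPC
open Set Function Filter Topology

theorem df_le {a b R : ℕ} : df a b ≤ R ↔ a ≤ b + R ∧ b ≤ a + R := by unfold df; omega

theorem near (D n s R : ℕ) (hn : 1 ≤ n) (hs : s ≤ n) : ∃ C : ℝ, 1 ≤ C ∧ ∀ M : ℕ, 1 ≤ M →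
    ∀ w, IsSpline D M (n+1) w → ∀ P : (Fin D → Fin M) → (Fin D → ℝ) → ℝ, (∀ j, CP n (P j)) →
    (∀ j, ∀ x ∈ cell D M j, w x = P j x) → ∀ lam : (Fin D → Fin M) → ℝ,
    (∀ j, ∀ x ∈ cell D M j, ∀ k ≤ s, ‖iteratedFDeriv ℝ k (P j) x‖ ≤ lam j) → ∀ (j : Fin D → Fin M) (Λ : ℝ),
    (∀ j' : Fin D → Fin M, (∀ i, df (j i) (j' i) ≤ R) → lam j' ≤ Λ) →
    ∀ j' : Fin D → Fin M, (∀ i, df (j i) (j' i) ≤ R) → ∀ y ∈ cell D M j', |w y - P j y| ≤ C * ((1/M)^s * Λ) := by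
  obtain ⟨C, hC, hext⟩ := extrapD D n (R+1) (by positivity)
  have hf1 : (1:ℝ) ≤ s.factorial := by exact_mod_cast Nat.one_le_iff_ne_zero.2 s.factorial_ne_zero
  have hR1 : (1:ℝ) ≤ (R+1:ℝ)^s := one_le_pow₀ (by linarith [Nat.cast_nonneg (α := ℝ) R])
  refine ⟨s.factorial * (1 + C) * (R+1)^s, ?_, ?_⟩
  · have : (1:ℝ) ≤ 1 + C := by linarith
    exact one_le_mul_of_one_le_of_one_le (one_le_mul_of_one_le_of_one_le hf1 this) hR1
  intro M hM w hw P hP hwP lam hlam j Λ hΛ j' hj' y hy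
  have hM' : (0:ℝ) < M := by exact_mod_cast hM
  have hjj : lam j ≤ Λ := hΛ j fun i => by simp [df]
  have hlam0 : ∀ j, 0 ≤ lam j := fun j =>
    (norm_nonneg _).trans (hlam j _ (scaled_mem hM j (y := 0) fun i => by simp) 0 (Nat.zero_le _))
  have hΛ0 : 0 ≤ Λ := (hlam0 j).trans hjj
  have hw' := sp_iff.1 hw
  have interior : ∀ y ∈ cell D M j', y ∈ unitCube D → |w y - P j y| ≤ s.factorial * (1 + C) * (R+1)^s * ((1/M)^s * Λ) := by
    intro y hy hyU
    set z0 : Fin D → ℝ := fun i => ((j i:ℕ) + 1/2)/M with hz0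
    have Mz0 : ∀ i, M * z0 i = (j i:ℕ) + 1/2 := fun i => by simp only [hz0]; field_simp
    set v := y - z0 with hv
    have hyc := (mem_cell_iff hM).1 hy
    have dR : ∀ i, ((j i:ℕ):ℝ) ≤ (j' i:ℕ) + R ∧ ((j' i:ℕ):ℝ) ≤ (j i:ℕ) + R := fun i => by
      have := df_le.1 (hj' i)
      exact ⟨by exact_mod_cast this.1, by exact_mod_cast this.2⟩
    have Mz : ∀ (t : ℝ) i, M * (z0 + t • v) i = (1-t) * ((j i:ℕ) + 1/2) + t * (M * y i) := fun t i => by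
      rw [← Mz0 i]; simp [hv]; ring
    have z0U : z0 ∈ unitCube D := fun i => by
      have h1 : ((j i:ℕ):ℝ) + 1 ≤ M := by exact_mod_cast (j i).2
      have h2 : (0:ℝ) ≤ (j i:ℕ) := by positivity
      exact ⟨by simp only [hz0]; positivity, by simp only [hz0]; rw [div_lt_one hM']; linarith⟩
    have zU : ∀ t ∈ Icc (0:ℝ) 1, z0 + t • v ∈ unitCube D := fun t ht i => by
      have h1 := z0U i
      have h2 := hyU i
      have e : (z0 + t • v) i = (1-t) * z0 i + t * y i := by simp [hv]; ring
      rw [e]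
      constructor
      · rcases eq_or_lt_of_le ht.1 with h | h
        · rw [← h]; simpa using h1.1
        · have := mul_pos h h2.1
          have := mul_nonneg (by linarith [ht.2] : 0 ≤ 1 - t) h1.1.le
          linarith
      · rcases eq_or_lt_of_le ht.1 with h | h
        · rw [← h]; simpa using h1.2
        · have := mul_lt_mul_of_pos_left h2.2 h
          have := mul_le_mul_of_nonneg_left h1.2.le (by linarith [ht.2] : 0 ≤ 1 - t)
          linarith
    have zR : ∀ t ∈ Icc (0:ℝ) 1, ∀ i, |M * (z0 + t • v) i - (j i:ℕ)| ≤ R + 1 := fun t ht i => by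
      rw [Mz]
      have h1 := hyc i
      have h2 := dR i
      have a1 : -(R+1:ℝ) ≤ M * y i - (j i:ℕ) := by linarith
      have a2 : M * y i - (j i:ℕ) ≤ R + 1 := by linarith
      have hR0 : (0:ℝ) ≤ R := by positivity
      have b1 := mul_le_mul_of_nonneg_left a1 ht.1
      have b2 := mul_le_mul_of_nonneg_left a2 ht.1
      have ht2 := ht.2
      have b3 := mul_nonneg (sub_nonneg.2 ht2) hR0
      rw [abs_le]; constructor <;> nlinarith
    have hvn : ‖v‖ ≤ (R+1) * (1/M) := by
      rw [pi_norm_le_iff_of_nonneg (by positivity)]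
      intro i
      have h1 := zR 1 (by simp) i
      have h2 : M * v i = M * (z0 + (1:ℝ) • v) i - (j i:ℕ) - 1/2 := by
        have := Mz0 i
        simp only [Pi.add_apply, Pi.smul_apply, one_smul, mul_add, this]; ring
      have h3 := hyc i
      have h4 := dR i
      rw [mul_one_div, Real.norm_eq_abs, le_div_iff₀ hM', show |v i| * (M:ℝ) = |M * v i| by rw [abs_mul, abs_of_pos hM']; ring]
      have h5 : M * v i = M * y i - ((j i:ℕ) + 1/2) := by rw [← Mz0 i, hv]; simp [mul_sub]
      rw [h5, abs_le]; constructor <;> linarith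
    -- forward cells
    have fwd : ∀ t : ℝ, ∃ J : Fin D → Fin M, t ∈ Ico (0:ℝ) 1 → (∀ i, df (j i) (J i) ≤ R) ∧
        ∀ᶠ τ in 𝓝[>] t, z0 + τ • v ∈ cell D M J := by
      intro t
      by_cases ht : t ∈ Ico (0:ℝ) 1
      swap
      · exact ⟨j, fun h => absurd h ht⟩
      choose c hc using fun i => forward ((j i:ℕ) + 1/2) (M * y i - ((j i:ℕ) + 1/2)) t
      have hall := eventually_all.2 hc
      have h1 : ∀ᶠ τ in 𝓝[>] t, τ ∈ Ioo t 1 := Ioo_mem_nhdsGT ht.2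
      obtain ⟨τ, hτ, hτ1⟩ := (hall.and h1).exists
      have hτI : τ ∈ Icc (0:ℝ) 1 := ⟨by linarith [ht.1, hτ1.1], hτ1.2.le⟩
      have hzτ := zU τ hτI
      obtain ⟨J, hJ⟩ := exists_cell hM (x := z0 + τ • v) fun i => ⟨(hzτ i).1.le, (hzτ i).2⟩
      have hJ' := (mem_cell_iff hM).1 hJ
      have hJc : ∀ i, ((J i:ℕ):ℤ) = c i := fun i => by
        have a := hJ' i
        have b := hτ i
        rw [Mz] at a
        have e1 : (1-τ) * (((j i:ℕ):ℝ) + 1/2) + τ * (M * y i) = (j i:ℕ) + 1/2 + (M * y i - ((j i:ℕ) + 1/2)) * τ := by ring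
        rw [e1] at a
        have p1 : (((J i:ℕ):ℤ):ℝ) < ((c i + 1 : ℤ):ℝ) := by push_cast; linarith
        have p2 : ((c i : ℤ):ℝ) < (((J i:ℕ):ℤ) + 1 : ℤ) := by push_cast; linarith
        have p1' := Int.cast_lt.1 p1
        have p2' := Int.cast_lt.1 p2
        omega
      refine ⟨J, fun _ => ⟨fun i => ?_, ?_⟩⟩
      · have a := hJ' i
        rw [Mz] at a
        have b := hyc i
        have d := dR i
        have hR0 : (0:ℝ) ≤ R := by positivity
        have q1 : (j i:ℝ) - R ≤ M * y i := by linarith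
        have q2 : M * y i < (j i:ℝ) + R + 1 := by linarith
        have q3 := mul_le_mul_of_nonneg_left q1 hτI.1
        have q4 := mul_le_mul_of_nonneg_left q2.le hτI.1
        have q5 := mul_nonneg (sub_nonneg.2 hτI.2) hR0
        have hτ2 := hτ1.2
        have r1 : ((J i:ℕ):ℝ) < (j i:ℕ) + R + 1 := by nlinarith
        have r2 : ((j i:ℕ):ℝ) < (J i:ℕ) + R + 1 := by nlinarith
        have r1' : (J i:ℕ) < (j i:ℕ) + R + 1 := by exact_mod_cast r1
        have r2' : (j i:ℕ) < (J i:ℕ) + R + 1 := by exact_mod_cast r2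
        rw [df_le]; omega
      · filter_upwards [hall] with τ' h'
        rw [mem_cell_iff hM]
        intro i
        rw [Mz]
        have e1 : (1-τ') * (((j i:ℕ):ℝ) + 1/2) + τ' * (M * y i) = (j i:ℕ) + 1/2 + (M * y i - ((j i:ℕ) + 1/2)) * τ' := by ring
        have e2 : ((c i:ℤ):ℝ) = (J i:ℕ) := by rw [← hJc i]; exact Int.cast_natCast _
        rw [e1, ← e2]
        exact h' i
    choose J hJ using fwd
    have hline : ∀ t : ℝ, Continuous fun τ : ℝ => z0 + τ • v := fun t => by fun_prop
    have res := piecewise_bound n s hn hs (fun t => w (z0 + t • v) - P j (z0 + t • v)) ?_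
      (fun t τ => P (J t) (z0 + τ • v) - P j (z0 + τ • v)) ?_ ?_ ?_ (s.factorial * (Λ + C * Λ) * ‖v‖^s) ?_ 1 (by simp)
    · simp only [one_smul] at res
      have e : z0 + v = y := by simp [hv]
      rw [e] at res
      refine res.trans ?_
      calc (s.factorial:ℝ) * (Λ + C * Λ) * ‖v‖^s ≤ s.factorial * (Λ + C * Λ) * ((R+1) * (1/M))^s := by gcongr
        _ = _ := by rw [mul_pow]; ring
    · intro t ht
      have a1 : ContDiffAt ℝ (n-1:ℕ) (fun t : ℝ => z0 + t • v) t := by fun_prop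
      exact ((hw'.1 _ (zU t ht)).comp t a1).sub ((hP j).contDiff.contDiffAt.comp t a1)
    · intro t _
      have a1 : ContDiff ℝ (n:ℕ) (fun t : ℝ => z0 + t • v) := by fun_prop
      exact ((hP _).contDiff.comp a1).sub ((hP j).contDiff.comp a1)
    · intro t ht
      filter_upwards [(hJ t ht).2] with τ hτ
      rw [hwP _ _ hτ]
    · intro k
      have : (fun t : ℝ => w (z0 + t • v) - P j (z0 + t • v)) =ᶠ[𝓝 0] fun _ => 0 := by
        have h1 : ∀ i, ∀ᶠ t : ℝ in 𝓝 0, ((j i:ℕ):ℝ) < M * (z0 + t • v) i ∧ M * (z0 + t • v) i < (j i:ℕ) + 1 := fun i => by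
          have hc : Continuous fun t : ℝ => M * (z0 + t • v) i := by
            simp only [Pi.add_apply, Pi.smul_apply]; fun_prop
          refine (continuousAt_const.eventually_lt hc.continuousAt ?_).and (hc.continuousAt.eventually_lt continuousAt_const ?_)
          · rw [Mz]; norm_num
          · rw [Mz]; norm_num
        filter_upwards [eventually_all.2 h1] with t ht
        rw [hwP j _ ((mem_cell_iff hM).2 fun i => ⟨(ht i).1.le, (ht i).2⟩), sub_self]
      rw [this.iteratedDeriv_eq k, iteratedDeriv_const]; simp
    · intro t ht
      obtain ⟨hJ1, hJ2⟩ := hJ t ht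
      refine comp_line z0 v (fun x => P (J t) x - P j x) s ((hP _).contDiff.sub (hP _).contDiff) t _ fun k hk => ?_
      have e : iteratedFDeriv ℝ k (fun x => P (J t) x - P j x) (z0 + t • v) =
          iteratedFDeriv ℝ k (P (J t)) (z0 + t • v) - iteratedFDeriv ℝ k (P j) (z0 + t • v) :=
        iteratedFDeriv_sub_apply (hP _).contDiff.contDiffAt (hP _).contDiff.contDiffAt
      rw [e]
      refine (norm_sub_le _ _).trans (add_le_add ?_ ?_)
      · have hc : Continuous fun τ : ℝ => ‖iteratedFDeriv ℝ k (P (J t)) (z0 + τ • v)‖ :=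
          (((hP (J t)).contDiff (m := k)).continuous_iteratedFDeriv le_rfl |>.comp (hline 0)).norm
        refine le_of_tendsto (hc.continuousAt (x := t) |>.tendsto.mono_left (nhdsWithin_le_nhds (s := Ioi t))) ?_
        filter_upwards [hJ2] with τ hτ
        exact (hlam _ _ hτ k hk).trans (hΛ _ hJ1)
      · refine (hext M hM (P j) (hP j) j k (lam j) (fun x hx => hlam j x hx k hk) _ (zR t ⟨ht.1, ht.2.le⟩)).trans ?_
        gcongr
  -- general point of the half open cell
  have hyc := (mem_cell_iff hM).1 hy
  have hcont : Continuous fun ε : ℝ => |P j' (y + ε • fun _ => 1) - P j (y + ε • fun _ => 1)| := by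
    have h1 := ((hP j').contDiff (m := 0)).continuous
    have h2 := ((hP j).contDiff (m := 0)).continuous
    fun_prop
  rw [hwP j' y hy]
  have lim := (hcont.continuousAt (x := 0)).tendsto.mono_left (nhdsWithin_le_nhds (s := Ioi 0))
  simp only [zero_smul, add_zero] at lim
  refine le_of_tendsto lim ?_
  have h1 : ∀ i, ∀ᶠ ε : ℝ in 𝓝[>] 0, M * (y i + ε) < (j' i:ℕ) + 1 := fun i => by
    have hc : Continuous fun ε : ℝ => M * (y i + ε) := by fun_prop
    refine (hc.continuousAt.eventually_lt continuousAt_const ?_).filter_mono nhdsWithin_le_nhds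
    rw [add_zero]; exact (hyc i).2
  filter_upwards [eventually_all.2 h1, self_mem_nhdsWithin] with ε hε hε0
  have hε0 : 0 < ε := hε0
  have hmem : y + ε • (fun _ => (1:ℝ)) ∈ cell D M j' := by
    rw [mem_cell_iff hM]
    intro i
    have h2 := hε i
    have h3 := (hyc i).1
    simp only [Pi.add_apply, Pi.smul_apply, smul_eq_mul, mul_one]
    exact ⟨by nlinarith, h2⟩
  rw [← hwP j' _ hmem]
  refine interior _ hmem fun i => ?_
  have h2 := cell_sub hM hmem i
  have h3 := cell_sub hM hy i
  refine ⟨?_, h2.2⟩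
  simp only [Pi.add_apply, Pi.smul_apply, smul_eq_mul, mul_one]
  linarith [h3.1]

end LPC

namespace LPC
open Set Function Filter Topology

theorem taylorPoly (s : ℕ) (f : ℝ → ℝ) (hf : ContDiff ℝ s f) (a b B : ℝ) (hab : a < b)
    (hB : ∀ τ ∈ Icc a b, |iteratedDeriv s f τ| ≤ B) : ∃ q : Polynomial ℝ, q.natDegree ≤ s - 1 ∧
    ∀ τ ∈ Icc a b, |f τ - q.eval τ| ≤ B * (b-a)^s := by
  have hB0 : 0 ≤ B := (abs_nonneg _).trans (hB a ⟨le_rfl, hab.le⟩)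
  rcases s with _ | r
  · exact ⟨0, by simp, fun τ hτ => by simpa using hB τ hτ⟩
  refine ⟨∑ k ∈ Finset.range (r+1), Polynomial.C ((k.factorial:ℝ)⁻¹ * iteratedDerivWithin k f (Icc a b) a) *
    (Polynomial.X - Polynomial.C a)^k, ?_, fun τ hτ => ?_⟩
  · refine Polynomial.natDegree_sum_le_of_forall_le _ _ fun k hk => ?_
    have hk := Finset.mem_range.1 hk
    refine (Polynomial.natDegree_C_mul_le _ _).trans (Polynomial.natDegree_pow_le.trans ?_)
    rw [Polynomial.natDegree_X_sub_C]; omega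
  · have h1 := taylor_mean_remainder_bound (f := f) (n := r) (C := B) hab.le (by exact_mod_cast hf.contDiffOn) hτ
      (fun y hy => by
        rw [iteratedDerivWithin_eq_iteratedDeriv (uniqueDiffOn_Icc hab) (by exact_mod_cast hf.contDiffAt) hy, Real.norm_eq_abs]
        exact hB y hy)
    rw [taylor_within_apply, Real.norm_eq_abs] at h1
    have e : Polynomial.eval τ (∑ k ∈ Finset.range (r+1), Polynomial.C ((k.factorial:ℝ)⁻¹ * iteratedDerivWithin k f (Icc a b) a) *
        (Polynomial.X - Polynomial.C a)^k) =
        ∑ k ∈ Finset.range (r + 1), ((k.factorial : ℝ)⁻¹ * (τ - a) ^ k) • iteratedDerivWithin k f (Icc a b) a := by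
      rw [Polynomial.eval_finsetSum]
      refine Finset.sum_congr rfl fun k _ => ?_
      simp; ring
    rw [e]
    refine h1.trans ((div_le_self (mul_nonneg hB0 (pow_nonneg (sub_nonneg.2 hτ.1) _)) ?_).trans ?_)
    · exact_mod_cast Nat.one_le_iff_ne_zero.2 r.factorial_ne_zero
    · have := hτ.1
      have := hτ.2
      gcongr

theorem locapp (D N s : ℕ) (L : ℝ) (hL : 1 ≤ L) (hs : s ≤ N+1) : ∃ (R : ℕ) (C : ℝ), 1 ≤ C ∧
    ∀ Φ Ψ, GoodMap D (N+1) L Φ Ψ → ∀ M : ℕ, 1 ≤ M →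
    ∀ w, IsSpline D M (N+1+1) w → ∀ P : (Fin D → Fin M) → (Fin D → ℝ) → ℝ, (∀ j, CP (N+1) (P j)) →
    (∀ j, ∀ x ∈ cell D M j, w x = P j x) → ∀ lam : (Fin D → Fin M) → ℝ,
    (∀ j, ∀ x ∈ cell D M j, ∀ k ≤ s, ‖iteratedFDeriv ℝ k (P j) x‖ ≤ lam j) → ∀ (m j : Fin D → Fin M),
    Φ (fun i => ((m i:ℕ):ℝ)/M) ∈ cell D M j → ∀ Λ : ℝ,
    (∀ j' : Fin D → Fin M, (∀ i, df (j i) (j' i) ≤ R) → lam j' ≤ Λ) →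
    LocApp D N M (fun x => w (Φ x)) m (C * ((1/M)^s * Λ)) := by
  set R : ℕ := ⌈L*(N+1)⌉₊ + 1 with hR
  have hR1 : L*(N+1) + 1 ≤ R := by rw [hR]; push_cast; linarith [Nat.le_ceil (L*(N+1:ℝ))]
  obtain ⟨C1, hC1, hnear⟩ := near D (N+1) s R (by omega) hs
  obtain ⟨C2, hC2, hext⟩ := extrapD D (N+1) R (by positivity)
  refine ⟨R, C1 + s.factorial * (s.factorial * C2 * L^s) * (N+1)^s, ?_, ?_⟩
  · have : 0 ≤ s.factorial * (s.factorial * C2 * L^s) * (N+1:ℝ)^s := by positivity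
    linarith
  intro Φ Ψ hΦ M hM w hw P hP hwP lam hlam m j hj Λ hΛ i x hx
  have hM' : (0:ℝ) < M := by exact_mod_cast hM
  have hjj : lam j ≤ Λ := hΛ j fun i => by simp [df]
  have hlam0 : ∀ j, 0 ≤ lam j := fun j =>
    (norm_nonneg _).trans (hlam j _ (scaled_mem hM j (y := 0) fun i => by simp) 0 (Nat.zero_le _))
  have hΛ0 : 0 ≤ Λ := (hlam0 j).trans hjj
  have hjc := (mem_cell_iff hM).1 hj
  have hz : (fun i => ((m i:ℕ):ℝ)/M) ∈ ccube D := fun i => by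
    have h1 : ((m i:ℕ):ℝ) + 1 ≤ M := by exact_mod_cast (m i).2
    exact ⟨by positivity, by rw [div_le_one hM']; linarith⟩
  have dist : ∀ y ∈ ccube D, (∀ i, ((m i:ℕ):ℝ) - N ≤ M * y i ∧ M * y i ≤ (m i:ℕ) + 1) → ∀ i,
      |M * Φ y i - M * Φ (fun i => ((m i:ℕ):ℝ)/M) i| ≤ L*(N+1) := by
    intro y hy hym i
    have h1 : ‖y - (fun i => ((m i:ℕ):ℝ)/M)‖ ≤ (N+1)/M := by
      rw [pi_norm_le_iff_of_nonneg (by positivity)]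
      intro i
      rw [Real.norm_eq_abs, le_div_iff₀ hM', show |(y - fun i => ((m i:ℕ):ℝ)/M) i| * (M:ℝ) = |M * y i - (m i:ℕ)| by
        rw [← abs_of_pos hM', ← abs_mul, abs_of_pos hM']; congr 1; simp; field_simp]
      have h2 := hym i
      have h3 : (0:ℝ) ≤ N := by positivity
      rw [abs_le]; constructor <;> linarith
    have h2 := hΦ.lip1 y hy _ hz
    have h3 := (norm_le_pi_norm (Φ y - Φ (fun i => ((m i:ℕ):ℝ)/M)) i).trans h2
    rw [← mul_sub, abs_mul, abs_of_pos hM']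
    rw [Pi.sub_apply, Real.norm_eq_abs] at h3
    calc (M:ℝ) * _ ≤ M * (L * ((N+1)/M)) := by
          refine mul_le_mul_of_nonneg_left (h3.trans ?_) hM'.le
          gcongr
      _ = L * (N+1) := by field_simp
  set z := update x i 0 with hz'
  set v : Fin D → ℝ := Pi.single i (1/M) with hv
  have hline : ∀ τ : ℝ, update x i (τ/M) = z + τ • v := fun τ => by
    funext l
    by_cases h : l = i
    · subst h; simp [hz', hv]; ring
    · simp [hz', hv, h]
  have hvn : ‖v‖ = 1/M := by rw [hv, Pi.norm_single]; simp
  have hPΦ : ContDiff ℝ s (fun y => P j (Φ y)) :=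
    ((hP j).contDiff).comp (hΦ.smooth1.of_le (by exact_mod_cast hs))
  set a : ℝ := max ((m i:ℕ) - N) 0 with ha
  set b : ℝ := (m i:ℕ) + 1 with hb
  have hm0 : (0:ℝ) ≤ (m i:ℕ) := by positivity
  have hN0 : (0:ℝ) ≤ N := by positivity
  have hmM : b ≤ M := by rw [hb]; exact_mod_cast (m i).2
  have hab : a < b := max_lt (by linarith) (by linarith)
  have hba : b - a ≤ N + 1 := by have := le_max_left (((m i:ℕ):ℝ) - N) 0; linarith
  have hcl : ∀ τ ∈ Icc a b, update x i (τ/M) ∈ ccube D ∧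
      (∀ l, ((m l:ℕ):ℝ) - N ≤ M * update x i (τ/M) l ∧ M * update x i (τ/M) l ≤ (m l:ℕ) + 1) := by
    intro τ hτ
    have hτ1 := (le_max_left _ _).trans hτ.1
    have hτ2 := (le_max_right _ _).trans hτ.1
    have hτ3 := hτ.2
    constructor
    · intro l
      by_cases h : l = i
      · subst h; rw [update_self]; exact ⟨by positivity, by rw [div_le_one hM']; linarith⟩
      · rw [update_of_ne h]; exact ⟨(hx.1 l).1, (hx.1 l).2.le⟩
    · intro l
      by_cases h : l = i
      · subst h; rw [update_self, mul_div_cancel₀ _ hM'.ne']; exact ⟨hτ1, hτ3⟩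
      · rw [update_of_ne h]; exact ⟨(hx.2 l).1, (hx.2 l).2.le⟩
  obtain ⟨q, hq, hqb⟩ := taylorPoly s (fun τ => P j (Φ (z + τ • v))) (hPΦ.comp (by fun_prop)) a b
    (s.factorial * (s.factorial * (C2 * Λ) * L^s) * ‖v‖^s) hab (fun τ hτ => by
      refine comp_line z v (fun y => P j (Φ y)) s hPΦ τ _ fun k hk => ?_
      obtain ⟨h1, h2⟩ := hcl τ hτ
      rw [← hline]
      refine (norm_iteratedFDeriv_comp_le (N := (k:ℕ)) (g := P j) (f := Φ) (C := C2 * Λ) (D := L) (n := k) ((hP j).contDiff)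
        (hΦ.smooth1.of_le (by exact_mod_cast hk.trans hs)) le_rfl _ (fun l hl => ?_) (fun l hl1 hl2 => ?_)).trans ?_
      · refine (hext M hM (P j) (hP j) j l (lam j) (fun x hx => hlam j x hx l (hl.trans hk)) _ fun i' => ?_).trans (by gcongr)
        have h3 := abs_le.1 (dist _ h1 h2 i')
        have h4 := hjc i'
        rw [abs_le]; constructor <;> linarith
      · exact (hΦ.bound _ h1 l (by omega)).trans (le_self_pow₀ hL (by omega))
      · gcongr)
  refine ⟨q, by omega, fun τ hτ => ?_⟩
  have hτI : τ ∈ Icc a b := by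
    have h1 := hτ.2 i
    have h2 := (hτ.1 i).1
    rw [update_self] at h1 h2
    rw [mul_div_cancel₀ _ hM'.ne'] at h1
    refine ⟨max_le h1.1 ?_, h1.2.le⟩
    have := mul_nonneg h2 hM'.le
    rwa [div_mul_cancel₀ _ hM'.ne'] at this
  obtain ⟨h1, h2⟩ := hcl τ hτI
  obtain ⟨j', hj'⟩ := exists_cell hM (hΦ.hc1 _ hτ.1)
  have hdf : ∀ l, df (j l) (j' l) ≤ R := fun l => by
    have h3 := abs_le.1 (dist _ h1 h2 l)
    have h4 := hjc l
    have h5 := (mem_cell_iff hM).1 hj' l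
    rw [df_le]
    have r1 : ((j l:ℕ):ℝ) < (j' l:ℕ) + R + 1 := by linarith
    have r2 : ((j' l:ℕ):ℝ) < (j l:ℕ) + R + 1 := by linarith
    have r1' : (j l:ℕ) < (j' l:ℕ) + R + 1 := by exact_mod_cast r1
    have r2' : (j' l:ℕ) < (j l:ℕ) + R + 1 := by exact_mod_cast r2
    omega
  have A := hnear M hM w hw P hP hwP lam hlam j Λ hΛ j' hdf _ hj'
  have B := hqb τ hτI
  simp only [← hline] at B
  show |w (Φ (update x i (τ/M))) - q.eval τ| ≤ _
  have B' : s.factorial * (s.factorial * (C2 * Λ) * L^s) * ‖v‖^s * (b-a)^s ≤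
      s.factorial * (s.factorial * C2 * L^s) * (N+1)^s * ((1/M)^s * Λ) := by
    calc _ ≤ s.factorial * (s.factorial * (C2 * Λ) * L^s) * ‖v‖^s * (N+1)^s := by
          have := sub_nonneg.2 hab.le
          gcongr
      _ = _ := by rw [hvn]; ring
  rw [add_mul]
  exact (abs_sub_le _ _ _).trans (add_le_add A (B.trans B'))

end LPC

namespace LPC
open Set Function Filter Topology

open Classical in
theorem discErr (D N s : ℕ) (hD : 0 < D) (hN : 1 ≤ N) (L : ℝ) (hL : 1 ≤ L) (hs : s ≤ N+1) :
    ∃ d₀ C A : ℝ, d₀ ∈ Ioo (0:ℝ) 1 ∧ 0 < C ∧ 0 < A ∧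
    ∀ Φ Ψ, GoodMap D (N+1) L Φ Ψ → ∀ M K : ℕ, 1 ≤ M → 1 ≤ K → (M:ℝ) ≤ d₀ * K →
    ∀ x0 : (Fin D → Fin K) → (Fin D → ℝ), (∀ k, x0 k ∈ cell D K k) →
    ∀ w, IsSpline D M (N+1+1) w → ∀ P : (Fin D → Fin M) → (Fin D → ℝ) → ℝ, (∀ j, CP (N+1) (P j)) →
    (∀ j, ∀ x ∈ cell D M j, w x = P j x) → ∀ lam : (Fin D → Fin M) → ℝ,
    (∀ j, ∀ x ∈ cell D M j, ∀ k ≤ s, ‖iteratedFDeriv ℝ k (P j) x‖ ≤ lam j) →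
    ∀ uh, IsSpline D M (N+1) uh →
    (∀ v, IsSpline D M (N+1) v → ∑ k, uh (Ψ (x0 k)) * v (Ψ (x0 k)) = ∑ k, w (x0 k) * v (Ψ (x0 k))) →
    ∃ κ : (Fin D → Fin M) → (Fin D → Fin M) → ℝ, (∀ m j, 0 ≤ κ m j) ∧ (∀ m, ∑ j, κ m j ≤ A) ∧
      (∀ j, ∑ m, κ m j ≤ A) ∧ ∀ m, ∀ x ∈ cell D M m, |uh x - w (Φ x)| ≤ C * ((1/M)^s * ∑ j, κ m j * lam j) := by
  obtain ⟨d₀, c, C, hd₀, hc, hC, hpart⟩ := particles D N (N+1) L hL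
  obtain ⟨ϑ, C', hϑ, hC', hstab⟩ := stab D N hD hN c C hc hC
  obtain ⟨Cq, hCq, hquasi⟩ := quasiD D N hN
  obtain ⟨R, Cl, hCl, hloc⟩ := locapp D N s L hL hs
  have hϑ1 : 0 < 1 - ϑ := by linarith [hϑ.2]
  refine ⟨d₀, (C'+1) * (Cq * Cl), (2/(1-ϑ))^D * ((2*R+1)^D + (2*(L*(R+1))+1)^D), hd₀, by positivity, by positivity, ?_⟩
  intro Φ Ψ hΦ M K hM hK hMK x0 hx0 w hw P hP hwP lam hlam uh huh heq
  have hM' : (0:ℝ) < M := by exact_mod_cast hM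
  have hK' : (0:ℝ) < K := by exact_mod_cast hK
  have hlam0 : ∀ j, 0 ≤ lam j := fun j =>
    (norm_nonneg _).trans (hlam j _ (scaled_mem hM j (y := 0) fun i => by simp) 0 (Nat.zero_le _))
  have hmz : ∀ m : Fin D → Fin M, (fun i => ((m i:ℕ):ℝ)/M) ∈ hcube D := fun m i => by
    have h1 : ((m i:ℕ):ℝ) + 1 ≤ M := by exact_mod_cast (m i).2
    exact ⟨by positivity, by rw [div_lt_one hM']; linarith⟩
  choose J hJ using fun m : Fin D → Fin M => exists_cell hM (hΦ.hc1 _ (hmz m))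
  set I : (Fin D → Fin M) → (Fin D → Fin M) → ℝ := fun m j => if ∀ i, df (J m i) (j i) ≤ R then 1 else 0 with hI
  have hI0 : ∀ m j, 0 ≤ I m j := fun m j => by simp only [hI]; split_ifs <;> norm_num
  set Θ : (Fin D → Fin M) → (Fin D → Fin M) → ℝ := fun m m0 => ∏ i, ϑ ^ df (m i) (m0 i) with hΘ
  have hΘ0 : ∀ m j, 0 ≤ Θ m j := fun m j => Finset.prod_nonneg fun i _ => pow_nonneg hϑ.1.le _
  have hΘ1 : ∀ m, Θ m m = 1 := fun m => by simp [hΘ, df]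
  have hΘs : ∀ m m0, Θ m m0 = Θ m0 m := fun m m0 => by simp only [hΘ, df_comm]
  have hksum := kernel_sum D M ϑ hϑ
  set Λ : (Fin D → Fin M) → ℝ := fun m => ∑ j, I m j * lam j with hΛ
  have hΛ0 : ∀ m, 0 ≤ Λ m := fun m => Finset.sum_nonneg fun j _ => mul_nonneg (hI0 m j) (hlam0 j)
  obtain ⟨v, hv, hvq⟩ := hquasi M hM (fun x => w (Φ x))
  have hvb : ∀ m, ∀ x ∈ cell D M m, |v x - w (Φ x)| ≤ Cq * (Cl * ((1/M)^s * Λ m)) := by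
    intro m
    have := hΛ0 m
    refine hvq m _ (by positivity) (hloc Φ Ψ hΦ M hM w hw P hP hwP lam hlam m (J m) (hJ m) (Λ m) fun j' hj' => ?_)
    have h1 : I m j' = 1 := if_pos hj'
    have h2 := Finset.single_le_sum (f := fun j => I m j * lam j) (fun j _ => mul_nonneg (hI0 m j) (hlam0 j)) (Finset.mem_univ j')
    simp only [h1, one_mul] at h2
    exact h2
  choose ci hci using fun k => exists_cell hM (hΦ.hc2 _ (cell_sub hK (hx0 k)))
  obtain ⟨hp1, hp2⟩ := hpart Φ Ψ hΦ M K hM hK hMK x0 hx0 ci hci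
  have hdisc : Disc D N M c C (((K:ℝ)/M)^D) (fun k => Ψ (x0 k)) ci := ⟨hM, hc, hC, by positivity, hci, hp1, hp2⟩
  have hst := hstab M _ _ _ ci hdisc _ (sp_sub huh hv) (fun k => w (x0 k) - v (Ψ (x0 k)))
    (fun m => Cq * (Cl * ((1/M)^s * Λ m))) (fun m => by have := hΛ0 m; positivity) (fun k => by
      have := hvb _ _ (hci k)
      rw [hΦ.inv1] at this
      rwa [abs_sub_comm]) (fun v' hv' => by
      have := heq v' hv'
      simp only [sub_mul, Finset.sum_sub_distrib]
      rw [this])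
  have key : ∀ m, ∑ m0, Θ m m0 * (Cq * (Cl * ((1/M)^s * Λ m0))) =
      (Cq * Cl) * ((1/M)^s * ∑ j, (∑ m0, Θ m m0 * I m0 j) * lam j) := by
    intro m
    simp only [hΛ, Finset.mul_sum, Finset.sum_mul]
    rw [Finset.sum_comm]
    refine Finset.sum_congr rfl fun j _ => Finset.sum_congr rfl fun m0 _ => by ring
  refine ⟨fun m j => ∑ m0, Θ m m0 * I m0 j, fun m j => Finset.sum_nonneg fun m0 _ => mul_nonneg (hΘ0 _ _) (hI0 _ _), ?_, ?_, ?_⟩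
  · intro m
    rw [Finset.sum_comm]
    simp only [← Finset.mul_sum]
    calc ∑ m0, Θ m m0 * ∑ j, I m0 j ≤ ∑ m0, Θ m m0 * (2*R+1)^D := by
          refine Finset.sum_le_sum fun m0 _ => mul_le_mul_of_nonneg_left ?_ (hΘ0 _ _)
          simp only [hI, Finset.sum_boole]
          refine win_upperD D M (fun i => (J m0 i:ℕ)) R (by positivity) _ fun j hj i => ?_
          have := df_le.1 ((Finset.mem_filter.1 hj).2 i)
          have a1 : ((J m0 i:ℕ):ℝ) ≤ (j i:ℕ) + R := by exact_mod_cast this.1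
          have a2 : ((j i:ℕ):ℝ) ≤ (J m0 i:ℕ) + R := by exact_mod_cast this.2
          rw [abs_le]; constructor <;> linarith
      _ ≤ _ := by
          rw [← Finset.sum_mul]
          refine mul_le_mul (hksum m) (le_add_of_nonneg_right (by positivity)) (by positivity) (by positivity)
  · intro j
    rw [Finset.sum_comm]
    simp only [← Finset.sum_mul]
    calc ∑ m0, (∑ m, Θ m m0) * I m0 j ≤ ∑ m0, (2/(1-ϑ))^D * I m0 j := by
          refine Finset.sum_le_sum fun m0 _ => mul_le_mul_of_nonneg_right ?_ (hI0 _ _)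
          simp only [fun m => hΘs m m0]
          exact hksum m0
      _ ≤ _ := by
          rw [← Finset.mul_sum]
          refine mul_le_mul_of_nonneg_left (le_trans ?_ (le_add_of_nonneg_left (by positivity))) (by positivity)
          simp only [hI, Finset.sum_boole]
          refine win_upperD D M (fun i => M * Ψ (fun i => ((j i:ℕ):ℝ)/M) i) _ (by positivity) _ fun m0 hm0 i => ?_
          have hdf := (Finset.mem_filter.1 hm0).2
          have h1 : ‖Φ (fun i => ((m0 i:ℕ):ℝ)/M) - (fun i => ((j i:ℕ):ℝ)/M)‖ ≤ (R+1)/M := by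
            rw [pi_norm_le_iff_of_nonneg (by positivity)]
            intro l
            have := df_le.1 (hdf l)
            have a1 : ((J m0 l:ℕ):ℝ) ≤ (j l:ℕ) + R := by exact_mod_cast this.1
            have a2 : ((j l:ℕ):ℝ) ≤ (J m0 l:ℕ) + R := by exact_mod_cast this.2
            have a3 := (mem_cell_iff hM).1 (hJ m0) l
            rw [Real.norm_eq_abs, le_div_iff₀ hM', Pi.sub_apply, ← abs_of_pos hM', ← abs_mul, abs_of_pos hM', sub_mul, div_mul_cancel₀ _ hM'.ne', abs_le]
            constructor <;> linarith
          have h2 := hΦ.lip2 _ (hcube_sub D (hΦ.hc1 _ (hmz m0))) _ (hcube_sub D (hmz j))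
          rw [hΦ.inv2] at h2
          have h3 := (norm_le_pi_norm _ i).trans (h2.trans (mul_le_mul_of_nonneg_left h1 (by linarith)))
          rw [Pi.sub_apply, Real.norm_eq_abs, ← mul_div_assoc, le_div_iff₀ hM', ← abs_of_pos hM', ← abs_mul, abs_of_pos hM',
            sub_mul, div_mul_cancel₀ _ hM'.ne'] at h3
          rwa [mul_comm (M:ℝ)]
  · intro m x hx
    have h1 := hst m x hx
    have h2 := hvb m x hx
    have h3 : Cq * (Cl * ((1/M)^s * Λ m)) ≤ ∑ m0, Θ m m0 * (Cq * (Cl * ((1/M)^s * Λ m0))) := by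
      have := Finset.single_le_sum (f := fun m0 => Θ m m0 * (Cq * (Cl * ((1/M)^s * Λ m0))))
        (fun m0 _ => by have := hΛ0 m0; have := hΘ0 m m0; positivity) (Finset.mem_univ m)
      simp only [hΘ1, one_mul] at this
      exact this
    have h4 : |uh x - v x| ≤ C' * ∑ m0, Θ m m0 * (Cq * (Cl * ((1/M)^s * Λ m0))) := h1
    have h5 := (abs_sub_le (uh x) (v x) (w (Φ x))).trans (add_le_add h4 (h2.trans h3))
    rw [key] at h5
    refine h5.trans (le_of_eq ?_)
    ring

end LPC

namespace LPC
open Set Function Filter Topology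

theorem measurableSet_cell (D M : ℕ) (m : Fin D → Fin M) : MeasurableSet (cell D M m) := by
  have : cell D M m = Set.pi univ fun i => Ico (((m i:ℕ):ℝ)/M) ((((m i:ℕ):ℝ)+1)/M) := by
    ext x; simp [cell]
  rw [this]
  exact MeasurableSet.univ_pi fun i => measurableSet_Ico

theorem volume_cell {D M : ℕ} (m : Fin D → Fin M) :
    volume (cell D M m) = ENNReal.ofReal ((1/M)^D) := by
  have : cell D M m = Set.pi univ fun i => Ico (((m i:ℕ):ℝ)/M) ((((m i:ℕ):ℝ)+1)/M) := by
    ext x; simp [cell]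
  rw [this, Real.volume_pi_Ico, ENNReal.ofReal_pow (by positivity)]
  simp only [← sub_div, add_sub_cancel_left]
  simp

theorem lpow {α : Type*} {E : Type*} [NormedAddCommGroup E] [MeasurableSpace α] (μ : Measure α) (p : ℝ≥0∞) (hp : 1 ≤ p) (hp' : p ≠ ⊤) (f : α → E) :
    (eLpNorm f p μ)^p.toReal = ∫⁻ x, ‖f x‖ₑ^p.toReal ∂μ := by
  have h0 : p ≠ 0 := by rintro rfl; simp at hp
  rw [eLpNorm_eq_lintegral_rpow_enorm_toReal h0 hp', ← ENNReal.rpow_mul,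
    one_div_mul_cancel (ENNReal.toReal_pos h0 hp').ne', ENNReal.rpow_one]

theorem one_le_toReal {p : ℝ≥0∞} (hp : 1 ≤ p) (hp' : p ≠ ⊤) : 1 ≤ p.toReal := by
  have := ENNReal.toReal_mono hp' hp
  simpa using this

theorem tri {D M : ℕ} (hM : 1 ≤ M) (p : ℝ≥0∞) (hp : 1 ≤ p) (f g : (Fin D → ℝ) → ℝ) (T : (Fin D → Fin M) → ℝ≥0∞)
    (X : ℝ≥0∞) (hX : p ≠ ⊤ → ∑ m, ENNReal.ofReal ((1/M)^D) * T m ^ p.toReal ≤ X ^ p.toReal) (hX' : p = ⊤ → ∀ m, T m ≤ X)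
    (hf : ∀ m, ∀ x ∈ cell D M m, ‖f x‖ₑ ≤ T m + ‖g x‖ₑ) :
    eLpNorm f p (volume.restrict (unitCube D)) ≤ 2 * (X + eLpNorm g p (volume.restrict (unitCube D))) := by
  by_cases hp' : p = ⊤
  · subst hp'
    have h1 : eLpNorm f ⊤ (volume.restrict (unitCube D)) ≤ X + eLpNorm g ⊤ (volume.restrict (unitCube D)) := by
      simp only [eLpNorm_exponent_top]
      refine eLpNormEssSup_le_of_ae_enorm_bound ?_
      filter_upwards [enorm_ae_le_eLpNormEssSup g (volume.restrict (unitCube D)), ae_restrict_mem (measurableSet_unitCube D)] with x hx hxU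
      obtain ⟨m, hm⟩ := exists_cell hM (x := x) fun i => ⟨(hxU i).1.le, (hxU i).2⟩
      exact (hf m x hm).trans (add_le_add (hX' rfl m) hx)
    refine h1.trans ?_
    rw [two_mul]
    exact le_self_add
  have hq := one_le_toReal hp hp'
  set q := p.toReal with hqd
  have hq0 : 0 < q := by linarith
  set S : (Fin D → Fin M) → Set (Fin D → ℝ) := fun m => cell D M m ∩ unitCube D with hS
  have hSm : ∀ m, MeasurableSet (S m) := fun m => (measurableSet_cell D M m).inter (measurableSet_unitCube D)
  have hSd : Pairwise (Disjoint on S) := fun m m' hmm => by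
    rw [onFun, Set.disjoint_left]
    exact fun x hx hx' => hmm (cell_unique hM hx.1 hx'.1)
  have hSU : ⋃ m, S m = unitCube D := by
    ext x
    simp only [hS, mem_iUnion, mem_inter_iff]
    refine ⟨fun ⟨m, h⟩ => h.2, fun hxU => ?_⟩
    obtain ⟨m, hm⟩ := exists_cell hM (x := x) fun i => ⟨(hxU i).1.le, (hxU i).2⟩
    exact ⟨m, hm, hxU⟩
  have split : ∀ F : (Fin D → ℝ) → ℝ≥0∞, ∫⁻ x in unitCube D, F x = ∑ m, ∫⁻ x in S m, F x := fun F => by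
    rw [← hSU, lintegral_iUnion hSm hSd, tsum_fintype]
  have hT : ∀ m, ∫⁻ _ in S m, T m ^ q ≤ ENNReal.ofReal ((1/M)^D) * T m ^ q := fun m => by
    rw [setLIntegral_const, mul_comm]
    gcongr
    rw [← volume_cell m]
    exact measure_mono inter_subset_left
  have key : (eLpNorm f p (volume.restrict (unitCube D)))^q ≤ (2 * (X + eLpNorm g p (volume.restrict (unitCube D))))^q := by
    rw [lpow _ p hp hp', split]
    calc ∑ m, ∫⁻ x in S m, ‖f x‖ₑ^q ≤ ∑ m, ∫⁻ x in S m, 2^(q-1) * (T m ^q + ‖g x‖ₑ^q) := by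
          refine Finset.sum_le_sum fun m _ => setLIntegral_mono' (hSm m) fun x hx => ?_
          exact (ENNReal.rpow_le_rpow (hf m x hx.1) hq0.le).trans (ENNReal.rpow_add_le_mul_rpow_add_rpow _ _ hq)
      _ ≤ ∑ m, 2^(q-1) * (ENNReal.ofReal ((1/M)^D) * T m ^ q + ∫⁻ x in S m, ‖g x‖ₑ^q) := by
          refine Finset.sum_le_sum fun m _ => ?_
          rw [lintegral_const_mul' _ _ (ENNReal.rpow_ne_top_of_nonneg (by linarith) (by simp)), lintegral_add_left measurable_const]
          gcongr
          exact hT m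
      _ = 2^(q-1) * (∑ m, ENNReal.ofReal ((1/M)^D) * T m ^ q + (eLpNorm g p (volume.restrict (unitCube D)))^q) := by
          rw [← Finset.mul_sum, Finset.sum_add_distrib, lpow _ p hp hp', split]
      _ ≤ 2^q * (X^q + (eLpNorm g p (volume.restrict (unitCube D)))^q) := by
          gcongr
          · norm_num
          · linarith
          · exact hX hp'
      _ ≤ _ := by
          rw [ENNReal.mul_rpow_of_nonneg _ _ hq0.le]
          gcongr
          exact ENNReal.add_rpow_le_rpow_add _ _ hq
  exact (ENNReal.rpow_le_rpow_iff hq0).1 key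

theorem schur {ι : Type*} [Fintype ι] (q : ℝ) (hq : 1 ≤ q) (κ : ι → ι → ℝ≥0∞) (A : ℝ≥0∞) (hA0 : A ≠ 0) (hA : A ≠ ⊤)
    (h1 : ∀ m, ∑ j, κ m j ≤ A) (h2 : ∀ j, ∑ m, κ m j ≤ A) (e : ι → ℝ≥0∞) :
    ∑ m, (∑ j, κ m j * e j)^q ≤ A^q * ∑ j, e j ^ q := by
  have hq0 : 0 < q := by linarith
  have hq1 : 0 ≤ 1 - q⁻¹ := by
    have := inv_le_one_of_one_le₀ hq
    linarith
  have step : ∀ m, (∑ j, κ m j * e j)^q ≤ A^(q-1) * ∑ j, κ m j * e j^q := by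
    intro m
    have h := ENNReal.rpow_le_rpow (ENNReal.inner_le_weight_mul_Lp_of_nonneg Finset.univ hq (κ m) e) hq0.le
    refine h.trans ?_
    rw [ENNReal.mul_rpow_of_nonneg _ _ hq0.le, ← ENNReal.rpow_mul, ← ENNReal.rpow_mul, inv_mul_cancel₀ hq0.ne', ENNReal.rpow_one,
      sub_mul, inv_mul_cancel₀ hq0.ne', one_mul]
    gcongr
    exact h1 m
  calc _ ≤ ∑ m, A^(q-1) * ∑ j, κ m j * e j^q := Finset.sum_le_sum fun m _ => step m
    _ = A^(q-1) * ∑ j, (∑ m, κ m j) * e j^q := by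
      rw [← Finset.mul_sum, Finset.sum_comm]
      simp only [Finset.sum_mul]
    _ ≤ A^(q-1) * ∑ j, A * e j^q := by
      gcongr with j _
      exact h2 j
    _ = A^q * ∑ j, e j ^ q := by
      rw [← Finset.mul_sum, ← mul_assoc]
      congr 1
      nth_rewrite 2 [← ENNReal.rpow_one A]
      rw [← ENNReal.rpow_add _ _ hA0 hA, sub_add_cancel]

def ocell (D M : ℕ) (k : Fin D → Fin M) : Set (Fin D → ℝ) :=
  Set.pi univ fun i => Ioo (((k i:ℕ):ℝ)/M) ((((k i:ℕ):ℝ)+1)/M)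

theorem isOpen_ocell (D M : ℕ) (k : Fin D → Fin M) : IsOpen (ocell D M k) :=
  isOpen_set_pi finite_univ fun _ _ => isOpen_Ioo

theorem ocell_cell {D M : ℕ} {k : Fin D → Fin M} : ocell D M k ⊆ cell D M k := fun x hx i =>
  ⟨(hx i (mem_univ i)).1.le, (hx i (mem_univ i)).2⟩

theorem ocell_cube {D M : ℕ} (hM : 1 ≤ M) {k : Fin D → Fin M} : ocell D M k ⊆ unitCube D := fun x hx i => by
  have h := cell_sub hM (ocell_cell hx) i
  exact ⟨lt_of_le_of_lt (by positivity) (hx i (mem_univ i)).1, h.2⟩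

theorem cellBound (D n : ℕ) (p : ℝ≥0∞) (hp : 1 ≤ p) : ∃ ρ : ℝ, 0 < ρ ∧ ∀ M : ℕ, 1 ≤ M → ∀ f : (Fin D → ℝ) → ℝ, CP n f →
    ∀ (j : Fin D → Fin M) (k : ℕ), eLpNorm (fun x => ‖iteratedFDeriv ℝ k f x‖) p (volume.restrict (ocell D M j)) ≠ ⊤ →
    ∀ y ∈ cell D M j, ‖iteratedFDeriv ℝ k f y‖ * ((2*(ρ*(1/M)))^D)^(1/p.toReal) ≤
      4 * (eLpNorm (fun x => ‖iteratedFDeriv ℝ k f x‖) p (volume.restrict (ocell D M j))).toReal := by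
  obtain ⟨ρ, hρ0, hρ8, hρ⟩ := norming D n
  refine ⟨ρ, hρ0, ?_⟩
  intro M hM f hf j k he y hy
  have hM' : (0:ℝ) < M := by exact_mod_cast hM
  have h0 : p ≠ 0 := by rintro rfl; simp at hp
  set e := eLpNorm (fun x => ‖iteratedFDeriv ℝ k f x‖) p (volume.restrict (ocell D M j)) with hedef
  set c : ℝ := ((2*(ρ*(1/M)))^D)^(1/p.toReal) with hc
  have hc0 : 0 < c := by positivity
  rw [← le_div_iff₀ hc0]
  refine ContinuousMultilinearMap.opNorm_le_bound (by positivity) fun v => ?_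
  obtain ⟨z, hz, hzb⟩ := hρ _ ((hf.iter k v).affine (1/M) (fun i => ((j i:ℕ):ℝ)/M))
  set B := Metric.closedBall (fun i => ((j i:ℕ):ℝ)/M + 1/M * z i) (ρ*(1/M)) with hB
  have hr0 : 0 ≤ ρ*(1/M) := by positivity
  have hBz : ∀ x ∈ B, ‖(fun i => M * x i - (j i:ℕ)) - z‖ ≤ ρ := by
    intro x hx
    rw [hB, Metric.mem_closedBall, dist_eq_norm] at hx
    rw [pi_norm_le_iff_of_nonneg hρ0.le]
    intro i
    have h1 := (norm_le_pi_norm _ i).trans hx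
    rw [Pi.sub_apply, Real.norm_eq_abs, mul_one_div, le_div_iff₀ hM', ← abs_of_pos hM', ← abs_mul, abs_of_pos hM'] at h1
    rw [Pi.sub_apply, Real.norm_eq_abs]
    refine le_trans (le_of_eq (congrArg _ ?_)) h1
    show M * x i - (j i:ℕ) - z i = (x i - (((j i:ℕ):ℝ)/M + 1/M * z i)) * M
    field_simp
    ring
  have hBo : B ⊆ ocell D M j := by
    intro x hx i _
    have h1 := (norm_le_pi_norm _ i).trans (hBz x hx)
    rw [Pi.sub_apply, Real.norm_eq_abs, abs_le] at h1
    have h2 := hz i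
    constructor
    · rw [div_lt_iff₀ hM']; linarith [h2.1, h1.1, mul_comm (M:ℝ) (x i)]
    · rw [lt_div_iff₀ hM']; linarith [h2.2, h1.2, mul_comm (M:ℝ) (x i)]
  have hpt : ∀ x ∈ B, ‖iteratedFDeriv ℝ k f y v‖ ≤ (4 * ∏ i, ‖v i‖) * ‖‖iteratedFDeriv ℝ k f x‖‖ := by
    intro x hx
    have h1 := hzb _ (unscaled_mem hM j hy) _ (hBz x hx)
    simp only [scaled_unscaled hM j] at h1
    have h2 := (iteratedFDeriv ℝ k f x).le_opNorm v
    rw [Real.norm_eq_abs] at h2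
    rw [norm_norm, Real.norm_eq_abs]
    refine h1.trans ?_
    linarith
  have hvolB : volume B = ENNReal.ofReal ((2*(ρ*(1/M)))^D) := by
    rw [hB, Real.volume_pi_closedBall _ hr0, Fintype.card_fin]
  have hμ : volume.restrict B ≠ 0 := by
    rw [Ne, Measure.restrict_eq_zero, hvolB]
    simp only [ENNReal.ofReal_eq_zero, not_le]
    positivity
  have h3 := eLpNorm_le_mul_eLpNorm_of_ae_le_mul (μ := volume.restrict B) (f := fun _ => iteratedFDeriv ℝ k f y v)
    (g := fun x => ‖iteratedFDeriv ℝ k f x‖) (c := 4 * ∏ i, ‖v i‖)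
    (ae_restrict_of_forall_mem Metric.isClosed_closedBall.measurableSet hpt) p
  rw [eLpNorm_const _ h0 hμ, Measure.restrict_apply_univ, hvolB, ENNReal.ofReal_rpow_of_pos (by positivity), ← hc] at h3
  have h4 := h3.trans (mul_le_mul_right (eLpNorm_mono_measure (fun x => ‖iteratedFDeriv ℝ k f x‖) (Measure.restrict_mono_set volume hBo)) _)
  have h5 := ENNReal.toReal_mono (ENNReal.mul_ne_top ENNReal.ofReal_ne_top he) h4
  have hprod : 0 ≤ ∏ i, ‖v i‖ := Finset.prod_nonneg fun i _ => norm_nonneg _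
  rw [ENNReal.toReal_mul, ENNReal.toReal_mul, toReal_enorm, ENNReal.toReal_ofReal hc0.le, ENNReal.toReal_ofReal (by positivity)] at h5
  rw [div_mul_eq_mul_div, le_div_iff₀ hc0]
  refine h5.trans (le_of_eq ?_)
  ring

end LPC

namespace LPC
open Set Function Filter Topology

theorem sumE {D M : ℕ} (hM : 1 ≤ M) (s : ℕ) (p : ℝ≥0∞) (hp : 1 ≤ p) (hp' : p ≠ ⊤) (w : (Fin D → ℝ) → ℝ) :
    ∑ j : Fin D → Fin M, ((Finset.range (s+1)).sup fun k =>
      eLpNorm (fun x => ‖iteratedFDeriv ℝ k w x‖) p (volume.restrict (ocell D M j)))^p.toReal ≤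
    ((s+1 : ℕ) * sobolevNorm D s p w)^p.toReal := by
  have hq := one_le_toReal hp hp'
  set q := p.toReal with hqd
  have hq0 : 0 < q := by linarith
  set e : (Fin D → Fin M) → ℕ → ℝ≥0∞ := fun j k =>
    eLpNorm (fun x => ‖iteratedFDeriv ℝ k w x‖) p (volume.restrict (ocell D M j)) with he
  have h1 : ∀ j, ((Finset.range (s+1)).sup (e j))^q ≤ ∑ k ∈ Finset.range (s+1), e j k ^ q := by
    intro j
    obtain ⟨k, hk, hk'⟩ := Finset.exists_mem_eq_sup (Finset.range (s+1)) ⟨0, by simp⟩ (e j)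
    rw [hk']
    exact Finset.single_le_sum (f := fun k => e j k ^ q) (fun _ _ => zero_le) hk
  have h2 : ∀ k ∈ Finset.range (s+1), ∑ j, e j k ^ q ≤ (sobolevNorm D s p w)^q := by
    intro k hk
    have hd : Pairwise (Disjoint on fun j : Fin D → Fin M => ocell D M j) := fun m m' hmm => by
      rw [onFun, Set.disjoint_left]
      exact fun x hx hx' => hmm (cell_unique hM (ocell_cell hx) (ocell_cell hx'))
    have h3 : ∑ j, e j k ^ q ≤ (eLpNorm (fun x => ‖iteratedFDeriv ℝ k w x‖) p (volume.restrict (unitCube D)))^q := by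
      simp only [he, hqd, lpow _ p hp hp']
      rw [← tsum_fintype (L := .unconditional _), ← lintegral_iUnion (fun j => (isOpen_ocell D M j).measurableSet) hd]
      exact lintegral_mono_set (iUnion_subset fun j => ocell_cube hM)
    refine h3.trans (ENNReal.rpow_le_rpow ?_ hq0.le)
    exact Finset.le_sup (f := fun k => eLpNorm (fun x => ‖iteratedFDeriv ℝ k w x‖) p (volume.restrict (unitCube D))) hk
  calc _ ≤ ∑ j, ∑ k ∈ Finset.range (s+1), e j k ^ q := Finset.sum_le_sum fun j _ => h1 j
    _ = ∑ k ∈ Finset.range (s+1), ∑ j, e j k ^ q := Finset.sum_comm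
    _ ≤ ∑ k ∈ Finset.range (s+1), (sobolevNorm D s p w)^q := Finset.sum_le_sum h2
    _ = (s+1 : ℕ) * (sobolevNorm D s p w)^q := by rw [Finset.sum_const, Finset.card_range, nsmul_eq_mul]
    _ ≤ ((s+1 : ℕ) : ℝ≥0∞)^q * (sobolevNorm D s p w)^q := by
      gcongr
      have : (1:ℝ≥0∞) ≤ (s+1:ℕ) := by exact_mod_cast Nat.succ_le_succ (Nat.zero_le s)
      exact ENNReal.le_rpow_self_of_one_le this hq
    _ = _ := (ENNReal.mul_rpow_of_nonneg _ _ hq0.le).symm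

end LPC

/-- `L^p(Ω)`-convergence, Theorem 2 of the paper.
Let `n ≥ 2`, `p ∈ [1,∞]`, `C₀ > 0` and `0 ≤ s ≤ n`.  There are constants `d₀ ∈ (0,1)` and
`C > 0` depending only on the velocity field (through `F`), `n`, `s`, `p`, `D`, `T` and
`C₀` such that for all `σ = 1/M` and `h = dσ = 1/K` with `0 < d ≤ d₀`: if
`u₀ ∈ W^{s,p}(Ω)`, `w₀ ∈ V_σ^{n+1}(Ω)` satisfies
`‖u₀ − w₀‖_{L^p(Ω)} ≤ C₀ σ^r ‖u₀‖_{W^{r,p}(Ω)}` and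
`‖w₀‖_{W^{r,p}(Ω)} ≤ C₀ ‖u₀‖_{W^{r,p}(Ω)}` for all `0 ≤ r ≤ min s n`,
the particle strengths are `u_i = w₀(x_i(0))`, `u(x,t) = u₀(X_{t→0}(x))` is the exact
solution, and `u_{h,σ}(·,t) ∈ V_σ^n(Ω)` solves
`Σ_i w_i u_{h,σ}(x_i(t)) v(x_i(t)) = Σ_i w_i u_i v(x_i(t))` for all `v ∈ V_σ^n(Ω)`, then
for every `t ∈ [0,T]`:
`‖u_{h,σ}(·,t) − u(·,t)‖_{L^p(Ω)} ≤ C σ^s ‖u₀‖_{W^{s,p}(Ω)}`. -/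
theorem lp_convergence
    (D : ℕ) (hD : 0 < D) (T : ℝ) (hT : 0 < T) (F : FlowData D T)
    (n : ℕ) (hn : 2 ≤ n) (p : ℝ≥0∞) (hp : 1 ≤ p) (C₀ : ℝ) (hC₀ : 0 < C₀)
    (s : ℕ) (hs : s ≤ n) :
    ∃ d₀ C : ℝ, d₀ ∈ Set.Ioo (0 : ℝ) 1 ∧ 0 < C ∧
      ∀ M K : ℕ, 0 < M → 0 < K → (M : ℝ) ≤ d₀ * (K : ℝ) →
      ∀ x0 : (Fin D → Fin K) → (Fin D → ℝ), (∀ k, x0 k ∈ cell D K k) →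
      ∀ u₀ : (Fin D → ℝ) → ℝ, sobolevNorm D s p u₀ ≠ ⊤ →
      ∀ w₀ : (Fin D → ℝ) → ℝ, IsSpline D M (n + 1) w₀ →
        (∀ r : ℕ, r ≤ min s n →
          eLpNorm (fun x => u₀ x - w₀ x) p (volume.restrict (unitCube D)) ≤
              ENNReal.ofReal (C₀ * ((1 : ℝ) / M) ^ r) * sobolevNorm D r p u₀ ∧
            sobolevNorm D r p w₀ ≤ ENNReal.ofReal C₀ * sobolevNorm D r p u₀) →
      ∀ t ∈ Set.Icc (0 : ℝ) T,
      ∀ uhσ : (Fin D → ℝ) → ℝ, IsSpline D M n uhσ →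
        (∀ v : (Fin D → ℝ) → ℝ, IsSpline D M n v →
          ∑ k : Fin D → Fin K, ((1 : ℝ) / K) ^ D * uhσ (F.X 0 t (x0 k)) * v (F.X 0 t (x0 k)) =
          ∑ k : Fin D → Fin K, ((1 : ℝ) / K) ^ D * w₀ (x0 k) * v (F.X 0 t (x0 k))) →
        eLpNorm (fun x => uhσ x - u₀ (F.X t 0 x)) p (volume.restrict (unitCube D)) ≤
          ENNReal.ofReal (C * ((1 : ℝ) / M) ^ s) * sobolevNorm D s p u₀ := by
  obtain ⟨N, rfl⟩ : ∃ N, n = N + 1 := ⟨n - 1, by omega⟩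
  obtain ⟨L, hG⟩ := LPC.exists_goodMap hT F (N+1) (by omega)
  have hL : 1 ≤ L := (hG 0 ⟨le_rfl, hT.le⟩).one_le
  obtain ⟨d₀, C, A, hd₀, hC, hA, hdisc⟩ := LPC.discErr D N s hD (by omega) L hL hs
  obtain ⟨ρ, hρ0, hcb⟩ := LPC.cellBound D (N+1) p hp
  set α : ℝ := 1/p.toReal with hα
  set B0 : ℝ := 4/((2*ρ)^D)^α with hB0
  have hB0p : 0 < B0 := by positivity
  refine ⟨d₀, 2*(C*A*(B0*(s+1))*C₀ + L^D*C₀), hd₀, by positivity, ?_⟩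
  intro M K hM hK hMK x0 hx0 u₀ hu₀ w hw hyp t ht uh huh heq
  have hM' : (0:ℝ) < M := by exact_mod_cast hM
  have hK' : (0:ℝ) < K := by exact_mod_cast hK
  obtain ⟨hy1, hy2⟩ := hyp s (le_min le_rfl hs)
  have hGt := hG t ht
  set Φ := F.X t 0 with hΦ
  set Ψ := F.X 0 t with hΨ
  set S := sobolevNorm D s p u₀ with hS
  set σ : ℝ := 1/M with hσ
  have hσ0 : 0 < σ := by positivity
  have hWtop : sobolevNorm D s p w ≠ ⊤ := ne_top_of_le_ne_top (ENNReal.mul_ne_top ENNReal.ofReal_ne_top hu₀) hy2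
  choose P hP hwP using (LPC.sp_iff.1 hw).2
  set e : (Fin D → Fin M) → ℕ → ℝ≥0∞ := fun j k =>
    eLpNorm (fun x => ‖iteratedFDeriv ℝ k w x‖) p (volume.restrict (LPC.ocell D M j)) with he
  set E : (Fin D → Fin M) → ℝ≥0∞ := fun j => (Finset.range (s+1)).sup (e j) with hE
  have hES : ∀ j, E j ≤ sobolevNorm D s p w := fun j =>
    Finset.sup_mono_fun fun k _ => eLpNorm_mono_measure _ (Measure.restrict_mono_set volume (LPC.ocell_cube hM))
  have hEtop : ∀ j, E j ≠ ⊤ := fun j => ne_top_of_le_ne_top hWtop (hES j)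
  have heP : ∀ j k, eLpNorm (fun x => ‖iteratedFDeriv ℝ k (P j) x‖) p (volume.restrict (LPC.ocell D M j)) = e j k := by
    intro j k
    refine eLpNorm_congr_ae ?_
    filter_upwards [ae_restrict_mem (LPC.isOpen_ocell D M j).measurableSet] with x hx
    have h1 : w =ᶠ[nhds x] P j := by
      filter_upwards [(LPC.isOpen_ocell D M j).mem_nhds hx] with y hy
      exact hwP j y (LPC.ocell_cell hy)
    rw [(h1.iteratedFDeriv (𝕜 := ℝ) k).eq_of_nhds]
  have hα0 : 0 ≤ α := by positivity
  set c : ℝ := ((2*(ρ*σ))^D)^α with hc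
  have hc0 : 0 < c := by positivity
  have hcB : 4/c = B0 * ((σ^D)^α)⁻¹ := by
    rw [hc, hB0, ← mul_assoc, mul_pow (2*ρ) σ, Real.mul_rpow (by positivity) (by positivity)]
    field_simp
  set lam : (Fin D → Fin M) → ℝ := fun j => 4/c * (E j).toReal with hlam
  have hlamb : ∀ j, ∀ x ∈ cell D M j, ∀ k ≤ s, ‖iteratedFDeriv ℝ k (P j) x‖ ≤ lam j := by
    intro j x hx k hk
    have hek : e j k ≤ E j := Finset.le_sup (Finset.mem_range.2 (by omega))
    have h1 := hcb M hM (P j) (hP j) j k (by rw [heP]; exact ne_top_of_le_ne_top (hEtop j) hek) x hx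
    rw [heP, ← hσ, ← hc, ← le_div_iff₀ hc0] at h1
    refine h1.trans ?_
    simp only [hlam]
    rw [div_mul_eq_mul_div]
    gcongr
    exact hEtop j
  obtain ⟨κ, hκ0, hκ1, hκ2, hκ⟩ := hdisc Φ Ψ hGt M K hM hK hMK x0 hx0 w hw P hP hwP lam hlamb uh huh (fun v hv => by
    have h1 := heq v hv
    simp only [mul_assoc, ← Finset.mul_sum] at h1
    exact mul_left_cancel₀ (by positivity) h1)
  set κ' : (Fin D → Fin M) → (Fin D → Fin M) → ℝ≥0∞ := fun m j => ENNReal.ofReal (C*σ^s*κ m j) with hκ'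
  set A' : ℝ≥0∞ := ENNReal.ofReal (C*σ^s*A) with hA'
  have hκ'1 : ∀ m, ∑ j, κ' m j ≤ A' := fun m => by
    simp only [hκ', hA']
    rw [← ENNReal.ofReal_sum_of_nonneg fun j _ => by have := hκ0 m j; positivity, ← Finset.mul_sum]
    exact ENNReal.ofReal_le_ofReal (mul_le_mul_of_nonneg_left (hκ1 m) (by positivity))
  have hκ'2 : ∀ j, ∑ m, κ' m j ≤ A' := fun j => by
    simp only [hκ', hA']
    rw [← ENNReal.ofReal_sum_of_nonneg fun m _ => by have := hκ0 m j; positivity, ← Finset.mul_sum]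
    exact ENNReal.ofReal_le_ofReal (mul_le_mul_of_nonneg_left (hκ2 j) (by positivity))
  set ell : (Fin D → Fin M) → ℝ≥0∞ := fun j => ENNReal.ofReal (4/c) * E j with hell
  have hell' : ∀ j, ENNReal.ofReal (lam j) = ell j := fun j => by
    simp only [hlam, hell]
    rw [ENNReal.ofReal_mul (by positivity), ENNReal.ofReal_toReal (hEtop j)]
  have hA'0 : A' ≠ 0 := by simp only [hA', Ne, ENNReal.ofReal_eq_zero, not_le]; positivity
  have hpt : ∀ m, ∀ x ∈ cell D M m, ‖uh x - u₀ (Φ x)‖ₑ ≤ (∑ j, κ' m j * ell j) + ‖u₀ (Φ x) - w (Φ x)‖ₑ := by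
    intro m x hx
    have h1 := hκ m x hx
    have h2 : ‖uh x - w (Φ x)‖ₑ ≤ ∑ j, κ' m j * ell j := by
      rw [← ofReal_norm, Real.norm_eq_abs]
      refine (ENNReal.ofReal_le_ofReal h1).trans (le_of_eq ?_)
      simp only [← hell', hκ']
      rw [Finset.mul_sum, Finset.mul_sum, ENNReal.ofReal_sum_of_nonneg fun j _ => by
        have := hκ0 m j
        have : 0 ≤ lam j := by simp only [hlam]; positivity
        positivity]
      refine Finset.sum_congr rfl fun j _ => ?_
      rw [← ENNReal.ofReal_mul (by have := hκ0 m j; positivity)]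
      congr 1
      ring
    have h3 : uh x - u₀ (Φ x) = (uh x - w (Φ x)) - (u₀ (Φ x) - w (Φ x)) := by ring
    rw [h3]
    exact enorm_sub_le.trans (add_le_add_left h2 _)
  have htri := LPC.tri hM p hp (fun x => uh x - u₀ (Φ x)) (fun x => u₀ (Φ x) - w (Φ x)) (fun m => ∑ j, κ' m j * ell j)
    (A' * (ENNReal.ofReal B0 * ((s+1:ℕ) * sobolevNorm D s p w))) (fun hp' => ?_) (fun hp' m => ?_) hpt
  · have hcomp := LPC.comp_eLpNorm hGt p hp (fun x => u₀ x - w x)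
    have hY := hcomp.trans (mul_le_mul_right hy1 _)
    refine htri.trans ?_
    have hs1 : ((s+1:ℕ):ℝ≥0∞) = ENNReal.ofReal (s+1) := by
      rw [← ENNReal.ofReal_natCast]; push_cast; rfl
    calc _ ≤ 2 * (A' * (ENNReal.ofReal B0 * ((s+1:ℕ) * (ENNReal.ofReal C₀ * S))) +
          ENNReal.ofReal (L^D) * (ENNReal.ofReal (C₀ * σ^s) * S)) := by gcongr
      _ = _ := by
        rw [hs1, hA', ← ENNReal.ofReal_ofNat 2]
        simp only [← mul_assoc]
        rw [← ENNReal.ofReal_mul (by positivity), ← ENNReal.ofReal_mul (by positivity), ← ENNReal.ofReal_mul (by positivity),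
          mul_assoc (ENNReal.ofReal (L^D)), ← mul_assoc (ENNReal.ofReal (L^D)), ← ENNReal.ofReal_mul (by positivity), ← add_mul,
          ← ENNReal.ofReal_add (by positivity) (by positivity), ← mul_assoc, ← ENNReal.ofReal_mul (by positivity)]
        congr 2
        ring
  · have hq := LPC.one_le_toReal hp hp'
    have hq0 : 0 < p.toReal := by linarith
    rw [← Finset.mul_sum]
    have h1 := LPC.schur p.toReal hq κ' A' hA'0 ENNReal.ofReal_ne_top hκ'1 hκ'2 ell
    have h2 := LPC.sumE hM s p hp hp' w
    calc _ ≤ ENNReal.ofReal (σ^D) * (A'^p.toReal * ∑ j, ell j ^ p.toReal) := by gcongr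
      _ = A'^p.toReal * (ENNReal.ofReal B0 ^ p.toReal * ∑ j, E j ^ p.toReal) := by
        simp only [hell, ENNReal.mul_rpow_of_nonneg _ _ hq0.le]
        rw [← Finset.mul_sum, mul_left_comm]
        congr 1
        rw [← mul_assoc]
        congr 1
        rw [ENNReal.ofReal_rpow_of_pos (by positivity), ENNReal.ofReal_rpow_of_pos hB0p, ← ENNReal.ofReal_mul (by positivity), hcB,
          Real.mul_rpow hB0p.le (by positivity), Real.inv_rpow (by positivity), ← Real.rpow_mul (by positivity), hα,
          one_div_mul_cancel hq0.ne', Real.rpow_one]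
        congr 1
        field_simp
      _ ≤ A'^p.toReal * (ENNReal.ofReal B0 ^ p.toReal * ((s+1:ℕ) * sobolevNorm D s p w)^p.toReal) := by gcongr
      _ = _ := by rw [ENNReal.mul_rpow_of_nonneg A' _ hq0.le, ENNReal.mul_rpow_of_nonneg (ENNReal.ofReal B0) _ hq0.le]
  · have hα' : α = 0 := by rw [hα, hp']; simp
    have h4 : 4/c = B0 := by rw [hcB, hα']; simp
    calc ∑ j, κ' m j * ell j ≤ ∑ j, κ' m j * (ENNReal.ofReal B0 * ((s+1:ℕ) * sobolevNorm D s p w)) := by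
          refine Finset.sum_le_sum fun j _ => mul_le_mul_right ?_ _
          simp only [hell, h4]
          refine mul_le_mul_right ((hES j).trans ?_) _
          refine le_mul_of_one_le_left zero_le ?_
          exact_mod_cast Nat.succ_le_succ (Nat.zero_le s)
      _ ≤ _ := by
          rw [← Finset.sum_mul]
          exact mul_le_mul_left (hκ'1 m) _

end
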